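/- Let M be a minimally vertically 4-connected matroid with at least six elements that is not isomorphic to N_9. Then M has a 4-element cocircuit, or a 5-element cocircuit that contains a triangle. -/

import Mathlib

open Set Matroid

universe u

variable {α : Type u}

/-- The rank of a set `X` in a matroid `M`: the supremum of the cardinalities of the
independent subsets of `X`. -/
noncomputable def mrk (M : Matroid α) (X : Set α) : ℕ∞ :=
  ⨆ I ∈ {I : Set α | M.Indep I ∧ I ⊆ X}, I.encard

/-- The rank `r(M)` of a matroid `M`. -/
noncomputable def mrank (M : Matroid α) : ℕ∞ := mrk M M.E

/-- The connectivity function `λ_M(X) = r(X) + r(E(M) - X) - r(M)`. -/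
noncomputable def lam (M : Matroid α) (X : Set α) : ℕ∞ :=
  mrk M X + mrk M (M.E \ X) - mrank M

/-- The deletion `M \ D` of a set of elements `D` from `M`. -/
def mdel (M : Matroid α) (D : Set α) : Matroid α := M ↾ (M.E \ D)

/-- A circuit of a matroid: a minimal dependent set. -/
def MCircuit (M : Matroid α) (C : Set α) : Prop := M.Dep C ∧ ∀ D, D ⊂ C → M.Indep D

/-- A cocircuit of a matroid: a circuit of the dual matroid. -/
def MCocircuit (M : Matroid α) (C : Set α) : Prop := MCircuit M✶ C

/-- A triangle: a 3-element circuit. -/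
def IsTriangle (M : Matroid α) (T : Set α) : Prop := MCircuit M T ∧ T.encard = 3

/-- `(X, Y)` is a vertical `j`-separation of `M`: a partition of `E(M)` with
`λ_M(X) < j` and `min {r(X), r(Y)} ≥ j`. -/
def IsVSep (M : Matroid α) (j : ℕ) (X Y : Set α) : Prop :=
  X ∪ Y = M.E ∧ Disjoint X Y ∧ lam M X < (j : ℕ∞) ∧
    (j : ℕ∞) ≤ mrk M X ∧ (j : ℕ∞) ≤ mrk M Y

/-- An exact vertical `j`-separation: one with `λ_M(X) = j - 1`. -/
def IsExactVSep (M : Matroid α) (j : ℕ) (X Y : Set α) : Prop :=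
  IsVSep M j X Y ∧ lam M X = (j : ℕ∞) - 1

/-- `M` is vertically `k`-connected: it has no vertical `j`-separation for a
positive integer `j < k`. -/
def VertConn (M : Matroid α) (k : ℕ) : Prop :=
  ∀ j X Y, 0 < j → j < k → ¬ IsVSep M j X Y

/-- `(X, Y)` is a (Tutte) `j`-separation of `M`. -/
def IsSep (M : Matroid α) (j : ℕ) (X Y : Set α) : Prop :=
  X ∪ Y = M.E ∧ Disjoint X Y ∧ lam M X < (j : ℕ∞) ∧
    (j : ℕ∞) ≤ X.encard ∧ (j : ℕ∞) ≤ Y.encard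

/-- `M` is (Tutte) `k`-connected. -/
def TConn (M : Matroid α) (k : ℕ) : Prop :=
  ∀ j X Y, 0 < j → j < k → ¬ IsSep M j X Y

/-- `M` is minimally vertically 4-connected. -/
def MinVertConn4 (M : Matroid α) : Prop :=
  VertConn M 4 ∧ ∀ e ∈ M.E, ¬ VertConn (mdel M {e}) 4

/-- `M` is a simple matroid: every subset of the ground set with at most two
elements is independent (no loops and no parallel pairs). -/
def MSimple (M : Matroid α) : Prop := ∀ S ⊆ M.E, S.encard ≤ 2 → M.Indep S

/-- `M` has a restriction isomorphic to `U_{2,4}`: a 4-element subset of the ground set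
of rank 2, all of whose subsets with at most 2 elements are independent. -/
def HasU24Restriction (M : Matroid α) : Prop :=
  ∃ X ⊆ M.E, X.encard = 4 ∧ mrk M X = 2 ∧ ∀ S ⊆ X, S.encard ≤ 2 → M.Indep S

/-- The restriction `M|X` is isomorphic to `U_{2,4}`. -/
def RestrIsoU24 (M : Matroid α) (X : Set α) : Prop :=
  X ⊆ M.E ∧ X.encard = 4 ∧ mrk M X = 2 ∧ ∀ S ⊆ X, S.encard ≤ 2 → M.Indep S

/-- The restriction `M|C` is isomorphic to `U_{2,k} ⊕ U_{2,2}`: `C` is the disjoint union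
of a `k`-element rank-2 set `L` containing no loops or parallel pairs (a copy of `U_{2,k}`)
and a 2-element independent set `P` (a copy of `U_{2,2}`), with `r(C) = r(L) + r(P) = 4`,
so that the restriction is the direct sum of the two pieces. -/
def RestrIsoLinePlusPair (M : Matroid α) (C : Set α) (k : ℕ) : Prop :=
  ∃ L P, C = L ∪ P ∧ Disjoint L P ∧ L.encard = (k : ℕ∞) ∧ P.encard = 2 ∧
    M.Indep P ∧ mrk M L = 2 ∧ (∀ S ⊆ L, S.encard ≤ 2 → M.Indep S) ∧ mrk M C = 4

/-- The restriction `M|X` is isomorphic to the 2-sum `U_{2,4} ⊕₂ U_{2,4}`: `X` is the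
disjoint union of two 3-element circuits `T₁` and `T₂`, and the circuits of `M` contained
in `X` (i.e. the circuits of `M|X`) are exactly `T₁`, `T₂`, and the unions `P₁ ∪ P₂` of
2-element subsets `P₁ ⊆ T₁` and `P₂ ⊆ T₂`. -/
def RestrIsoTwoSumU24U24 (M : Matroid α) (X : Set α) : Prop :=
  X ⊆ M.E ∧ ∃ T₁ T₂ : Set α, Disjoint T₁ T₂ ∧ X = T₁ ∪ T₂ ∧
    T₁.encard = 3 ∧ T₂.encard = 3 ∧
    ∀ C ⊆ X, (MCircuit M C ↔ (C = T₁ ∨ C = T₂ ∨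
      ∃ P₁ P₂, P₁ ⊆ T₁ ∧ P₂ ⊆ T₂ ∧ P₁.encard = 2 ∧ P₂.encard = 2 ∧ C = P₁ ∪ P₂))

/-- The columns of the `GF(3)`-matrix representing `N₉`. -/
def N9Cols : Fin 9 → Fin 4 → ZMod 3 :=
  ![![1, 0, 0, 0], ![0, 1, 0, 0], ![0, 0, 1, 0], ![0, 0, 0, 1], ![0, 1, 1, -1],
    ![1, 0, 1, 1], ![1, 1, 0, 1], ![-1, 1, 1, 0], ![1, -1, 1, -1]]

/-- `M` is isomorphic to `N₉`, the 9-element rank-4 matroid represented over `GF(3)`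
by the matrix with columns `N9Cols`. -/
def IsoN9 (M : Matroid α) : Prop :=
  ∃ φ : α → Fin 9, Set.BijOn φ M.E Set.univ ∧
    ∀ I ⊆ M.E, (M.Indep I ↔ LinearIndependent (ZMod 3) fun x : I => N9Cols (φ x.1))

/-- `M` is binary: representable over the two-element field `GF(2)`, i.e. there is a
map from the ground set to a `GF(2)`-vector space under which independence in `M`
coincides with linear independence. -/
def IsBinary (M : Matroid α) : Prop :=
  ∃ (ι : Type u) (φ : α → ι → ZMod 2),
    ∀ I ⊆ M.E, (M.Indep I ↔ LinearIndependent (ZMod 2) fun x : I => φ x.1)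

/-- `M` is a uniform matroid, i.e. isomorphic to `U_{m,n}` for some `m` and `n`:
the ground set has `n` elements and a subset of the ground set is independent
exactly when it has at most `m` elements. -/
def IsUniform (M : Matroid α) : Prop :=
  ∃ m n : ℕ, M.E.encard = (n : ℕ∞) ∧ ∀ I ⊆ M.E, (M.Indep I ↔ I.encard ≤ (m : ℕ∞))

structure QSep {β : Type u} (r : Set β → ℕ) (e : β) (X Y : Set β) : Prop where
  cov : ∀ z, z = e ∨ z ∈ X ∨ z ∈ Y
  dis : ∀ z, z ∈ X → z ∉ Y
  eX : e ∉ X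
  eY : e ∉ Y
  cX : r (insert e X) = r X + 1
  cY : r (insert e Y) = r Y + 1
  sum : r X + r Y = r univ + 2
  lX : r X < r univ
  lY : r Y < r univ

structure QMat {β : Type u} (r : Set β → ℕ) : Prop where
  mono : ∀ {A B : Set β}, A ⊆ B → r A ≤ r B
  submod : ∀ A B : Set β, r (A ∪ B) + r (A ∩ B) ≤ r A + r B
  ins : ∀ (x : β) (A : Set β), r (insert x A) ≤ r A + 1
  emp : r ∅ = 0
  pair : ∀ x y, x ≠ y → r {x, y} = 2
  four : 4 ≤ r univ
  v4 : ∀ A : Set β, r A < r univ → r Aᶜ < r univ → r univ + 3 ≤ r A + r Aᶜ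
  coc5 : ∀ K : Set β, K.Finite → r Kᶜ < r univ → 5 ≤ K.ncard
  tri5 : ∀ K T : Set β, K.ncard = 5 → r Kᶜ < r univ → T ⊆ K → T.ncard = 3 → 3 ≤ r T
  sep : ∀ e, ∃ X Y, QSep r e X Y

section
variable {β : Type u} {r : Set β → ℕ}

theorem QSep.symm {e : β} {X Y : Set β} (h : QSep r e X Y) : QSep r e Y X where
  cov := fun z => by rcases h.cov z with h | h | h <;> simp [h]
  dis := fun z h1 h2 => h.dis z h2 h1
  eX := h.eY
  eY := h.eX
  cX := h.cY
  cY := h.cX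
  sum := by have := h.sum; omega
  lX := h.lY
  lY := h.lX

namespace QMat
variable (hr : QMat r)
include hr

theorem sub {A B I U : Set β} (hI : I ⊆ A ∩ B) (hU : U ⊆ A ∪ B) : r U + r I ≤ r A + r B := by
  have := hr.submod A B
  have := hr.mono hI
  have := hr.mono hU
  omega

theorem one (x : β) : r {x} = 1 := by
  have h1 := hr.ins x ∅
  have h2 := hr.emp
  simp at h1
  by_contra hne
  have h0 : r {x} = 0 := by omega
  obtain ⟨y, hy⟩ : ∃ y, y ≠ x := by
    by_contra hcon
    push Not at hcon
    have : (univ : Set β) = {x} := by ext z; simp [hcon z]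
    have := hr.four
    simp_all
  have := hr.pair y x hy
  have := hr.ins y {x}
  omega

theorem lsub (A B : Set β) :
    (r (A ∩ B) + r (A ∩ B)ᶜ) + (r (A ∪ B) + r (A ∪ B)ᶜ) ≤ (r A + r Aᶜ) + (r B + r Bᶜ) := by
  have h1 := hr.submod A B
  have h2 := hr.submod Aᶜ Bᶜ
  rw [compl_inter, compl_union]
  omega

theorem insle {A B : Set β} (x : β) (h : B ⊆ insert x A) : r B ≤ r A + 1 :=
  (hr.mono h).trans (hr.ins x A)

/-- closure is monotone -/
theorem notcl {e : β} {A X : Set β} (h : r (insert e X) = r X + 1) (hA : A ⊆ X) :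
    r (insert e A) = r A + 1 := by
  have h1 := hr.ins e A
  have h2 := hr.sub (A := insert e A) (B := X) (I := A) (U := insert e X)
    (by intro z; grind) (by intro z; grind)
  omega

theorem clmono {e : β} {A X : Set β} (h : r (insert e A) ≤ r A) (hA : A ⊆ X) :
    r (insert e X) = r X := by
  have h0 := hr.mono (subset_insert e X)
  have h2 := hr.sub (A := insert e A) (B := X) (I := A) (U := insert e X)
    (by intro z; grind) (by intro z; grind)
  omega

end QMat
end

section
attribute [-grind] Set.subset_insert
variable {β : Type u} {r : Set β → ℕ}

theorem exSub {S : Set β} {n : ℕ} (h : ¬(S.Finite ∧ S.ncard < n)) :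
    ∃ T ⊆ S, T.Finite ∧ T.ncard = n := by
  by_cases hS : S.Finite
  · obtain ⟨T, hT, hn⟩ := Set.exists_subset_card_eq (s := S) (n := n) (by grind)
    exact ⟨T, hT, hS.subset hT, hn⟩
  · obtain ⟨T, hT, hn⟩ := Set.Infinite.exists_subset_ncard_eq hS n
    grind

theorem card4 {S : Set β} (h : S.ncard = 4) : ∃ a b c d, S = {a, b, c, d} ∧ a ≠ b ∧ a ≠ c ∧
    a ≠ d ∧ b ≠ c ∧ b ≠ d ∧ c ≠ d := by
  obtain ⟨a, T, ha, rfl, hT⟩ := Set.eq_insert_of_ncard_eq_succ (n := 3) h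
  obtain ⟨b, c, d, h1, h2, h3, rfl⟩ := Set.ncard_eq_three.1 hT
  exact ⟨a, b, c, d, rfl, by grind⟩

theorem ncard3_le (a b c : β) : ({a, b, c} : Set β).ncard ≤ 3 := by
  have h1 := Set.ncard_insert_le a {b, c}
  have h2 := Set.ncard_insert_le b {c}
  have h3 := Set.ncard_singleton c
  omega

theorem ncard4_le (a b c d : β) : ({a, b, c, d} : Set β).ncard ≤ 4 := by
  have h1 := Set.ncard_insert_le a {b, c, d}
  have h2 := ncard3_le b c d
  omega

theorem ncard5_le (a b c d e : β) : ({a, b, c, d, e} : Set β).ncard ≤ 5 := by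
  have h1 := Set.ncard_insert_le a {b, c, d, e}
  have h2 := ncard4_le b c d e
  omega

theorem ncard_insL (x : β) (A : Set β) (h : A.Finite) : A.ncard ≤ (insert x A).ncard :=
  Set.ncard_le_ncard (subset_insert x A) (h.insert x)

namespace QSep
variable {e f : β} {X Y X' Y' : Set β}

theorem cYe (h : QSep r e X Y) : (insert e Y)ᶜ = X := by
  ext z; have := h.cov z; have := h.dis z; have := h.eX; grind
theorem cYn (h : QSep r e X Y) : Yᶜ = insert e X := by
  ext z; have := h.cov z; have := h.dis z; have := h.eY; grind
theorem LY (h : QSep r e X Y) : r Y + r Yᶜ = r univ + 3 := by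
  rw [h.cYn, h.cX]; have := h.sum; omega
theorem LeY (h : QSep r e X Y) : r (insert e Y) + r (insert e Y)ᶜ = r univ + 3 := by
  rw [h.cYe, h.cY]; have := h.sum; omega
theorem r3 (h : QSep r e X Y) : 3 ≤ r Y := by have := h.sum; have := h.lX; omega

theorem split_in (h : QSep r f X' Y') {A : Set β} (hA : A.Finite) (hf : f ∈ A) :
    A.ncard = (A ∩ X').ncard + (A ∩ Y').ncard + 1 := by
  have e1 : A = insert f ((A ∩ X') ∪ (A ∩ Y')) := by
    ext z; have := h.cov z; grind
  have hd : Disjoint (A ∩ X') (A ∩ Y') := by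
    rw [Set.disjoint_left]; intro z; have := h.dis z; grind
  have f1 : (A ∩ X').Finite := hA.subset inter_subset_left
  have f2 : (A ∩ Y').Finite := hA.subset inter_subset_left
  have := Set.ncard_union_eq hd f1 f2
  have h2 := Set.ncard_insert_of_notMem (a := f) (s := (A ∩ X') ∪ (A ∩ Y'))
    (by have := h.eX; have := h.eY; grind) (f1.union f2)
  rw [← e1] at h2
  omega

theorem split_out (h : QSep r f X' Y') {A : Set β} (hA : A.Finite) (hf : f ∉ A) :
    A.ncard = (A ∩ X').ncard + (A ∩ Y').ncard := by
  have e1 : A = ((A ∩ X') ∪ (A ∩ Y')) := by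
    ext z; have := h.cov z; grind
  have hd : Disjoint (A ∩ X') (A ∩ Y') := by
    rw [Set.disjoint_left]; intro z; have := h.dis z; grind
  have f1 : (A ∩ X').Finite := hA.subset inter_subset_left
  have f2 : (A ∩ Y').Finite := hA.subset inter_subset_left
  have := Set.ncard_union_eq hd f1 f2
  rw [← e1] at this
  omega
end QSep

namespace QMat
variable (hr : QMat r)
include hr
variable {e f : β} {X Y X' Y' : Set β}

theorem line4 {a b c d : β} (h1 : a ≠ b) (h2 : a ≠ c) (h3 : a ≠ d) (h4 : b ≠ c) (h5 : b ≠ d)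
    (h6 : c ≠ d) : 3 ≤ r {a, b, c, d} := by
  obtain ⟨X, Y, h⟩ := hr.sep a
  have key : ∀ Z x y, r (insert a Z) = r Z + 1 → x ∈ Z → y ∈ Z → x ≠ y →
      x ∈ ({b, c, d} : Set β) → y ∈ ({b, c, d} : Set β) → 3 ≤ r {a, b, c, d} := by
    intro Z x y hZ hx hy hxy hx' hy'
    have h1 := hr.notcl (A := {x, y}) hZ (by grind)
    have h2 := hr.pair x y hxy
    have h3 := hr.mono (A := insert a {x, y}) (B := {a, b, c, d}) (by grind)
    omega
  have kX := fun x y => key X x y h.cX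
  have kY := fun x y => key Y x y h.cY
  have hb := h.cov b
  have hc := h.cov c
  have hd := h.cov d
  have k1 := kX b c
  have k2 := kX b d
  have k3 := kX c d
  have k4 := kY b c
  have k5 := kY b d
  have k6 := kY c d
  clear kX kY key
  simp only [mem_insert_iff, mem_singleton_iff, true_or, or_true, forall_const] at *
  grind

theorem lin {S : Set β} (h : r S ≤ 2) : S.Finite ∧ S.ncard ≤ 3 := by
  by_contra hc
  obtain ⟨T, hT, -, h4⟩ := exSub (S := S) (n := 4) (by grind)
  obtain ⟨a, b, c, d, rfl, h⟩ := card4 h4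
  have := hr.line4 (a := a) (b := b) (c := c) (d := d) (by grind) (by grind) (by grind)
    (by grind) (by grind) (by grind)
  have := hr.mono hT
  omega

theorem pt {S : Set β} (h : r S ≤ 1) : S.Finite ∧ S.ncard ≤ 1 := by
  by_contra hc
  obtain ⟨T, hT, -, h4⟩ := exSub (S := S) (n := 2) (by grind)
  obtain ⟨a, b, hab, rfl⟩ := Set.ncard_eq_two.1 h4
  have := hr.pair a b hab
  have := hr.mono hT
  omega

theorem two_le {S : Set β} {a b : β} (ha : a ∈ S) (hb : b ∈ S) (hab : a ≠ b) : 2 ≤ r S := by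
  have := hr.pair a b hab
  have := hr.mono (A := {a, b}) (B := S) (by grind)
  omega

theorem two_le' {S : Set β} (h : 2 ≤ S.ncard) : 2 ≤ r S := by
  by_contra hc
  have := hr.pt (S := S) (by omega)
  omega

theorem le_ncard {S : Set β} (h : S.Finite) : r S ≤ S.ncard := by
  induction S, h using Set.Finite.induction_on with
  | empty => simp [hr.emp]
  | insert ha hs ih =>
    rw [Set.ncard_insert_of_notMem ha hs]
    have := hr.ins
    grind

theorem glue {A B : Set β} {p q : β} (hA : r A ≤ 2) (hB : r B ≤ 2) (hpq : p ≠ q)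
    (h1 : p ∈ A) (h2 : q ∈ A) (h3 : p ∈ B) (h4 : q ∈ B) : r (A ∪ B) ≤ 2 := by
  have := hr.submod A B
  have := hr.two_le (S := A ∩ B) (a := p) (b := q) (by grind) (by grind) hpq
  omega

/-- two lines sharing two points with two further points -/
theorem noline {A B : Set β} {p q x y : β} (hA : r A ≤ 2) (hB : r B ≤ 2) (hpq : p ≠ q)
    (h1 : p ∈ A) (h2 : q ∈ A) (h3 : p ∈ B) (h4 : q ∈ B) (hx : x ∈ A ∪ B) (hy : y ∈ A ∪ B)
    (hxy : x ≠ y) (hxp : x ≠ p) (hxq : x ≠ q) (hyp : y ≠ p) (hyq : y ≠ q) : False := by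
  have h5 := hr.glue hA hB hpq h1 h2 h3 h4
  have h6 := hr.line4 hpq hxp.symm hyp.symm hxq.symm hyq.symm hxy
  have := hr.mono (A := {p, q, x, y}) (B := A ∪ B) (by grind)
  omega

theorem L2 {A : Set β} (h : r A + r Aᶜ ≤ r univ + 2) (h2 : r A < r univ) : r A ≤ 2 := by
  by_contra hc
  have := hr.v4 A h2
  omega

theorem makeSep {A : Set β} (hf : f ∉ A) (h3 : 3 ≤ r A) (hc : r (insert f A) = r A + 1)
    (hn : r (insert f A) < r univ) (h1 : r A + r Aᶜ ≤ r univ + 3)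
    (h2 : r (insert f A) + r (insert f A)ᶜ ≤ r univ + 3) : QSep r f (insert f A)ᶜ A := by
  have hv := hr.v4 (insert f A) hn
  have e1 : insert f (insert f A)ᶜ = Aᶜ := by ext z; grind
  have hi := hr.ins f (insert f A)ᶜ
  have hv2 := hr.v4 A (by omega)
  have hm := hr.mono (subset_insert f (insert f A)ᶜ)
  rw [e1] at hi hm
  refine ⟨by grind, by grind, by grind, hf, ?_, hc, by omega, by omega, by omega⟩
  rw [e1]
  by_contra hne
  omega

theorem move (h : QSep r f X' Y') {x : β} (hx : x ∈ X') (hc : r (insert x Y') = r Y') :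
    QSep r f (X' \ {x}) (insert x Y') := by
  have hxf : x ≠ f := by have := h.eX; grind
  have hnY := h.eY
  have hnX := h.eX
  have cov := h.cov
  have dis := h.dis
  have h1 := hr.mono (A := X' \ {x}) (B := X') sdiff_subset
  have hsum := h.sum
  have h2 := hr.ins f (insert x Y')
  have h3 := hr.mono (A := insert f Y') (B := insert f (insert x Y')) (by grind)
  have h4 := h.cY
  have hlX := h.lX
  have hlY := h.lY
  have e1 : (insert f (insert x Y'))ᶜ = X' \ {x} := by
    ext z; grind
  have key : r (X' \ {x}) = r X' := by
    by_cases hs : r Y' + 1 < r univ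
    · have := hr.v4 (insert f (insert x Y')) (by omega) (by rw [e1]; omega)
      rw [e1] at this
      omega
    · by_contra hne
      have hl := hr.lin (S := X' \ {x}) (by omega)
      have hcc : (insert f (X' \ {x}))ᶜ = insert x Y' := by
        ext z; grind
      have := hr.coc5 (insert f (X' \ {x})) (hl.1.insert f) (by rw [hcc]; omega)
      have := Set.ncard_insert_le f (X' \ {x})
      omega
  refine ⟨by grind, by grind, by grind, by grind, ?_, by omega, by omega, by omega, by omega⟩
  exact hr.notcl h.cX sdiff_subset

theorem L3a (h : QSep r e X Y) (h' : QSep r f X' Y') (hf : f ∈ Y) (he : e ∈ X')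
    (hmin : ∀ g ∈ Y, ∀ B A, A ⊆ Y → ¬ QSep r g B A) : r (Y ∩ Y') ≤ 2 ∨ r (X ∩ X') ≤ 1 := by
  by_contra hc
  push Not at hc
  have hnX := h.eX
  have hnY' := h'.eY
  refine hmin f hf _ (Y ∩ Y') inter_subset_left (hr.makeSep (by grind) (by omega)
    (hr.notcl h'.cY inter_subset_right) ?_ ?_ ?_)
  · have := hr.mono (A := insert f (Y ∩ Y')) (B := Y) (by grind)
    have := h.lY
    omega
  all_goals
    have hz : (Y ∪ Y')ᶜ = insert e (X ∩ X') := by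
      rw [compl_union, h.cYn, h'.cYn]; ext z
      have := h.dis z; have := h.cov z; have := h'.dis z; have := h'.cov z; grind
    have h1 := hr.notcl (A := X ∩ X') h.cX inter_subset_left
    have h2 := hr.mono (A := insert e (X ∩ X')) (B := X') (by grind)
    have h3 := h'.lX
    have h4 := hr.L2 (A := insert e (X ∩ X'))
    rw [← hz, compl_compl] at h4
    rw [← hz] at h1 h2
    have h5 := hr.lsub Y Y'
    have h6 := hr.lsub Y (insert f Y')
    have e1 : Y ∪ insert f Y' = Y ∪ Y' := by grind
    have e2 : Y ∩ insert f Y' = insert f (Y ∩ Y') := by grind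
    rw [e1, e2] at h6
    have := h.LY
    have := h'.LY
    have := h'.LeY
    omega

theorem L3b (h : QSep r e X Y) (h' : QSep r f X' Y') (hf : f ∈ Y) (he : e ∈ X')
    (hmin : ∀ g ∈ Y, ∀ B A, A ⊆ Y → ¬ QSep r g B A) : r (Y ∩ X') ≤ 2 ∨ r (X ∩ Y') ≤ 2 := by
  by_contra hc
  push Not at hc
  have hnX := h.eX
  have hnX' := h'.eX
  refine hmin f hf _ (Y ∩ X') inter_subset_left (hr.makeSep (by grind) (by omega)
    (hr.notcl h'.cX inter_subset_right) ?_ ?_ ?_)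
  · have := hr.mono (A := insert f (Y ∩ X')) (B := Y) (by grind)
    have := h.lY
    omega
  all_goals
    have hz : (Y ∪ X')ᶜ = X ∩ Y' := by
      rw [compl_union, h.cYn, h'.symm.cYn]; ext z
      have := h.dis z; have := h.cov z; have := h'.dis z; have := h'.cov z; grind
    have h2 := hr.mono (A := X ∩ Y') (B := X) (by grind)
    have h3 := h.lX
    have h4 := hr.L2 (A := X ∩ Y')
    rw [← hz, compl_compl] at h4
    rw [← hz] at h2 hc
    have h5 := hr.lsub Y X'
    have h6 := hr.lsub Y (insert f X')
    have e1 : Y ∪ insert f X' = Y ∪ X' := by grind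
    have e2 : Y ∩ insert f X' = insert f (Y ∩ X') := by grind
    rw [e1, e2] at h6
    have := h.LY
    have := h'.symm.LY
    have := h'.symm.LeY
    omega

end QMat
end

section
attribute [-grind] Set.subset_insert
set_option linter.unusedSectionVars false
variable {β : Type u} {r : Set β → ℕ}
namespace QMat
variable (hr : QMat r)
include hr
variable {e f : β} {X Y X' Y' : Set β} {k : ℕ}

theorem sep2 (f e : β) (hfe : e ≠ f) : ∃ X Y, QSep r f X Y ∧ e ∈ X := by
  obtain ⟨X, Y, h⟩ := hr.sep f
  rcases h.cov e with h1 | h1 | h1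
  · exact absurd h1 hfe
  · exact ⟨X, Y, h, h1⟩
  · exact ⟨Y, X, h.symm, h1⟩

theorem nonemp (h : QSep r e X Y) : Y.Nonempty := by
  by_contra hc
  rw [Set.not_nonempty_iff_eq_empty] at hc
  have := h.r3
  have := hr.emp
  simp_all

theorem fin_of {A : Set β} (h : QSep r f X' Y') (h1 : (A ∩ X').Finite) (h2 : (A ∩ Y').Finite) :
    A.Finite := by
  refine ((h1.union h2).insert f).subset ?_
  intro z
  have := h.cov z
  grind

theorem exFin : ∃ e X Y, QSep r e X Y ∧ Y.Finite := by
  classical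
  have hex : ∃ k, ∃ e X Y, QSep r e X Y ∧ r Y = k := by
    have h4 := hr.four
    have : Nonempty β := by
      by_contra hc
      rw [not_nonempty_iff] at hc
      have : (univ : Set β) = ∅ := by ext z; exact hc.elim z
      have := hr.emp
      simp_all
    obtain ⟨e⟩ := this
    obtain ⟨X, Y, h⟩ := hr.sep e
    exact ⟨_, e, X, Y, h, rfl⟩
  obtain ⟨e, X, Y, h, hk⟩ := Nat.find_spec hex
  have hmin : ∀ g ∈ Y, ∀ B A, A ⊆ Y → ¬ QSep r g B A := by
    intro g hg B A hA hs
    refine Nat.find_min hex (m := r A) ?_ ⟨g, B, A, hs, rfl⟩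
    have := hr.mono (A := insert g A) (B := Y) (by grind)
    have := hs.cY
    omega
  obtain ⟨f, hf⟩ := hr.nonemp h
  obtain ⟨X', Y', h', he⟩ := hr.sep2 f e (by have := h.eY; grind)
  have ha := hr.L3a h h' hf he hmin
  have hb := hr.L3b h h' hf he hmin
  have l := fun S => (hr.lin (S := S))
  rcases ha with ha | ha <;> rcases hb with hb | hb
  · exact ⟨e, X, Y, h, hr.fin_of h' (l _ hb).1 (l _ ha).1⟩
  · refine ⟨f, X', Y', h', hr.fin_of h ?_ ?_⟩
    · rw [inter_comm]; exact (l _ hb).1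
    · rw [inter_comm]; exact (l _ ha).1
  · refine ⟨f, Y', X', h'.symm, hr.fin_of h ?_ ?_⟩
    · rw [inter_comm]; exact (l _ (by omega)).1
    · rw [inter_comm]; exact (l _ hb).1
  · exact ⟨e, Y, X, h.symm, hr.fin_of h' (l _ (by omega)).1 (l _ hb).1⟩

theorem exMin : ∃ e X Y, QSep r e X Y ∧ Y.Finite ∧
    ∀ g A B, QSep r g A B → B.Finite → Y.ncard ≤ B.ncard := by
  classical
  have hex : ∃ k, ∃ e X Y, QSep r e X Y ∧ Y.Finite ∧ Y.ncard = k := by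
    obtain ⟨e, X, Y, h, hf⟩ := hr.exFin
    exact ⟨_, e, X, Y, h, hf, rfl⟩
  obtain ⟨e, X, Y, h, hf, hk⟩ := Nat.find_spec hex
  refine ⟨e, X, Y, h, hf, fun g A B hs hB => ?_⟩
  rw [hk]
  exact Nat.find_min' hex ⟨g, A, B, hs, hB, rfl⟩

theorem k4 (h : QSep r e X Y) (hY : Y.Finite) : 4 ≤ Y.ncard := by
  have h1 := hr.coc5 (insert e Y) (hY.insert e) (by rw [h.cYe]; exact h.lX)
  have := Set.ncard_insert_le e Y
  omega

theorem hmin_of (hY : Y.Finite) (hk : ∀ g A B, QSep r g A B → B.Finite → Y.ncard ≤ B.ncard) :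
    ∀ g ∈ Y, ∀ B A, A ⊆ Y → ¬ QSep r g B A := by
  intro g hg B A hA hs
  have h1 := hk g B A hs (hY.subset hA)
  have : A ⊂ Y := ⟨hA, fun hh => hs.eY (hh hg)⟩
  have := Set.ncard_lt_ncard this hY
  omega

theorem five1 (h : QSep r e X Y) (hY : Y.Finite)
    (hk : ∀ g A B, QSep r g A B → B.Finite → Y.ncard ≤ B.ncard)
    (h' : QSep r f X' Y') (hf : f ∈ Y) (he : e ∈ X') : r (Y ∩ Y') ≤ 2 := by
  rcases hr.L3a h h' hf he (hr.hmin_of hY hk) with h1 | h1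
  · exact h1
  · have h2 := hr.pt h1
    have h3 : X'.Finite := by
      refine hr.fin_of h ?_ ?_
      · rw [inter_comm]; exact h2.1
      · exact hY.subset inter_subset_right
    have h4 := hk f Y' X' h'.symm h3
    have h5 := h.split_in h3 he
    have h6 := h'.split_in hY hf
    rw [inter_comm X' X, inter_comm X' Y] at h5
    have := hr.le_ncard (hY.subset (inter_subset_left (t := Y')))
    omega

theorem five2 (h : QSep r e X Y) (hY : Y.Finite)
    (hk : ∀ g A B, QSep r g A B → B.Finite → Y.ncard ≤ B.ncard)
    (h' : QSep r f X' Y') (hf : f ∈ Y) (he : e ∈ X') (h2 : 2 ≤ (Y ∩ X').ncard) :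
    r (X ∩ Y') ≤ 2 := by
  rcases hr.L3b h h' hf he (hr.hmin_of hY hk) with h1 | h1
  · have hge := hr.two_le' h2
    have hfin := hr.lin h1
    have h3 := hr.notcl (A := Y ∩ X') h'.cX inter_subset_right
    have h4 := hr.notcl (A := insert f (Y ∩ X')) h.cY (by grind)
    set A := insert e (insert f (Y ∩ X')) with hA
    have hAf : A.Finite := (hfin.1.insert f).insert e
    have hsp : ¬ r Aᶜ < r univ := by
      intro hlt
      have c1 := hr.coc5 A hAf hlt
      have c2 := Set.ncard_insert_le e (insert f (Y ∩ X'))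
      have c3 := Set.ncard_insert_le f (Y ∩ X')
      rw [← hA] at c2
      have := hr.tri5 A (Y ∩ X') (by omega) hlt (by grind) (by omega)
      omega
    have e1 : insert e Y ∩ insert f X' = A := by
      have := h.eY; have := h'.eX; grind
    have e2 : (insert e Y ∪ insert f X')ᶜ = X ∩ Y' := by
      have a1 := h.cYe; have a2 := h'.symm.cYe
      rw [compl_union, a1, a2]
    have h5 := hr.lsub (insert e Y) (insert f X')
    rw [e1] at h5
    have := h.LeY
    have := h'.symm.LeY
    have h6 := hr.L2 (A := X ∩ Y')
    rw [← e2, compl_compl] at h6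
    have h7 := hr.mono (A := X ∩ Y') (B := X) inter_subset_left
    have := h.lX
    rw [e2] at h5 h6
    omega
  · exact h1

end QMat
end

section
attribute [-grind] Set.subset_insert
set_option linter.unusedSectionVars false
variable {β : Type u} {r : Set β → ℕ}

theorem third {T : Set β} (h : T.ncard = 3) (u v : β) : ∃ w ∈ T, w ≠ u ∧ w ≠ v := by
  obtain ⟨a, b, c, h1, h2, h3, rfl⟩ := Set.ncard_eq_three.1 h
  by_contra hc
  push Not at hc
  have h4 := hc a (by simp)
  have h5 := hc b (by simp)
  have h6 := hc c (by simp)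
  by_cases a = u <;> by_cases b = u <;> by_cases c = u <;> grind

theorem triMem {T : Set β} (h : T.ncard = 3) {x : β} (hx : x ∈ T) :
    ∃ p q, T = {x, p, q} ∧ x ≠ p ∧ x ≠ q ∧ p ≠ q := by
  obtain ⟨a, b, c, h1, h2, h3, rfl⟩ := Set.ncard_eq_three.1 h
  rcases hx with rfl | rfl | rfl
  · exact ⟨b, c, by grind⟩
  · exact ⟨a, c, by grind⟩
  · exact ⟨a, b, by grind⟩

theorem two_of {T : Set β} (h : 2 ≤ T.ncard) : ∃ u v, u ∈ T ∧ v ∈ T ∧ u ≠ v := by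
  have hf : T.Finite := by
    by_contra hc
    rw [Set.Infinite.ncard hc] at h
    omega
  obtain ⟨u, v, h1⟩ := (Set.one_lt_ncard_iff hf).1 h
  exact ⟨u, v, h1⟩

theorem fin_of_pos {T : Set β} (h : 0 < T.ncard) : T.Finite := Set.finite_of_ncard_pos h

theorem n3 {a b c : β} (h1 : a ≠ b) (h2 : a ≠ c) (h3 : b ≠ c) : ({a, b, c} : Set β).ncard = 3 :=
  Set.ncard_eq_three.2 ⟨a, b, c, h1, h2, h3, rfl⟩

namespace QMat
variable (hr : QMat r)
include hr
variable {e f : β} {X Y X' Y' : Set β} {k : ℕ}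

theorem triSplit {x y z : β} {P Q T : Set β} (h : QSep r x P Q) (hT : r T ≤ 2) (hx : x ∈ T)
    (hy : y ∈ T) (hz : z ∈ T) (hxy : x ≠ y) (hxz : x ≠ z) (hyz : y ≠ z) :
    (y ∈ P ∧ z ∈ Q ∧ y ∉ Q ∧ z ∉ P) ∨ (y ∈ Q ∧ z ∈ P ∧ y ∉ P ∧ z ∉ Q) := by
  have key : ∀ Z, r (insert x Z) = r Z + 1 → y ∈ Z → z ∈ Z → False := by
    intro Z hZ h1 h2
    have h3 := hr.notcl (A := {y, z}) hZ (by grind)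
    have h4 := hr.pair y z hyz
    have h5 := hr.mono (A := insert x {y, z}) (B := T) (by grind)
    omega
  have k1 := key P h.cX
  have k2 := key Q h.cY
  have := h.cov y
  have := h.cov z
  have := h.dis y
  have := h.dis z
  grind

theorem L6a (h : QSep r e X Y) (hY : 6 ≤ Y.ncard)
    (hk : ∀ g A B, QSep r g A B → B.Finite → Y.ncard ≤ B.ncard)
    (h' : QSep r f X' Y') (hf : f ∈ Y) (he : e ∈ X') :
    Y.ncard = 6 ∧ Y'.ncard = 6 ∧ r (Y ∩ Y') ≤ 2 ∧ (Y ∩ Y').ncard = 3 ∧ r (X ∩ Y') ≤ 2 ∧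
      (X ∩ Y').ncard = 3 := by
  have hYf := fin_of_pos (T := Y) (by omega)
  have h1 := hr.five1 h hYf hk h' hf he
  have h2 := h'.split_in hYf hf
  have h3 := hr.lin h1
  have h4 := hr.five2 h hYf hk h' hf he (by omega)
  have h5 := hr.lin h4
  have h6 : Y'.Finite := by
    refine hr.fin_of h ?_ ?_
    · rw [inter_comm]; exact h5.1
    · rw [inter_comm]; exact h3.1
  have h7 := hk _ _ _ h' h6
  have h8 := h.split_out h6 (by have := h'.dis e he; grind)
  rw [inter_comm Y' X, inter_comm Y' Y] at h8
  refine ⟨?_, ?_, h1, ?_, h4, ?_⟩ <;> omega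

theorem L6 (h : QSep r e X Y) (hY : Y.Finite)
    (hk : ∀ g A B, QSep r g A B → B.Finite → Y.ncard ≤ B.ncard) : Y.ncard ≤ 5 := by
  by_contra hc
  obtain ⟨f, hf⟩ := hr.nonemp h
  obtain ⟨X', Y', h', he⟩ := hr.sep2 f e (by have := h.eY; grind)
  have h1 := hr.L6a h (by omega) hk h' hf he
  obtain ⟨f1, p, q, d1, d2, d3, hT⟩ := Set.ncard_eq_three.1 h1.2.2.2.1
  have hf1 : f1 ∈ Y ∩ Y' := by rw [hT]; grind
  have hp : p ∈ Y ∩ Y' := by rw [hT]; grind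
  have hq : q ∈ Y ∩ Y' := by rw [hT]; grind
  obtain ⟨X2, Y2, h2, he2⟩ := hr.sep2 f1 f (by have := h'.eY; grind)
  have h3 := hr.L6a h' (by omega) (by rw [h1.2.1, ← h1.1]; exact hk) h2 hf1.2 he2
  have hs := hr.triSplit h2 h1.2.2.1 hf1 hp hq d1 d2 d3
  have main : ∀ p q, p ∈ Y ∩ Y' → q ∈ Y ∩ Y' → Y ∩ Y' = {f1, p, q} → p ∈ Y2 → q ∉ Y2 →
      False := by
    intro p q hp hq hT h4 h5
    have h6 := Set.ncard_sdiff_singleton_of_mem (s := Y' ∩ Y2) (a := p) (by grind)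
    obtain ⟨u, v, hu, hv, huv⟩ := two_of (T := (Y' ∩ Y2) \ {p}) (by omega)
    have hE : ∀ z ∈ (Y' ∩ Y2) \ {p}, z ∈ X ∩ Y' := by
      intro z hz
      have a1 := h.cov z
      have a2 : z ≠ e := by have := h'.dis e he; grind
      have a3 := h2.eY
      have a4 : z ∈ Y ∩ Y' → z = f1 ∨ z = p ∨ z = q := by rw [hT]; grind
      grind
    have hu' := hE u hu
    have hv' := hE v hv
    obtain ⟨w, hw, hwu, hwv⟩ := third h1.2.2.2.2.2 u v
    have := h.dis w
    refine hr.noline (p := u) (q := v) (x := p) (y := w) h3.2.2.1 h1.2.2.2.2.1 huv ?_ ?_ ?_ ?_ ?_ ?_ ?_ ?_ ?_ ?_ ?_ <;> grind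
  rcases hs with hs | hs
  · exact main q p hq hp (by grind) (by grind) (by grind)
  · exact main p q hp hq (by grind) (by grind) (by grind)

theorem Y5r (h : QSep r e X Y) (hY : Y.ncard = 5) : r Y ≤ 4 := by
  have hYf := fin_of_pos (T := Y) (by omega)
  by_contra hc
  obtain ⟨a, b, ha, hb, hab⟩ := two_of (T := Y) (by omega)
  have h1 := hr.coc5 (insert e ((Y \ {a}) \ {b})) (((hYf.sdiff).sdiff).insert e) ?_
  · have h2 := Set.ncard_sdiff_singleton_of_mem ha
    have h3 := Set.ncard_sdiff_singleton_of_mem (s := Y \ {a}) (a := b) (by grind)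
    have := Set.ncard_insert_le e ((Y \ {a}) \ {b})
    omega
  · have e1 : (insert e ((Y \ {a}) \ {b}))ᶜ = insert a (insert b X) := by
      ext z; have := h.cov z; have := h.dis z; have := h.eX; have := h.eY; grind
    rw [e1]
    have := hr.ins a (insert b X)
    have := hr.ins b X
    have := h.sum
    omega

theorem Y5tri (h : QSep r e X Y) (hY : Y.ncard = 5) {T : Set β} (hT : T ⊆ Y) (h3 : T.ncard = 3)
    (hr2 : r T ≤ 2) : r Y = 3 := by
  have h1 := hr.Y5r h hY
  have h2 := h.r3
  by_contra hc
  have := hr.tri5 Y T hY (by rw [h.cYn, h.cX]; have := h.sum; omega) hT h3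
  omega

theorem typGen (hk : ∀ g A B, QSep r g A B → B.Finite → 5 ≤ B.ncard)
    (h : QSep r e X Y) (hY : Y.ncard = 5) (h' : QSep r f X' Y') (hf : f ∈ Y) (he : e ∈ X') :
    (r (Y ∩ Y') ≤ 2 ∧ (Y ∩ Y').ncard = 3 ∧ (Y ∩ X').ncard = 1) ∨
    ((Y ∩ Y').ncard = 2 ∧ (Y ∩ X').ncard = 2 ∧ r (X ∩ Y') ≤ 2 ∧ (X ∩ Y').ncard = 3 ∧
      Y'.ncard = 5 ∧ r Y' = 3) := by
  have hYf := fin_of_pos (T := Y) (by omega)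
  have hk' : ∀ g A B, QSep r g A B → B.Finite → Y.ncard ≤ B.ncard := by rw [hY]; exact hk
  have h1 := hr.five1 h hYf hk' h' hf he
  have h2 := h'.split_in hYf hf
  have h3 := hr.lin h1
  by_cases hx : (Y ∩ X').ncard = 1
  · left; refine ⟨h1, by omega, hx⟩
  right
  have h4 := hr.five2 h hYf hk' h' hf he (by omega)
  have h5 := hr.lin h4
  have h6 : Y'.Finite := by
    refine hr.fin_of h ?_ ?_
    · rw [inter_comm]; exact h5.1
    · rw [inter_comm]; exact h3.1
  have h7 := hk _ _ _ h' h6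
  have h8 := h.split_out h6 (by have := h'.dis e he; grind)
  rw [inter_comm Y' X, inter_comm Y' Y] at h8
  have h9 : Y'.ncard = 5 := by omega
  refine ⟨by omega, by omega, h4, by omega, h9, ?_⟩
  exact hr.Y5tri h' h9 (T := X ∩ Y') inter_subset_right (by omega) h4

end QMat
end

section
attribute [-grind] Set.subset_insert
set_option linter.unusedSectionVars false
variable {β : Type u} {r : Set β → ℕ}

structure QG5 {β : Type u} (r : Set β → ℕ) (e : β) (X : Set β) (t1 t2 t3 a b : β) : Prop where
  s : QSep r e X {t1, t2, t3, a, b}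
  t : r {t1, t2, t3} ≤ 2
  y : r {t1, t2, t3, a, b} = 3
  n : ({t1, t2, t3, a, b} : Set β).ncard = 5
  d12 : t1 ≠ t2
  d13 : t1 ≠ t3
  d1a : t1 ≠ a
  d1b : t1 ≠ b
  d23 : t2 ≠ t3
  d2a : t2 ≠ a
  d2b : t2 ≠ b
  d3a : t3 ≠ a
  d3b : t3 ≠ b
  dab : a ≠ b

theorem QG5.swab {e : β} {X : Set β} {t1 t2 t3 a b : β} (h : QG5 r e X t1 t2 t3 a b) :
    QG5 r e X t1 t2 t3 b a := by
  have e1 : ({t1, t2, t3, b, a} : Set β) = {t1, t2, t3, a, b} := by grind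
  have := h.s; have := h.t; have := h.y; have := h.n
  constructor <;> first | (rw [e1]; assumption) | assumption | (cases h; grind)

theorem QG5.sw12 {e : β} {X : Set β} {t1 t2 t3 a b : β} (h : QG5 r e X t1 t2 t3 a b) :
    QG5 r e X t2 t1 t3 a b := by
  have e1 : ({t2, t1, t3, a, b} : Set β) = {t1, t2, t3, a, b} := by grind
  have e2 : ({t2, t1, t3} : Set β) = {t1, t2, t3} := by grind
  have := h.s; have := h.t; have := h.y; have := h.n
  constructor <;> first | (rw [e1]; assumption) | (rw [e2]; assumption) | (cases h; grind)

theorem QG5.sw23 {e : β} {X : Set β} {t1 t2 t3 a b : β} (h : QG5 r e X t1 t2 t3 a b) :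
    QG5 r e X t1 t3 t2 a b := by
  have e1 : ({t1, t3, t2, a, b} : Set β) = {t1, t2, t3, a, b} := by grind
  have e2 : ({t1, t3, t2} : Set β) = {t1, t2, t3} := by grind
  have := h.s; have := h.t; have := h.y; have := h.n
  constructor <;> first | (rw [e1]; assumption) | (rw [e2]; assumption) | (cases h; grind)

theorem QG5.swt {e : β} {X : Set β} {t1 t2 t3 a b : β} (h : QG5 r e X t1 t2 t3 a b)
    (h2 : r {t1, a, b} ≤ 2) : QG5 r e X t1 a b t2 t3 := by
  have e1 : ({t1, a, b, t2, t3} : Set β) = {t1, t2, t3, a, b} := by grind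
  have := h.s; have := h.y; have := h.n
  constructor <;> first | (rw [e1]; assumption) | assumption | (cases h; grind)

namespace QMat
variable (hr : QMat r)
include hr
variable {e f : β} {X Y X' Y' : Set β} {k : ℕ} {t1 t2 t3 a b : β}

theorem mkG5 (h : QSep r e X Y) (hY : Y.ncard = 5) {T : Set β} (hT : T ⊆ Y) (h3 : T.ncard = 3)
    (hr2 : r T ≤ 2) : ∃ t1 t2 t3 a b, T = {t1, t2, t3} ∧ Y = {t1, t2, t3, a, b} ∧
      QG5 r e X t1 t2 t3 a b := by
  have hYf := fin_of_pos (T := Y) (by omega)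
  have hy := hr.Y5tri h hY hT h3 hr2
  obtain ⟨t1, t2, t3, d1, d2, d3, rfl⟩ := Set.ncard_eq_three.1 h3
  have h4 := Set.ncard_sdiff_add_ncard_of_subset hT hYf
  obtain ⟨a, b, hab, hd⟩ := Set.ncard_eq_two.1 (show (Y \ {t1, t2, t3}).ncard = 2 by omega)
  have e1 : Y = {t1, t2, t3, a, b} := by
    ext z
    have : z ∈ Y \ {t1, t2, t3} ↔ z ∈ ({a, b} : Set β) := by rw [hd]
    grind
  have ha : a ∈ Y \ {t1, t2, t3} := by rw [hd]; grind
  have hb : b ∈ Y \ {t1, t2, t3} := by rw [hd]; grind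
  refine ⟨t1, t2, t3, a, b, rfl, e1, ?_⟩
  subst e1
  constructor <;> first | assumption | grind

theorem typT1 (hk : ∀ g A B, QSep r g A B → B.Finite → 5 ≤ B.ncard)
    (g : QG5 r e X t1 t2 t3 a b) (h' : QSep r t1 X' Y') (he : e ∈ X') (h2 : t2 ∈ Y') :
    t3 ∈ X' ∧ ((a ∈ Y' ∧ b ∈ Y' ∧ r {t2, a, b} ≤ 2) ∨
    (a ∈ Y' ∧ b ∈ X' ∧ ∃ u1 u2 u3, u1 ∈ X ∧ u2 ∈ X ∧ u3 ∈ X ∧ Y' = {u1, u2, u3, t2, a} ∧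
      QG5 r t1 X' u1 u2 u3 t2 a) ∨
    (b ∈ Y' ∧ a ∈ X' ∧ ∃ u1 u2 u3, u1 ∈ X ∧ u2 ∈ X ∧ u3 ∈ X ∧ Y' = {u1, u2, u3, t2, b} ∧
      QG5 r t1 X' u1 u2 u3 t2 b)) := by
  have hs := hr.triSplit h' g.t (x := t1) (y := t2) (z := t3) (by grind) (by grind) (by grind)
    g.d12 g.d13 g.d23
  have h3 : t3 ∈ X' := by have := h'.dis t2; grind
  refine ⟨h3, ?_⟩
  have ht := hr.typGen hk g.s g.n h' (by grind) he
  have d3 := h'.dis t3 h3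
  have d2 : t2 ∉ X' := fun h => h'.dis _ h h2
  have key : ∀ a b, QG5 r e X t1 t2 t3 a b → a ∈ Y' → b ∈ X' →
      ((({t1, t2, t3, a, b} : Set β) ∩ Y').ncard = 2 ∧ (({t1, t2, t3, a, b} : Set β) ∩ X').ncard = 2
      ∧ r (X ∩ Y') ≤ 2 ∧ (X ∩ Y').ncard = 3 ∧ Y'.ncard = 5 ∧ r Y' = 3) →
      ∃ u1 u2 u3, u1 ∈ X ∧ u2 ∈ X ∧ u3 ∈ X ∧ Y' = {u1, u2, u3, t2, a} ∧
      QG5 r t1 X' u1 u2 u3 t2 a := by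
    intro a b g ha hb ht
    obtain ⟨u1, u2, u3, c, d, hT, hE, hG⟩ := hr.mkG5 h' ht.2.2.2.2.1 (T := X ∩ Y')
      inter_subset_right ht.2.2.2.1 ht.2.2.1
    have hu1 : u1 ∈ X ∩ Y' := by rw [hT]; grind
    have hu2 : u2 ∈ X ∩ Y' := by rw [hT]; grind
    have hu3 : u3 ∈ X ∩ Y' := by rw [hT]; grind
    have m1 : t2 ∈ ({u1, u2, u3, c, d} : Set β) := by rw [← hE]; exact h2
    have m2 : a ∈ ({u1, u2, u3, c, d} : Set β) := by rw [← hE]; exact ha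
    have nx : ∀ z, z ∈ ({t1, t2, t3, a, b} : Set β) → z ∉ X := fun z hz hx => g.s.dis z hx hz
    have n1 := nx t2 (by grind)
    have n2 := nx a (by grind)
    have := g.d2a
    have : (t2 = c ∧ a = d) ∨ (t2 = d ∧ a = c) := by grind
    rcases this with ⟨rfl, rfl⟩ | ⟨rfl, rfl⟩
    · exact ⟨u1, u2, u3, hu1.1, hu2.1, hu3.1, hE, hG⟩
    · exact ⟨u1, u2, u3, hu1.1, hu2.1, hu3.1, by rw [hE]; grind, hG.swab⟩
  have ca := h'.cov a
  have cb := h'.cov b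
  have := g.d1a; have := g.d1b
  have da := h'.dis a
  have db := h'.dis b
  have f1 := h'.eX; have f2 := h'.eY
  rcases ca with ca | ca | ca
  · grind
  · rcases cb with cb | cb | cb
    · grind
    · exfalso
      have e1 : ({t1, t2, t3, a, b} : Set β) ∩ Y' = {t2} := by
        ext z; grind
      rw [e1, Set.ncard_singleton] at ht
      omega
    · right; right
      refine ⟨cb, ca, key b a g.swab cb ca ?_⟩
      rcases ht with ht | ht
      · exfalso
        have e1 : ({t1, t2, t3, a, b} : Set β) ∩ Y' = {t2, b} := by
          ext z; grind
        rw [e1, Set.ncard_pair g.d2b] at ht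
        omega
      · have e1 : ({t1, t2, t3, b, a} : Set β) = {t1, t2, t3, a, b} := by grind
        rw [e1]; exact ht
  · rcases cb with cb | cb | cb
    · grind
    · right; left
      refine ⟨ca, cb, key a b g ca cb ?_⟩
      rcases ht with ht | ht
      · exfalso
        have e1 : ({t1, t2, t3, a, b} : Set β) ∩ Y' = {t2, a} := by
          ext z; grind
        rw [e1, Set.ncard_pair g.d2a] at ht
        omega
      · exact ht
    · left
      have e1 : ({t1, t2, t3, a, b} : Set β) ∩ Y' = {t2, a, b} := by
        ext z; grind
      rw [e1, n3 g.d2a g.d2b g.dab] at ht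
      refine ⟨ca, cb, by omega⟩

theorem exG5 (hk : ∀ g A B, QSep r g A B → B.Finite → 5 ≤ B.ncard)
    (h : QSep r e X Y) (hY : Y.ncard = 5) : ∃ e X t1 t2 t3 a b, QG5 r e X t1 t2 t3 a b := by
  obtain ⟨f, hf⟩ := hr.nonemp h
  obtain ⟨X', Y', h', he⟩ := hr.sep2 f e (by have := h.eY; grind)
  rcases hr.typGen hk h hY h' hf he with ht | ht
  · obtain ⟨t1, t2, t3, a, b, -, -, h1⟩ := hr.mkG5 h hY (T := Y ∩ Y') inter_subset_left ht.2.1 ht.1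
    exact ⟨_, _, _, _, _, _, _, h1⟩
  · obtain ⟨t1, t2, t3, a, b, -, -, h1⟩ := hr.mkG5 h' ht.2.2.2.2.1 (T := X ∩ Y')
      inter_subset_right ht.2.2.2.1 ht.2.2.1
    exact ⟨_, _, _, _, _, _, _, h1⟩

end QMat
end

section
attribute [-grind] Set.subset_insert
set_option linter.unusedSectionVars false
variable {β : Type u} {r : Set β → ℕ}

namespace QMat
variable (hr : QMat r)
include hr
variable {e f : β} {X Y X' Y' P Q : Set β} {k : ℕ} {t1 t2 t3 a b u1 u2 u3 : β}

theorem b2 (hk : ∀ g A B, QSep r g A B → B.Finite → 5 ≤ B.ncard)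
    (g : QG5 r e X t1 t2 t3 a b) (g' : QG5 r t1 X' u1 u2 u3 t2 a) (he : e ∈ X')
    (h1 : u1 ∈ X) (h2 : u2 ∈ X) (h3 : u3 ∈ X) : r (X ∩ X') = r univ - 2 := by
  set Y : Set β := {t1, t2, t3, a, b} with hYd
  set Y' : Set β := {u1, u2, u3, t2, a} with hYd'
  have hs := g.s
  have hs' := g'.s
  rw [← hYd] at hs
  rw [← hYd'] at hs'
  have hy : r Y = 3 := g.y
  have hy' : r Y' = 3 := g'.y
  have hXr : r X = r univ - 1 := by have := hs.sum; have := g.y; omega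
  have hXr' : r X' = r univ - 1 := by have := hs'.sum; have := g'.y; omega
  have h4 := hr.four
  have hXe : X = (X ∩ X') ∪ {u1, u2, u3} := by
    ext z
    have a1 := hs'.cov z
    have a2 := hs.dis z
    have a3 := hs'.dis z
    grind
  have i1 := hr.sub (A := X ∩ X') (B := {u1, u2, u3}) (I := ∅) (U := X) (by simp) hXe.le
  have i2 := g'.t
  have i3 := hr.notcl (A := X ∩ X') hs.cX inter_subset_left
  have i4 := hr.mono (A := insert e (X ∩ X')) (B := X') (by grind)
  by_contra hne
  have h5 : r (X ∩ X') + 3 = r univ := by have := hr.emp; omega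
  have i5 := hr.sub (A := Y) (B := Y') (I := {t2, a}) (U := Y ∪ Y') (by grind) le_rfl
  rw [hr.pair _ _ g.d2a] at i5
  have i6 : r (Y ∪ Y') ≤ 4 := by have := g.y; have := g'.y; omega
  have hz : (Y ∪ Y')ᶜ = insert e (X ∩ X') := by
    rw [compl_union, hs.cYn, hs'.cYn]; ext z
    have := hs.dis z; have := hs.cov z; have := hs'.dis z; have := hs'.cov z
    have := hs.eX
    grind
  have hz2 : (X ∩ X')ᶜ = insert e (Y ∪ Y') := by
    have := hs.eX
    rw [← compl_inj_iff, compl_compl, ← union_singleton, compl_union, hz]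
    ext z; grind
  have i7 := hr.L2 (A := X ∩ X') (by rw [hz2]; have := hr.ins e (Y ∪ Y'); omega) (by omega)
  have i8 := hr.lin i7
  have hXf : X.Finite := by
    rw [hXe]
    exact i8.1.union (by simp)
  have i9 := hk _ _ _ hs.symm hXf
  have i10 : X.ncard ≤ (X ∩ X').ncard + 3 := by
    have := Set.ncard_union_le (X ∩ X') {u1, u2, u3}
    rw [← hXe] at this
    have := ncard3_le u1 u2 u3
    omega
  have i11 := hr.two_le' (S := X ∩ X') (by omega)
  have i12 := hr.coc5 (insert e (X ∩ X')) (i8.1.insert e) (by rw [← hz, compl_compl]; omega)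
  have := Set.ncard_insert_le e (X ∩ X')
  omega

set_option maxHeartbeats 1000000 in
theorem b3' (hk : ∀ g A B, QSep r g A B → B.Finite → 5 ≤ B.ncard)
    (g : QG5 r e X t1 t2 t3 a b) (g' : QG5 r t1 X' u1 u2 u3 t2 a) (he : e ∈ X')
    (h3X : t3 ∈ X') (hbX : b ∈ X')
    (h1 : u1 ∈ X) (h2 : u2 ∈ X) (h3 : u3 ∈ X) (hPQ : QSep r t2 P Q) (heP : e ∈ P) (h1P : t1 ∈ P) :
    False := by
  have hb2 := hr.b2 hk g g' he h1 h2 h3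
  have hsp := hr.triSplit hPQ g.t (x := t2) (y := t1) (z := t3) (by grind) (by grind) (by grind)
    g.d12.symm g.d23 g.d13
  have h3Q : t3 ∈ Q := by have := hPQ.dis t1; grind
  have hY := hr.typGen hk g.s g.n hPQ (by grind) heP
  have hY' := hr.typGen hk g'.s g'.n hPQ (by grind) h1P
  have hs := g.s
  have hs' := g'.s
  have hX1 : ∀ z ∈ ({t1, t2, t3, a, b} : Set β), z ∉ X := fun z hz hx => hs.dis z hx hz
  have hX2 : ∀ z ∈ ({u1, u2, u3, t2, a} : Set β), z ∉ X' := fun z hz hx => hs'.dis z hx hz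
  have aX : a ∉ X := hX1 a (by grind)
  have aX' : a ∉ X' := hX2 a (by grind)
  have t2X : t2 ∉ X := hX1 t2 (by grind)
  have t3X : t3 ∉ X := hX1 t3 (by grind)
  have bX : b ∉ X := hX1 b (by grind)
  have t1X : t1 ∉ X := hX1 t1 (by grind)
  have t2Q : t2 ∉ Q := hPQ.eY
  have t1Q : t1 ∉ Q := hPQ.dis _ h1P
  have eX := hs.eX
  -- a contradiction when `a ∈ Q` and `Y' ∩ Q` is a triangle
  have hA : a ∈ Q → r (({u1, u2, u3, t2, a} : Set β) ∩ Q) ≤ 2 →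
      (({u1, u2, u3, t2, a} : Set β) ∩ Q).ncard = 3 → False := by
    intro haQ hr2 hn
    obtain ⟨p, q, hT, e1, e2, e3⟩ := triMem hn (x := a) (by grind)
    have hp : p ∈ ({u1, u2, u3, t2, a} : Set β) ∩ Q := by rw [hT]; grind
    have hq : q ∈ ({u1, u2, u3, t2, a} : Set β) ∩ Q := by rw [hT]; grind
    have hp' : p ∈ ({u1, u2, u3} : Set β) := by grind
    have hq' : q ∈ ({u1, u2, u3} : Set β) := by grind
    obtain ⟨w, hw, hwu, hwv⟩ := third (n3 g'.d12 g'.d13 g'.d23) p q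
    have hwa : w ≠ a := by rintro rfl; grind
    clear hX1 hX2 hk hb2 hsp hs hs' hPQ hT hn hY hY'
    refine hr.noline (p := p) (q := q) (x := a) (y := w) hr2 g'.t e3 ?_ ?_ ?_ ?_ ?_ ?_ ?_ ?_ ?_ ?_ ?_ <;> first | assumption | grind
  rcases hY with hY | hY
  · have hYQ : t3 ∈ Q ∧ a ∈ Q ∧ b ∈ Q := by
      have hsub : ({t1, t2, t3, a, b} : Set β) ∩ Q ⊆ {t3, a, b} := by intro z; grind
      have := Set.eq_of_subset_of_ncard_le hsub (by rw [n3 g.d3a g.d3b g.dab]; omega)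
      have h5 : ∀ z ∈ ({t3, a, b} : Set β), z ∈ Q := by rw [← this]; grind
      exact ⟨h5 _ (by grind), h5 _ (by grind), h5 _ (by grind)⟩
    rcases hY' with hY' | hY'
    · exact hA hYQ.2.1 hY'.1 hY'.2.1
    · obtain ⟨w, hw, hwu, hwv⟩ := third hY'.2.2.2.1 t3 b

      refine hr.noline (p := t3) (q := b) (x := a) (y := w) hY.1 hY'.2.2.1 g.d3b ?_ ?_ ?_ ?_ ?_ ?_ ?_ ?_ ?_ ?_ ?_ <;> first | assumption | (have := g.d3a; have := g.dab; grind)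
  · obtain ⟨c1, -, c2, c3, c4, c5⟩ := hY
    have hone : (a ∈ Q ∧ b ∉ Q) ∨ (a ∉ Q ∧ b ∈ Q) := by
      by_cases ha : a ∈ Q <;> by_cases hb : b ∈ Q
      · exfalso
        have e1 : ({t1, t2, t3, a, b} : Set β) ∩ Q = {t3, a, b} := by ext z; grind
        rw [e1, n3 g.d3a g.d3b g.dab] at c1
        omega
      · exact Or.inl ⟨ha, hb⟩
      · exact Or.inr ⟨ha, hb⟩
      · exfalso
        have e1 : ({t1, t2, t3, a, b} : Set β) ∩ Q = {t3} := by ext z; grind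
        rw [e1, Set.ncard_singleton] at c1
        omega
    rcases hY' with hY' | hY'
    · rcases hone with ⟨ha, hb⟩ | ⟨ha, hb⟩
      · exact hA ha hY'.1 hY'.2.1
      · have hsub : ({u1, u2, u3, t2, a} : Set β) ∩ Q ⊆ {u1, u2, u3} := by intro z; grind
        have hE := Set.eq_of_subset_of_ncard_le hsub (by rw [n3 g'.d12 g'.d13 g'.d23]; omega)
        have h5 : ∀ z ∈ ({u1, u2, u3} : Set β), z ∈ Q := by rw [← hE]; grind
        have hsub2 : ({u1, u2, u3} : Set β) ⊆ X ∩ Q := by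
          intro z hz; have := h5 z hz; grind
        have hE2 := Set.eq_of_subset_of_ncard_le hsub2 (by rw [n3 g'.d12 g'.d13 g'.d23]; omega)
          (fin_of_pos (by omega))
        have hsubP : insert e (X ∩ X') ⊆ X' ∩ P := by
          intro z hz
          rcases hz with rfl | hz
          · exact ⟨he, heP⟩
          · refine ⟨hz.2, ?_⟩
            have a1 := hPQ.cov z
            have a2 : z ∈ Q → z ∈ ({u1, u2, u3} : Set β) := by
              rw [hE2]; intro hh; exact ⟨hz.1, hh⟩
            have a3 := hX2 z
            grind
        have i1 := hr.sub hsubP (subset_refl (X' ∪ P))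
        have i2 := hr.mono (A := insert t1 X') (B := X' ∪ P) (by grind)
        have i3 := hs'.cX
        have i4 := hr.notcl (A := X ∩ X') hs.cX inter_subset_left
        have i5 := hPQ.sum
        have i6 := hs'.sum
        have i7 := g'.y
        have := hr.four
        omega
    · obtain ⟨f1, -, f2, f3, f4, f5⟩ := hY'
      rcases hone with ⟨ha, hb⟩ | ⟨ha, hb⟩
      · obtain ⟨x, y, hxy, hE⟩ := Set.ncard_eq_two.1 f1
        have haE : a ∈ ({x, y} : Set β) := by rw [← hE]; grind
        obtain ⟨u, hu⟩ : ∃ u, ({u1, u2, u3, t2, a} : Set β) ∩ Q = {a, u} := by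
          rcases haE with rfl | rfl
          · exact ⟨y, hE⟩
          · exact ⟨x, by rw [hE]; grind⟩
        obtain ⟨v1, v1m, v1u, -⟩ := third c3 u u
        obtain ⟨v2, v2m, v2u, v21⟩ := third c3 u v1
        have hW : ∀ z ∈ X ∩ Q, z ≠ u → z ∈ X' ∩ Q := by
          intro z hz hzu
          have a1 := hs'.cov z
          have a2 : z ∈ ({u1, u2, u3, t2, a} : Set β) ∩ Q → z = a ∨ z = u := by rw [hu]; grind
          grind
        have w1 := hW v1 v1m v1u
        have w2 := hW v2 v2m v2u
        have haa : a ≠ u := by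
          rintro rfl
          rw [hu] at f1
          simp at f1
        have huX : u ∈ X ∩ Q := by
          have : u ∈ ({u1, u2, u3, t2, a} : Set β) ∩ Q := by rw [hu]; grind
          grind
        clear hX1 hX2 hk hb2 hsp hs hs' hPQ hA c1 c3 c4 f1 f3 f4 hu hE hW haE
        refine hr.noline (p := v1) (q := v2) (x := u) (y := t3) c2 f2 v21.symm ?_ ?_ ?_ ?_ ?_ ?_ ?_ ?_ ?_ ?_ ?_ <;> first | assumption | grind
      · obtain ⟨p, q, hp, hq, hpq⟩ := two_of (T := ({u1, u2, u3, t2, a} : Set β) ∩ Q) (by omega)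
        obtain ⟨v, hv, hvp, hvq⟩ := third c3 p q
        have hp' : p ∈ ({u1, u2, u3} : Set β) := by grind
        have hq' : q ∈ ({u1, u2, u3} : Set β) := by grind
        obtain ⟨w, hw, hwu, hwv⟩ := third (n3 g'.d12 g'.d13 g'.d23) p q
        have hn3 : ∀ z, z ∈ ({u1, u2, u3, t2, a} : Set β) → z ∈ Q → z ≠ p → z ≠ q → False := by
          intro z hz hzQ z1 z2
          have := Set.ncard_le_ncard (s := {z, p, q}) (t := ({u1, u2, u3, t2, a} : Set β) ∩ Q)
            (by intro y; grind) (fin_of_pos (by omega))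
          rw [n3 z1 z2 hpq] at this
          omega
        have hv1 := hn3 v
        have hw1 := hn3 w
        clear hX1 hX2 hk hb2 hsp hs hs' hPQ hA c1 c3 c4 f1 f3 f4 hn3
        refine hr.noline (p := p) (q := q) (x := v) (y := w) c2 g'.t hpq ?_ ?_ ?_ ?_ ?_ ?_ ?_ ?_ ?_ ?_ ?_ <;> first | assumption | grind

theorem b3 (hk : ∀ g A B, QSep r g A B → B.Finite → 5 ≤ B.ncard)
    (g : QG5 r e X t1 t2 t3 a b) (h' : QSep r t1 X' Y') (he : e ∈ X') (h2 : t2 ∈ Y')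
    (hn : ¬ r {t2, a, b} ≤ 2) (hPQ : QSep r t2 P Q) (heP : e ∈ P) : t1 ∈ Q := by
  by_contra hc
  have h1P : t1 ∈ P := by have := hPQ.cov t1; have := g.d12; grind
  obtain ⟨h3, h4⟩ := hr.typT1 hk g h' he h2
  rcases h4 with h4 | h4 | h4
  · exact hn h4.2.2
  · obtain ⟨ha, hb, u1, u2, u3, m1, m2, m3, rfl, g'⟩ := h4
    exact hr.b3' hk g g' he h3 hb m1 m2 m3 hPQ heP h1P
  · obtain ⟨ha, hb, u1, u2, u3, m1, m2, m3, rfl, g'⟩ := h4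
    exact hr.b3' hk g.swab g' he h3 hb m1 m2 m3 hPQ heP h1P

theorem b4 (hk : ∀ g A B, QSep r g A B → B.Finite → 5 ≤ B.ncard)
    (g : QG5 r e X t1 t2 t3 a b) : ∃ s1 s2 s3, QG5 r e X s1 s2 s3 a b ∧ r {s1, a, b} ≤ 2 ∧
      ({s1, s2, s3} : Set β) = {t1, t2, t3} := by
  by_contra hc
  push Not at hc
  have n1 : ¬ r {t1, a, b} ≤ 2 := fun h => hc t1 t2 t3 g h rfl
  have n2 : ¬ r {t2, a, b} ≤ 2 := fun h => hc t2 t1 t3 g.sw12 h (by grind)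
  have n3 : ¬ r {t3, a, b} ≤ 2 := fun h => hc t3 t1 t2 g.sw23.sw12 h (by grind)
  have heY := g.s.eY
  obtain ⟨P1, Q1, s1, e1⟩ := hr.sep2 t1 e (by grind)
  obtain ⟨P2, Q2, s2, e2⟩ := hr.sep2 t2 e (by grind)
  obtain ⟨P3, Q3, s3, e3⟩ := hr.sep2 t3 e (by grind)
  have k1 := hr.triSplit s1 g.t (x := t1) (y := t2) (z := t3) (by grind) (by grind) (by grind)
    g.d12 g.d13 g.d23
  have k2 := hr.triSplit s2 g.t (x := t2) (y := t1) (z := t3) (by grind) (by grind) (by grind)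
    g.d12.symm g.d23 g.d13
  have k3 := hr.triSplit s3 g.t (x := t3) (y := t1) (z := t2) (by grind) (by grind) (by grind)
    g.d13.symm g.d23.symm g.d12
  have b12 := fun h => hr.b3 hk g s1 e1 h n2 s2 e2
  have b13 := fun h => hr.b3 hk g.sw23 s1 e1 h n3 s3 e3
  have b21 := fun h => hr.b3 hk g.sw12 s2 e2 h n1 s1 e1
  have b23 := fun h => hr.b3 hk g.sw12.sw23 s2 e2 h n3 s3 e3
  have b31 := fun h => hr.b3 hk g.sw23.sw12 s3 e3 h n1 s1 e1
  have b32 := fun h => hr.b3 hk g.sw23.sw12.sw23 s3 e3 h n2 s2 e2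
  clear hc hk n1 n2 n3 hr heY s1 s2 s3 g e1 e2 e3
  rcases k1 with k1 | k1 <;> rcases k2 with k2 | k2 <;> rcases k3 with k3 | k3 <;> simp_all

end QMat
end

section
attribute [-grind] Set.subset_insert
set_option linter.unusedSectionVars false
variable {β : Type u} {r : Set β → ℕ}

namespace QMat
variable (hr : QMat r)
include hr
variable {e f : β} {X Y X' Y' P Q S R : Set β} {k : ℕ} {t1 t2 t3 a b u1 u2 u3 : β}

theorem tricl {x y z : β} {A : Set β} (h : r {x, y, z} ≤ 2) (hyz : y ≠ z) (hy : y ∈ A)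
    (hz : z ∈ A) : r (insert x A) = r A := by
  have h1 := hr.pair y z hyz
  exact hr.clmono (A := {y, z}) (by omega) (by grind)

theorem moveN (hk : ∀ g A B, QSep r g A B → B.Finite → 5 ≤ B.ncard) (h : QSep r f X' Y')
    {x y z : β} (hx : x ∈ X') (hX : X'.ncard ≤ 5) (hXf : X'.Finite) (h3 : r {x, y, z} ≤ 2)
    (hyz : y ≠ z)
    (hy : y ∈ Y') (hz : z ∈ Y') : False := by
  have h1 := hr.move h hx (hr.tricl h3 hyz hy hz)
  have h2 := hk _ _ _ h1.symm hXf.sdiff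
  have := Set.ncard_sdiff_singleton_of_mem hx
  omega

set_option maxHeartbeats 1000000 in
theorem d5 (hk : ∀ g A B, QSep r g A B → B.Finite → 5 ≤ B.ncard)
    (g : QG5 r e X t1 t2 t3 a b) (g' : QG5 r t1 X' u1 u2 u3 t2 a) (he : e ∈ X')
    (h3X : t3 ∈ X') (hbX : b ∈ X') (h1ab : r {t1, a, b} ≤ 2) (hu : r {u1, t2, a} ≤ 2)
    (h1 : u1 ∈ X) (h2 : u2 ∈ X) (h3 : u3 ∈ X) (hSR : QSep r u1 S R) (h1S : t1 ∈ S)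
    (haR : a ∈ R) (h2S : t2 ∈ S) (hu2 : u2 ∈ R) (hu3 : u3 ∈ S) : False := by
  have hs := g.s
  have hs' := g'.s
  have dab := g.dab; have d1b := g.d1b; have d1a := g.d1a; have d12 := g.d12
  have d23 := g.d23; have d13 := g.d13; have d3b := g.d3b; have d2a := g.d2a
  have v23 := g'.d23
  have n1 : ∀ z ∈ ({t1, t2, t3, a, b} : Set β), z ∉ X := fun z hz hx => hs.dis z hx hz
  have n1' : ∀ z ∈ ({u1, u2, u3, t2, a} : Set β), z ∉ X' := fun z hz hx => hs'.dis z hx hz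
  have bX := n1 b (by grind)
  have t3X := n1 t3 (by grind)
  have t1X := n1 t1 (by grind)
  have u1X' := n1' u1 (by grind)
  have t1X' := hs'.eX
  have eX := hs.eX
  have aS : a ∉ S := fun h => hSR.dis _ h haR
  have t2R : t2 ∉ R := fun h => hSR.dis _ h2S h
  have t1R : t1 ∉ R := fun h => hSR.dis _ h1S h
  have u2S : u2 ∉ S := fun h => hSR.dis _ h hu2
  have u3R : u3 ∉ R := fun h => hSR.dis _ hu3 h
  have u1S := hSR.eX
  have u1R := hSR.eY
  have covt3 := hSR.cov t3
  have covb := hSR.cov b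
  have cove := hSR.cov e
  clear n1 n1'
  -- type of `u1` relative to `Y'`
  have e1 : ({u1, u2, u3, t2, a} : Set β) ∩ R = {u2, a} := by ext z; grind
  have ty := hr.typGen hk hs' g'.n hSR (by grind) h1S
  rw [e1, Set.ncard_pair g'.d2b] at ty
  obtain ⟨-, -, c1, c2, c3, c4⟩ := ty.resolve_left (by omega)
  have hRf : R.Finite := fin_of_pos (by omega)
  have hbR : b ∈ R := by
    by_contra hb
    have hbS : b ∈ S := by grind
    have : ({a, t1, b} : Set β) = {t1, a, b} := by grind
    exact hr.moveN hk hSR.symm (x := a) (y := t1) (z := b) haR (by omega) hRf (by rw [this]; exact h1ab)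
      d1b h1S hbS
  have hm := hr.move hSR h1S (hr.tricl h1ab dab haR hbR)
  have hcl := hr.tricl h1ab dab haR hbR
  have e2 : ({u1, u2, u3, t2, a} : Set β) ∩ (S \ {t1}) = {u3, t2} := by ext z; grind
  have ty2 := hr.typGen hk hs' g'.n hm.symm (by grind) (by grind)
  rw [e2, Set.ncard_pair g'.d3a] at ty2
  obtain ⟨-, -, f1, f2, f3, f4⟩ := ty2.resolve_left (by omega)
  have hSf : (S \ {t1}).Finite := fin_of_pos (by omega)
  have hn : r univ = 4 := by have := hm.sum; omega
  have h3S : t3 ∈ S := by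
    by_contra hb
    have hbS : t3 ∈ R := by grind
    have : ({t2, t1, t3} : Set β) = {t1, t2, t3} := by grind
    exact hr.moveN hk hm (x := t2) (y := t1) (z := t3) (by grind) (by omega) hSf
      (by rw [this]; exact g.t) d13 (by grind) (by grind)
  -- rank of `X ∩ X'`
  have hX0 : r (X ∩ X') ≤ 2 := by
    have i1 := hr.submod X X'
    have i2 := hr.mono (A := insert e X) (B := X ∪ X') (by grind)
    have := hs.cX
    have := hs.sum
    have := hs'.sum
    have := g.y
    have := g'.y
    omega
  have hX0m : ∀ z ∈ X', z ≠ e → z ≠ t3 → z ≠ b → z ∈ X ∩ X' := by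
    intro z hz z1 z2 z3
    have a1 := hs.cov z
    have a2 := hs'.dis z hz
    grind
  have t3R : t3 ∉ R := hSR.dis _ h3S
  have bS : b ∉ S := fun h => hSR.dis _ h hbR
  have ue : u1 ≠ e := by rintro rfl; exact eX h1
  have eR : e ∈ S → e ∉ R := hSR.dis e
  have eb : e ≠ b := by have := hs.eY; grind
  have et3 : e ≠ t3 := by have := hs.eY; grind
  have et1 : e ≠ t1 := by have := hs.eY; grind
  have dis := hSR.dis
  obtain ⟨p, q, hW, p1, p2, p3⟩ := triMem c2 (x := b) (by grind)
  obtain ⟨p', q', hW', p1', p2', p3'⟩ := triMem f2 (x := t3) (by grind)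
  have hp : p ∈ X' ∩ R := by rw [hW]; grind
  have hq : q ∈ X' ∩ R := by rw [hW]; grind
  have hp' : p' ∈ X' ∩ (S \ {t1}) := by rw [hW']; grind
  have hq' : q' ∈ X' ∩ (S \ {t1}) := by rw [hW']; grind
  have dp := dis p'
  have dq := dis q'
  by_cases hE : e ∈ R
  · have eS : e ∉ S := fun h => dis e h hE
    obtain ⟨w, hw, hwb, hwe⟩ := third c2 b e
    have k1 := hX0m w (by grind) (by grind) (by grind) (by grind)
    have k2 := hX0m p' (by grind) (by grind) (by grind) (by grind)
    have k3 := hX0m q' (by grind) (by grind) (by grind) (by grind)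
    have dw := dis w
    clear hX0m dis hk hs hs' ty ty2 hm hW hW' e1 e2 cove covt3 covb
    refine hr.noline (p := p') (q := q') (x := w) (y := t3) hX0 f1 p3' ?_ ?_ ?_ ?_ ?_ ?_ ?_ ?_ ?_ ?_ ?_ <;> first | assumption | grind
  · have eS : e ∈ S := by grind
    obtain ⟨w, hw, hwb, hwe⟩ := third f2 t3 e
    have k1 := hX0m w (by grind) (by grind) (by grind) (by grind)
    have k2 := hX0m p (by grind) (by grind) (by grind) (by grind)
    have k3 := hX0m q (by grind) (by grind) (by grind) (by grind)
    have dw := dis w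
    clear hX0m dis hk hs hs' ty ty2 hm hW hW' e1 e2 cove covt3 covb
    refine hr.noline (p := p) (q := q) (x := w) (y := b) hX0 c1 p3 ?_ ?_ ?_ ?_ ?_ ?_ ?_ ?_ ?_ ?_ ?_ <;> first | assumption | grind

theorem c5 (hk : ∀ g A B, QSep r g A B → B.Finite → 5 ≤ B.ncard)
    (g : QG5 r e X t1 t2 t3 a b) (h1ab : r {t1, a, b} ≤ 2) (h' : QSep r t1 X' Y')
    (he : e ∈ X') (h2 : t2 ∈ Y') (ha : a ∈ Y') : False := by
  have hsp := hr.triSplit h' h1ab (x := t1) (y := a) (z := b) (by grind) (by grind) (by grind)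
    g.d1a g.d1b g.dab
  have hb : b ∈ X' ∧ b ∉ Y' := by have := h'.dis a; grind
  obtain ⟨h3, h4⟩ := hr.typT1 hk g h' he h2
  obtain ⟨-, -, u1, u2, u3, m1, m2, m3, rfl, g'⟩ :
    (a ∈ Y' ∧ b ∈ X' ∧ ∃ u1 u2 u3, u1 ∈ X ∧ u2 ∈ X ∧ u3 ∈ X ∧ Y' = {u1, u2, u3, t2, a} ∧
      QG5 r t1 X' u1 u2 u3 t2 a) := by
    rcases h4 with h4 | h4 | h4
    · exact absurd h4.2.1 hb.2
    · exact h4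
    · exact absurd h4.1 hb.2
  obtain ⟨v1, v2, v3, g2, hv, hE⟩ := hr.b4 hk g'
  have hvX : ∀ z ∈ ({v1, v2, v3} : Set β), z ∈ X := by rw [hE]; grind
  have w1 := hvX v1 (by grind)
  have w2 := hvX v2 (by grind)
  have w3 := hvX v3 (by grind)
  obtain ⟨S, R, hSR, h1S⟩ := hr.sep2 v1 t1 (by have := g2.s.eY; grind)
  have s1 := hr.triSplit hSR g2.t (x := v1) (y := v2) (z := v3) (by grind) (by grind) (by grind)
    g2.d12 g2.d13 g2.d23
  have s2 := hr.triSplit hSR hv (x := v1) (y := t2) (z := a) (by grind) (by grind) (by grind)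
    g2.d1a g2.d1b g2.dab
  have hv' : r {v1, a, t2} ≤ 2 := by
    have : ({v1, a, t2} : Set β) = {v1, t2, a} := by grind
    rw [this]; exact hv
  rcases s1 with s1 | s1 <;> rcases s2 with s2 | s2
  · exact hr.d5 hk g g2.sw23 he h3 hb.1 h1ab hv w1 w3 w2 hSR h1S s2.2.1 s2.1 s1.2.1 s1.1
  · exact hr.d5 hk (g.swt h1ab) g2.sw23.swab he hb.1 h3 g.t hv' w1 w3 w2 hSR h1S s2.1 s2.2.1 s1.2.1 s1.1
  · exact hr.d5 hk g g2 he h3 hb.1 h1ab hv w1 w2 w3 hSR h1S s2.2.1 s2.1 s1.1 s1.2.1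
  · exact hr.d5 hk (g.swt h1ab) g2.swab he hb.1 h3 g.t hv' w1 w2 w3 hSR h1S s2.1 s2.2.1 s1.1 s1.2.1

theorem k5 (hk : ∀ g A B, QSep r g A B → B.Finite → 5 ≤ B.ncard)
    (h : QSep r e X Y) (hY : Y.ncard = 5) : False := by
  obtain ⟨e, X, t1, t2, t3, a, b, g⟩ := hr.exG5 hk h hY
  obtain ⟨t1, t2, t3, g, h1, -⟩ := hr.b4 hk g
  obtain ⟨X', Y', h', he⟩ := hr.sep2 t1 e (by have := g.s.eY; grind)
  have s1 := hr.triSplit h' g.t (x := t1) (y := t2) (z := t3) (by grind) (by grind) (by grind)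
    g.d12 g.d13 g.d23
  have s2 := hr.triSplit h' h1 (x := t1) (y := a) (z := b) (by grind) (by grind) (by grind)
    g.d1a g.d1b g.dab
  have h1' : r {t1, b, a} ≤ 2 := by
    have : ({t1, b, a} : Set β) = {t1, a, b} := by grind
    rw [this]; exact h1
  rcases s1 with s1 | s1 <;> rcases s2 with s2 | s2
  · exact hr.c5 hk g.sw23.swab h1' h' he s1.2.1 s2.2.1
  · exact hr.c5 hk g.sw23 h1 h' he s1.2.1 s2.1
  · exact hr.c5 hk g.swab h1' h' he s1.1 s2.2.1
  · exact hr.c5 hk g h1 h' he s1.1 s2.1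

theorem exists4 : ∃ e X Y, QSep r e X Y ∧ Y.ncard = 4 := by
  obtain ⟨e, X, Y, h, hf, hk⟩ := hr.exMin
  have h1 := hr.L6 h hf hk
  have h2 := hr.k4 h hf
  refine ⟨e, X, Y, h, ?_⟩
  by_contra hc
  have h5 : Y.ncard = 5 := by omega
  rw [h5] at hk
  exact hr.k5 hk h h5

end QMat
end

section
attribute [-grind] Set.subset_insert
set_option linter.unusedSectionVars false
variable {β : Type u} {r : Set β → ℕ}

def QSees {β : Type u} (r : Set β → ℕ) (S : Set β) (i j : β) : Prop :=
  r (insert i (insert j S)) ≤ r S + 1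

theorem QSees.symm {S : Set β} {i j : β} (h : QSees r S i j) : QSees r S j i := by
  unfold QSees at *
  rw [Set.insert_comm]; exact h

structure QBip {β : Type u} (r : Set β → ℕ) (X S S' : Set β) : Prop where
  u : S ∪ S' = X
  d : ∀ z ∈ S, z ∉ S'
  s : r S + r S' ≤ r univ

theorem QBip.symm {X S S' : Set β} (h : QBip r X S S') : QBip r X S' S :=
  ⟨by rw [← h.u, union_comm], fun z h1 h2 => h.d z h2 h1, by have := h.s; omega⟩

namespace QMat
variable (hr : QMat r)
include hr
variable {e f : β} {X Y X' Y' P Q S S' S1 S1' S2 S2' q W : Set β} {i j k l m s : β}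

theorem c4r (h : QSep r e X Y) (hY : Y.ncard = 4) : r Y = 3 := by
  have hYf := fin_of_pos (T := Y) (by omega)
  have h3 := h.r3
  by_contra hc
  obtain ⟨y, hy⟩ := hr.nonemp h
  have e1 : (insert e (Y \ {y}))ᶜ = insert y X := by
    ext z; have := h.cov z; have := h.dis z; have := h.eX; have := h.eY; grind
  have h1 := hr.coc5 (insert e (Y \ {y})) (hYf.sdiff.insert e)
    (by rw [e1]; have := hr.ins y X; have := h.sum; omega)
  have h2 := Set.ncard_sdiff_singleton_of_mem hy
  have := Set.ncard_insert_le e (Y \ {y})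
  omega

theorem c4X (h : QSep r e X Y) (hY : Y.ncard = 4) : r X + 1 = r univ := by
  have := hr.c4r h hY
  have := h.sum
  omega

theorem c4n (h : QSep r e X Y) (hY : Y.ncard = 4) : (insert e Y).ncard = 5 := by
  rw [Set.ncard_insert_of_notMem h.eY (fin_of_pos (by omega)), hY]

theorem c4tri (h : QSep r e X Y) (hY : Y.ncard = 4) {T : Set β} (hT : T ⊆ insert e Y)
    (h3 : T.ncard = 3) : 3 ≤ r T :=
  hr.tri5 (insert e Y) T (hr.c4n h hY) (by rw [h.cYe]; exact h.lX) hT h3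

theorem c4cl (h : QSep r e X Y) (hY : Y.ncard = 4) (hi : i ∈ insert e Y) (hS : S ⊆ X) :
    r (insert i S) = r S + 1 := by
  refine hr.notcl (X := X) ?_ hS
  rcases hi with rfl | hi
  · exact h.cX
  · have hYf := fin_of_pos (T := Y) (by omega)
    have e1 : (insert e (Y \ {i}))ᶜ = insert i X := by
      ext z; have := h.cov z; have := h.dis z; have := h.eX; have := h.eY; grind
    have h1 := hr.coc5 (insert e (Y \ {i})) (hYf.sdiff.insert e)
    have h2 := Set.ncard_sdiff_singleton_of_mem hi
    have := Set.ncard_insert_le e (Y \ {i})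
    rw [e1] at h1
    have := hr.c4X h hY
    have := hr.ins i X
    by_contra hc
    have := h1 (by omega)
    omega

theorem seesMono (h : QSep r e X Y) (hY : Y.ncard = 4) (hi : i ∈ insert e Y) (hS : S ⊆ S')
    (hS' : S' ⊆ X) (hs : QSees r S i j) : QSees r S' i j := by
  unfold QSees at *
  have h1 := hr.c4cl h hY hi (hS.trans hS')
  have h2 := hr.sub (A := insert i S') (B := insert i (insert j S)) (I := insert i S)
    (U := insert i (insert j S')) (by intro z; grind) (by intro z; grind)
  have h3 := hr.ins i S'
  omega

theorem seesTrans (h : QSep r e X Y) (hY : Y.ncard = 4) (hj : j ∈ insert e Y)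
    (hS' : S ⊆ X) (h1 : QSees r S i j) (h2 : QSees r S j k) :
    r (S ∪ {i, j, k}) ≤ r S + 1 := by
  unfold QSees at *
  have h3 := hr.c4cl h hY hj hS'
  have h4 := hr.sub (A := insert i (insert j S)) (B := insert j (insert k S)) (I := insert j S)
    (U := S ∪ {i, j, k}) (by intro z; grind) (by intro z; grind)
  omega

theorem smallq (h : QSep r e X Y) (hY : Y.ncard = 4) (hq : q ⊆ X) (hW : W = X \ q)
    (h2 : r q ≤ 2) {K : Set β} (hK : K ⊆ insert e Y) (hK3 : K.ncard = 3 ∨ (K.ncard = 2 ∧ q.ncard ≤ 1))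
    (hlt : r (W ∪ K) < r univ) : False := by
  have hYf := fin_of_pos (T := Y) (by omega)
  have hqf := hr.lin h2
  have e1 : (q ∪ (insert e Y \ K))ᶜ = W ∪ K := by
    subst hW
    ext z; have := h.cov z; have := h.dis z; have := h.eX; have := h.eY
    have : z ∈ K → z ∈ insert e Y := fun hz => hK hz
    grind
  have hCf : (insert e Y).Finite := hYf.insert e
  have h3 := hr.coc5 (q ∪ (insert e Y \ K)) (hqf.1.union hCf.sdiff) (by rw [e1]; exact hlt)
  have h4 := Set.ncard_union_le q (insert e Y \ K)
  have h5 := Set.ncard_sdiff_add_ncard_of_subset hK hCf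
  rw [hr.c4n h hY] at h5
  have hq3 : q.ncard = 3 := by omega
  have := hr.tri5 (q ∪ (insert e Y \ K)) q (by omega) (by rw [e1]; exact hlt) subset_union_left hq3
  omega

theorem qc (h : QSep r e X Y) (hq : q ⊆ X) (hW : W = X \ q) : qᶜ = W ∪ insert e Y := by
  subst hW
  ext z; have := h.cov z; have := h.dis z; have := h.eX; have := h.eY
  grind

theorem qlem (h : QSep r e X Y) (hY : Y.ncard = 4) (hq : q ⊆ X) (hW : W = X \ q)
    (hn : r q + r W ≤ r univ) (hi : i ∈ insert e Y) (hj : j ∈ insert e Y) (hk : k ∈ insert e Y)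
    (hij : i ≠ j) (hik : i ≠ k) (hjk : j ≠ k) (h1 : QSees r W i j) (h2 : QSees r W j k) :
    r q ≤ 1 := by
  have hWX : W ⊆ X := by rw [hW]; exact sdiff_subset
  have h3 := hr.seesTrans h hY hj hWX h1 h2
  have hT : ({i, j, k} : Set β) ⊆ insert e Y := by intro z; grind
  have h4 := hr.c4tri h hY hT (n3 hij hik hjk)
  have h5 := hr.sub (A := W ∪ {i, j, k}) (B := insert e Y) (I := {i, j, k})
    (U := W ∪ insert e Y) (by intro z; grind) (by intro z; grind)
  have h6 := h.cY
  have h7 := hr.c4r h hY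
  have h8 := hr.mono hq
  have h9 := h.lX
  have hq2 := hr.L2 (A := q) (by rw [hr.qc h hq hW]; omega) (by omega)
  by_contra hc
  have hqn := hr.lin hq2
  have hqn2 := hr.le_ncard hqn.1
  have h10 := n3 hij hik hjk
  exact hr.smallq h hY hq hW hq2 (K := {i, j, k}) hT (by omega) (by omega)

theorem zlem (h : QSep r e X Y) (hY : Y.ncard = 4) (hq : q ⊆ X) (hW : W = X \ q)
    (hne : q.Nonempty) (hi : i ∈ insert e Y) (hj : j ∈ insert e Y)
    (hij : i ≠ j) (h1 : QSees r W i j) : r univ ≤ r q + r W := by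
  by_contra hn
  have hT : ({i, j} : Set β) ⊆ insert e Y := by intro z; grind
  have hWe : W ∪ {i, j} = insert i (insert j W) := by ext z; grind
  have h3 : r (W ∪ {i, j}) ≤ r W + 1 := by rw [hWe]; exact h1
  have h5 := hr.sub (A := W ∪ {i, j}) (B := insert e Y) (I := {i, j})
    (U := W ∪ insert e Y) (by intro z; grind) (by intro z; grind)
  have h6 := h.cY
  have h7 := hr.c4r h hY
  have h8 := hr.mono hq
  have h9 := h.lX
  rw [hr.pair i j hij] at h5
  have hq2 := hr.L2 (A := q) (by rw [hr.qc h hq hW]; omega) (by omega)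
  have hqn := hr.lin hq2
  have hqn2 := hr.le_ncard hqn.1
  have hq0 : 0 < q.ncard := (Set.ncard_pos hqn.1).2 hne
  by_cases hq1 : r q ≤ 1
  · have hp := hr.pt hq1
    have hq1' : 1 ≤ r q := by
      obtain ⟨x, hx⟩ := hne
      have := hr.one x
      have := hr.mono (A := {x}) (B := q) (by grind)
      omega
    have h10 := Set.ncard_pair hij
    exact hr.smallq h hY hq hW hq2 (K := {i, j}) hT (by omega) (by omega)
  · obtain ⟨k, hk, hki, hkj⟩ : ∃ k ∈ insert e Y, k ≠ i ∧ k ≠ j := by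
      have h10 := Set.ncard_pair hij
      have := hr.c4n h hY
      obtain ⟨k, hk, hk2⟩ := Set.exists_mem_notMem_of_ncard_lt_ncard
        (show ({i, j} : Set β).ncard < (insert e Y).ncard by omega)
      exact ⟨k, hk, by grind⟩
    have hT : ({i, j, k} : Set β) ⊆ insert e Y := by intro z; grind
    have h10 := n3 hij hki.symm hkj.symm
    have h11 := hr.insle (A := W ∪ {i, j}) (B := W ∪ {i, j, k}) k (by intro z; grind)
    exact hr.smallq h hY hq hW hq2 (K := {i, j, k}) hT (by omega) (by omega)

theorem qe (h : QSep r e X Y) (hY : Y.ncard = 4) (b : QBip r X S S') (hi : i ∈ insert e Y)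
    (hj : j ∈ insert e Y) (hk : k ∈ insert e Y)
    (hij : i ≠ j) (hik : i ≠ k) (hjk : j ≠ k) (h1 : QSees r S i j) (h2 : QSees r S j k) :
    r S' ≤ 1 := by
  refine hr.qlem h hY (q := S') (W := S) ?_ ?_ ?_ hi hj hk hij hik hjk h1 h2
  · rw [← b.u]; exact subset_union_right
  · rw [← b.u]; ext z; have := b.d z; grind
  · have := b.s; omega

theorem qz (h : QSep r e X Y) (hY : Y.ncard = 4) (b1 : QBip r X S1 S1') (b2 : QBip r X S2 S2')
    (hne : (S1' ∩ S2').Nonempty) (hl : l ∈ insert e Y) (hm : m ∈ insert e Y) (hlm : l ≠ m)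
    (hs : QSees r S1 l m)
    (hi : i ∈ insert e Y)
    (hj : j ∈ insert e Y) (hk : k ∈ insert e Y)
    (hij : i ≠ j) (hik : i ≠ k) (hjk : j ≠ k) (h1 : QSees r (S1' ∪ S2') i j)
    (h2 : QSees r (S1' ∪ S2') j k) :
    r (S1 ∩ S2) ≤ 1 := by
  have u1 := b1.u
  have u2 := b2.u
  have e1 : S1' ∪ S2' = X \ (S1 ∩ S2) := by
    ext z; have := b1.d z; have := b2.d z
    have m1 : z ∈ S1 ∪ S1' ↔ z ∈ X := by rw [u1]
    have m2 : z ∈ S2 ∪ S2' ↔ z ∈ X := by rw [u2]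
    grind
  have e2 : S1 ∪ S2 = X \ (S1' ∩ S2') := by
    ext z; have := b1.d z; have := b2.d z
    have m1 : z ∈ S1 ∪ S1' ↔ z ∈ X := by rw [u1]
    have m2 : z ∈ S2 ∪ S2' ↔ z ∈ X := by rw [u2]
    grind
  have a1 : S1 ⊆ X := by rw [← u1]; exact subset_union_left
  have a2 : S1' ⊆ X := by rw [← u1]; exact subset_union_right
  have a3 : S2 ⊆ X := by rw [← u2]; exact subset_union_left
  have hz := hr.zlem h hY (q := S1' ∩ S2') (W := S1 ∪ S2) (inter_subset_left.trans a2) e2 hne hl hm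
    hlm (hr.seesMono h hY hl subset_union_left (union_subset a1 a3) hs)
  have i1 := hr.submod S1 S2
  have i2 := hr.submod S1' S2'
  have := b1.s
  have := b2.s
  exact hr.qlem h hY (inter_subset_left.trans a1) e1 (by omega) hi hj hk hij hik hjk h1 h2

end QMat
end

section
attribute [-grind] Set.subset_insert
set_option linter.unusedSectionVars false
variable {β : Type u} {r : Set β → ℕ}

structure QSpl {β : Type u} (r : Set β → ℕ) (e f : β) (X Y P Q : Set β) (c a b : β) : Prop where
  fc : f ≠ c
  fa : f ≠ a
  fb : f ≠ b
  ca : c ≠ a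
  cb : c ≠ b
  ab : a ≠ b
  hY : Y = {f, c, a, b}
  cP : c ∈ P
  aQ : a ∈ Q
  bQ : b ∈ Q
  sQ : QSees r (X ∩ Q) a b
  sP : QSees r (X ∩ P) e c
  bip : QBip r X (X ∩ Q) (X ∩ P)
  rQ : 2 ≤ r (X ∩ Q)
  rP : 2 ≤ r (X ∩ P)

namespace QMat
variable (hr : QMat r)
include hr
variable {e f a b c : β} {X Y P Q : Set β}

theorem c1a (h : QSep r e X Y) (hY : Y.ncard = 4) (hf : f ∈ Y) (g : QSep r f P Q)
    (hs : Y \ {f} ⊆ Q) : False := by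
  have h1 := Set.ncard_sdiff_singleton_of_mem hf
  have h2 := hr.c4tri h hY (T := Y \ {f}) (sdiff_subset.trans (subset_insert _ _)) (by omega)
  have h3 := hr.notcl g.cY hs
  rw [Set.insert_sdiff_singleton, Set.insert_eq_of_mem hf] at h3
  have := hr.c4r h hY
  omega

theorem c1b (h : QSep r e X Y) (hY : Y.ncard = 4) (g : QSep r f P Q) (he : e ∈ P)
    (hYe : Y = {f, a, b, c}) (bc : b ≠ c) (hb : b ∈ P) (hc : c ∈ P) (ha : a ∈ Q) : False := by
  have he' := h.eY
  have e1 : insert e Y ∩ insert f P = insert f {b, c, e} := by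
    subst hYe
    ext z; have := g.dis z; have := g.eX; grind
  have e2 : (insert e Y ∪ insert f P)ᶜ = X ∩ Q := by
    subst hYe
    ext z; have := g.dis z; have := g.eY; have := g.cov z; have := h.dis z; have := h.cov z
    have := h.eX
    grind
  have e3 : (insert f P)ᶜ = Q := g.symm.cYe
  have h1 := hr.lsub (insert e Y) (insert f P)
  rw [e1, e2, e3, h.cYe] at h1
  have hT : ({b, c, e} : Set β) ⊆ insert e Y := by subst hYe; intro z; grind
  have h2 := hr.c4tri h hY hT (n3 bc (by grind) (by grind))
  have h3 := hr.notcl (A := {b, c, e}) g.cX (by intro z; grind)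
  have h4 := hr.coc5 {f, b, c, e} (by simp)
  have h5 := ncard4_le f b c e
  have h6 := hr.c4r h hY
  have h7 := hr.c4X h hY
  have h8 := h.cY
  have h9 := g.cX
  have h10 := g.sum
  have h11 : r (insert f {b, c, e} : Set β)ᶜ = r univ := by
    have := hr.mono (subset_univ ((insert f {b, c, e} : Set β)ᶜ))
    by_contra hne
    have := h4 (by omega)
    omega
  have h12 : r (X ∩ Q) < r univ := by
    have := hr.mono (inter_subset_left (s := X) (t := Q)); omega
  have h13 := hr.L2 (A := X ∩ Q) (by rw [← e2, compl_compl, e2]; omega) h12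
  have h14 := hr.lin h13
  have e4 : Q ⊆ insert a (X ∩ Q) := by
    subst hYe
    intro z; have := g.dis z; have := g.eY; have := h.cov z
    grind
  have hQf : Q.Finite := (h14.1.insert a).subset e4
  have h15 := hr.k4 g hQf
  have h16 := Set.ncard_le_ncard e4 (h14.1.insert a)
  have h17 := Set.ncard_insert_le a (X ∩ Q)
  have h18 := Set.ncard_insert_of_notMem g.eY hQf
  have h19 := hr.tri5 (insert f Q) (X ∩ Q) (by omega) (by rw [g.cYe]; exact g.lX)
    (inter_subset_right.trans (subset_insert _ _)) (by omega)
  omega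

theorem c1c (h : QSep r e X Y) (hY : Y.ncard = 4) (g : QSep r f P Q) (he : e ∈ P)
    (hYe : Y = {f, c, a, b}) (fc : f ≠ c) (fa : f ≠ a) (fb : f ≠ b) (ca : c ≠ a) (cb : c ≠ b)
    (ab : a ≠ b) (hc : c ∈ P) (ha : a ∈ Q) (hb : b ∈ Q) : QSpl r e f X Y P Q c a b := by
  have he' := h.eY
  have eQ : Q = insert a (insert b (X ∩ Q)) := by
    subst hYe
    ext z; have := g.dis z; have := g.eY; have := h.cov z
    grind
  have eP : P = insert e (insert c (X ∩ P)) := by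
    subst hYe
    ext z; have := g.dis z; have := g.eX; have := h.cov z
    grind
  have hle : ∀ S : Set β, S.Finite → (∀ x y : β, (insert x (insert y S)).ncard ≤ S.ncard + 2) := by
    intro S hS x y
    have := Set.ncard_insert_le x (insert y S)
    have := Set.ncard_insert_le y S
    omega
  have kQ : 2 ≤ r (X ∩ Q) := by
    by_contra hcon
    have h1 := hr.pt (S := X ∩ Q) (by omega)
    have h2 := hle _ h1.1 a b
    rw [← eQ] at h2
    have := hr.k4 g (by rw [eQ]; exact (h1.1.insert b).insert a)
    omega
  have kP : 2 ≤ r (X ∩ P) := by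
    by_contra hcon
    have h1 := hr.pt (S := X ∩ P) (by omega)
    have h2 := hle _ h1.1 e c
    rw [← eP] at h2
    have := hr.k4 g.symm (by rw [eP]; exact (h1.1.insert c).insert e)
    omega
  have hsum := g.sum
  have h7 := hr.c4r h hY
  have h8 := hr.c4X h hY
  have h9 := h.cY
  have aY : a ∈ Y := by subst hYe; grind
  have bY : b ∈ Y := by subst hYe; grind
  have cY : c ∈ Y := by subst hYe; grind
  have h1 := hr.c4cl h hY (i := a) (S := X ∩ Q) (by grind) inter_subset_left
  have h2 := hr.mono (A := insert a (X ∩ Q)) (B := Q) (by intro z; grind)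
  have h3 := hr.c4cl h hY (i := e) (S := X ∩ P) (by grind) inter_subset_left
  have h4 := hr.mono (A := insert e (X ∩ P)) (B := P) (by intro z; grind)
  have dP : r P ≤ r (X ∩ P) + 1 := by
    by_contra hcon
    have e1 : (insert e (X ∩ P))ᶜ = Q ∪ Y := by
      ext z; have := g.dis z; have := g.cov z; have := h.cov z; have := h.dis z
      grind
    have h5 := hr.sub (A := Q) (B := Y) (I := {a, b}) (U := Q ∪ Y) (by intro z; grind) (by intro z; grind)
    rw [hr.pair a b ab] at h5
    have h6 := hr.L2 (A := insert e (X ∩ P)) (by rw [e1]; omega) (by have := g.lX; omega)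
    omega
  have dQ : r Q ≤ r (X ∩ Q) + 1 := by
    by_contra hcon
    have e1 : (X ∩ Q)ᶜ = P ∪ insert e Y := by
      ext z; have := g.dis z; have := g.cov z; have := h.cov z; have := h.dis z
      have := h.eX
      grind
    have h5 := hr.sub (A := P) (B := insert e Y) (I := {e, c}) (U := P ∪ insert e Y) (by intro z; grind) (by intro z; grind)
    rw [hr.pair e c (by grind)] at h5
    have h6 := hr.L2 (A := X ∩ Q) (by rw [e1]; omega) (by have := g.lY; omega)
    have h10 := hr.lin h6
    have h11 : r Q ≤ r (X ∩ Q) + 2 := by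
      have i1 := hr.ins a (insert b (X ∩ Q))
      have i2 := hr.ins b (X ∩ Q)
      rw [← eQ] at i1
      omega
    have e2 : (insert b (insert f (X ∩ Q)))ᶜ = insert a P := by
      ext z; have := g.dis z; have := g.cov z; have := h.cov z; have := h.dis z
      have := h.eX; have := g.eX; have := g.eY
      have : z ∈ Y ↔ z = f ∨ z = c ∨ z = a ∨ z = b := by rw [hYe]; simp
      grind
    have h12 := hr.ins a P
    have h13 := hle _ h10.1 b f
    have hlt : r (insert b (insert f (X ∩ Q)))ᶜ < r univ := by rw [e2]; omega
    have h14 := hr.coc5 _ ((h10.1.insert f).insert b) hlt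
    have h15 := hr.tri5 _ (X ∩ Q) (by omega) hlt (by intro z; grind) (by omega)
    omega
  refine ⟨fc, fa, fb, ca, cb, ab, hYe, hc, ha, hb, ?_, ?_, ⟨?_, ?_, ?_⟩, kQ, kP⟩
  · unfold QSees; rw [← eQ]; exact dQ
  · unfold QSees; rw [← eP]; exact dP
  · ext z; have := g.cov z; have := h.dis f
    have : f ∈ Y := by rw [hYe]; simp
    grind
  · intro z; have := g.dis z; grind
  · omega

theorem c1 (h : QSep r e X Y) (hY : Y.ncard = 4) (hf : f ∈ Y) (g : QSep r f P Q) (he : e ∈ P) :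
    ∃ c a b, QSpl r e f X Y P Q c a b := by
  have h1 := Set.ncard_sdiff_singleton_of_mem hf
  rw [hY] at h1
  obtain ⟨a, b, c, hab, hac, hbc, h2⟩ := Set.ncard_eq_three.1 h1
  have hm : ∀ z, z ∈ Y \ {f} ↔ z = a ∨ z = b ∨ z = c := by intro z; rw [h2]; simp
  have hYe : Y = {f, a, b, c} := by
    ext z; have := hm z; by_cases z = f <;> grind
  have fa : f ≠ a := by have := hm a; grind
  have fb : f ≠ b := by have := hm b; grind
  have fc : f ≠ c := by have := hm c; grind
  have y1 : Y = {f, b, a, c} := by rw [hYe]; ext z; grind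
  have y2 : Y = {f, c, a, b} := by rw [hYe]; ext z; grind
  rcases g.cov a with rfl | ha | ha
  · exact absurd rfl fa
  all_goals rcases g.cov b with rfl | hb | hb
  any_goals exact absurd rfl fb
  all_goals rcases g.cov c with rfl | hc | hc
  any_goals exact absurd rfl fc
  · exact (hr.c1a h hY hf g.symm (by intro z; rw [hm]; grind)).elim
  · exact (hr.c1b h hY g he y2 hab ha hb hc).elim
  · exact (hr.c1b h hY g he y1 hac ha hc hb).elim
  · exact ⟨a, b, c, hr.c1c h hY g he hYe fa fb fc hab hac hbc ha hb hc⟩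
  · exact (hr.c1b h hY g he hYe hbc hb hc ha).elim
  · exact ⟨b, a, c, hr.c1c h hY g he y1 fb fa fc hab.symm hbc hac hb ha hc⟩
  · exact ⟨c, a, b, hr.c1c h hY g he y2 fc fa fb hac.symm hbc.symm hab hc ha hb⟩
  · exact (hr.c1a h hY hf g (by intro z; rw [hm]; grind)).elim

end QMat
end

section
attribute [-grind] Set.subset_insert
set_option linter.unusedSectionVars false
variable {β : Type u} {r : Set β → ℕ}

structure QF {β : Type u} (e : β) (Y : Set β) (a b c d : β) : Prop where
  Y : Y = {a, b, c, d}
  ea : e ≠ a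
  eb : e ≠ b
  ec : e ≠ c
  ed : e ≠ d
  ab : a ≠ b
  ac : a ≠ c
  ad : a ≠ d
  bc : b ≠ c
  bd : b ≠ d
  cd : c ≠ d

namespace QMat
variable (hr : QMat r)
include hr
variable {e f g a b c d i j k l m : β} {X Y P Q A A' B B' P1 Q1 P2 Q2 S1 S1' S2 S2' q : Set β}

theorem ncard_one (h : r q ≤ 1) (hne : q.Nonempty) : q.ncard = 1 := by
  have h1 := hr.pt h
  have := (Set.ncard_pos h1.1).2 hne
  omega

theorem qemp (h : QSep r e X Y) (hY : Y.ncard = 4) (b1 : QBip r X A A') (b2 : QBip r X B B')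
    (hB : 2 ≤ r B) (hi : i ∈ insert e Y) (hj : j ∈ insert e Y) (hk : k ∈ insert e Y)
    (hij : i ≠ j) (hik : i ≠ k) (hjk : j ≠ k) (sA : QSees r A i j) (sB : QSees r B' j k) :
    (A ∩ B).Nonempty := by
  by_contra hc
  have u1 := b1.u
  have u2 := b2.u
  have hs : A ⊆ B' := by
    intro z hz
    have m2 : z ∈ B ∪ B' ↔ z ∈ X := by rw [u2]
    have m1 : z ∈ A ∪ A' ↔ z ∈ X := by rw [u1]
    by_contra h3
    exact hc ⟨z, hz, by grind⟩
  have hBX : B' ⊆ X := by rw [← u2]; exact subset_union_right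
  have := hr.qe h hY b2.symm hi hj hk hij hik hjk (hr.seesMono h hY hi hs hBX sA) sB
  omega

theorem qz1 (h : QSep r e X Y) (hY : Y.ncard = 4) (b1 : QBip r X S1 S1') (b2 : QBip r X S2 S2')
    (hne : (S1 ∩ S2).Nonempty) (hne' : (S1' ∩ S2').Nonempty)
    (hl : l ∈ insert e Y) (hm : m ∈ insert e Y) (hlm : l ≠ m)
    (hs : QSees r S1 l m)
    (hi : i ∈ insert e Y) (hj : j ∈ insert e Y) (hk : k ∈ insert e Y)
    (hij : i ≠ j) (hik : i ≠ k) (hjk : j ≠ k) (h1 : QSees r S1' i j)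
    (h2 : QSees r S2' j k) : (S1 ∩ S2).ncard = 1 := by
  have a2 : S1' ⊆ X := by rw [← b1.u]; exact subset_union_right
  have a3 : S2' ⊆ X := by rw [← b2.u]; exact subset_union_right
  exact hr.ncard_one (hr.qz h hY b1 b2 hne' hl hm hlm hs hi hj hk hij hik hjk
    (hr.seesMono h hY hi subset_union_left (union_subset a2 a3) h1)
    (hr.seesMono h hY hj subset_union_right (union_subset a2 a3) h2)) hne

theorem gn (h : QSep r e X Y) (hY : Y.ncard = 4) (t : QF e Y a b c d)
    (b1 : QBip r X S1 S1') (b2 : QBip r X S2 S2')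
    (r1 : 2 ≤ r S1) (r1' : 2 ≤ r S1') (r2 : 2 ≤ r S2) (r2' : 2 ≤ r S2')
    (s1 : QSees r S1 c d) (s1' : QSees r S1' e b) (s2 : QSees r S2 a d) (s2' : QSees r S2' e c) :
    (S1 ∩ S2).ncard = 1 ∧ (S1' ∩ S2).ncard = 1 ∧ (S1' ∩ S2').ncard = 1 := by
  have me : e ∈ insert e Y := by simp
  have ma : a ∈ insert e Y := by rw [t.Y]; simp
  have mb : b ∈ insert e Y := by rw [t.Y]; simp
  have mc : c ∈ insert e Y := by rw [t.Y]; simp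
  have md : d ∈ insert e Y := by rw [t.Y]; simp
  have nS2pS1p := hr.qemp h hY b2.symm b1.symm r1' me mc md t.ec t.ed t.cd
    s2' s1
  have nS1pS2p := nS2pS1p
  rw [inter_comm] at nS1pS2p
  have nS1S2 := hr.qemp h hY b1 b2 r2 md mc me t.cd.symm t.ed.symm t.ec.symm
    s1.symm s2'.symm
  have nS2S1 := nS1S2
  rw [inter_comm] at nS2S1
  have nS1S2p := hr.qemp h hY b1 b2.symm r2' mc md ma t.cd t.ac.symm t.ad.symm
    s1 s2.symm
  have nS2pS1 := nS1S2p
  rw [inter_comm] at nS2pS1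
  have nS1pS2 := hr.qemp h hY b1.symm b2 r2 mb me mc t.eb.symm t.bc t.ec
    s1'.symm s2'
  have nS2S1p := nS1pS2
  rw [inter_comm] at nS2S1p
  exact ⟨hr.qz1 h hY b1 b2 nS1S2 nS1pS2p mc md t.cd s1
    mb me mc t.eb.symm t.bc t.ec s1'.symm s2',
    hr.qz1 h hY b1.symm b2 nS1pS2 nS1S2p me mb t.eb s1'
    md mc me t.cd.symm t.ed.symm t.ec.symm s1.symm s2'.symm,
    hr.qz1 h hY b1.symm b2.symm nS1pS2p nS1S2 me mb t.eb s1'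
    mc md ma t.cd t.ac.symm t.ad.symm s1 s2.symm⟩

theorem in_ (h : QSep r e X Y) (hY : Y.ncard = 4) (t : QF e Y a b c d)
    (b1 : QBip r X S1 S1') (b2 : QBip r X S2 S2')
    (r1 : 2 ≤ r S1) (r1' : 2 ≤ r S1') (r2 : 2 ≤ r S2) (r2' : 2 ≤ r S2')
    (s1 : QSees r S1 c d) (s1' : QSees r S1' e b) (s2 : QSees r S2 a b) (s2' : QSees r S2' e d) :
    (S1 ∩ S2).ncard = 1 ∧ (S1 ∩ S2').ncard = 1 ∧ (S1' ∩ S2).ncard = 1 := by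
  have me : e ∈ insert e Y := by simp
  have ma : a ∈ insert e Y := by rw [t.Y]; simp
  have mb : b ∈ insert e Y := by rw [t.Y]; simp
  have mc : c ∈ insert e Y := by rw [t.Y]; simp
  have md : d ∈ insert e Y := by rw [t.Y]; simp
  have nS1pS2p := hr.qemp h hY b1.symm b2.symm r2' me mb ma t.eb t.ea t.ab.symm
    s1' s2.symm
  have nS2pS1p := nS1pS2p
  rw [inter_comm] at nS2pS1p
  have nS1pS2 := hr.qemp h hY b1.symm b2 r2 mb me md t.eb.symm t.bd t.ed
    s1'.symm s2'
  have nS2S1p := nS1pS2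
  rw [inter_comm] at nS2S1p
  have nS2pS1 := hr.qemp h hY b2.symm b1 r1 md me mb t.ed.symm t.bd.symm t.eb
    s2'.symm s1'
  have nS1S2p := nS2pS1
  rw [inter_comm] at nS1S2p
  have nS1S2 := hr.qemp h hY b1 b2 r2 mc md me t.cd t.ec.symm t.ed.symm
    s1 s2'.symm
  have nS2S1 := nS1S2
  rw [inter_comm] at nS2S1
  exact ⟨hr.qz1 h hY b1 b2 nS1S2 nS1pS2p mc md t.cd s1
    mb me md t.eb.symm t.bd t.ed s1'.symm s2',
    hr.qz1 h hY b1 b2.symm nS1S2p nS1pS2 mc md t.cd s1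
    me mb ma t.eb t.ea t.ab.symm s1' s2.symm,
    hr.qz1 h hY b1.symm b2 nS1pS2 nS1S2p me mb t.eb s1'
    mc md me t.cd t.ec.symm t.ed.symm s1 s2'.symm⟩

theorem lemG (h : QSep r e X Y) (hY : Y.ncard = 4) (hf : f ∈ Y) (hg : g ∈ Y)
    (s1 : QSep r f P1 Q1) (e1 : e ∈ P1) (s2 : QSep r g P2 Q2) (e2 : e ∈ P2)
    (hgP : g ∈ P1) (hfQ : f ∈ Q2) :
    (X ∩ Q1 ∩ (X ∩ Q2)).ncard = 1 ∧ (X ∩ P1 ∩ (X ∩ Q2)).ncard = 1 ∧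
      (X ∩ P1 ∩ (X ∩ P2)).ncard = 1 := by
  obtain ⟨c, x, y, t⟩ := hr.c1 h hY hf s1 e1
  obtain ⟨c', x', y', t'⟩ := hr.c1 h hY hg s2 e2
  have he := h.eY
  have mY : ∀ z, z ∈ Y ↔ z = f ∨ z = c ∨ z = x ∨ z = y := by intro z; rw [t.hY]; simp
  have mY' : ∀ z, z ∈ Y ↔ z = g ∨ z = c' ∨ z = x' ∨ z = y' := by intro z; rw [t'.hY]; simp
  obtain ⟨q1, q2, q3, q4, q5, q6, -, q7, q8, q9, v1, v2, bb, w1, w2⟩ := t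
  obtain ⟨q1', q2', q3', q4', q5', q6', -, q7', q8', q9', v1', v2', bb', w1', w2'⟩ := t'
  have hgf : g ≠ f := by have := s1.eX; grind
  have dx := s1.dis x
  have dy := s1.dis y
  have dc := s2.dis c'
  have hgc : g = c := by have := mY g; grind
  subst hgc
  have hc : c' = x ∨ c' = y := by have := mY c'; grind
  rcases hc with rfl | rfl
  · have hxy : (x' = f ∧ y' = y) ∨ (x' = y ∧ y' = f) := by
      have := mY x'; have := mY y'; grind
    refine hr.gn h hY (a := f) (b := g) (c := c') (d := y)
      ⟨by ext z; rw [mY]; simp, ?_, ?_, ?_, ?_, ?_, ?_, ?_, ?_, ?_, ?_⟩ bb bb' w1 w2 w1' w2'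
      v1 v2 ?_ v2'
    any_goals grind
    rcases hxy with ⟨rfl, rfl⟩ | ⟨rfl, rfl⟩
    · exact v1'
    · exact v1'.symm
  · have hxy : (x' = f ∧ y' = x) ∨ (x' = x ∧ y' = f) := by
      have := mY x'; have := mY y'; grind
    refine hr.gn h hY (a := f) (b := g) (c := c') (d := x)
      ⟨by ext z; rw [mY]; grind, ?_, ?_, ?_, ?_, ?_, ?_, ?_, ?_, ?_, ?_⟩ bb bb' w1 w2 w1' w2'
      v1.symm v2 ?_ v2'
    any_goals grind
    rcases hxy with ⟨rfl, rfl⟩ | ⟨rfl, rfl⟩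
    · exact v1'
    · exact v1'.symm

theorem lemI (h : QSep r e X Y) (hY : Y.ncard = 4) (hf : f ∈ Y) (hg : g ∈ Y)
    (s1 : QSep r f P1 Q1) (e1 : e ∈ P1) (s2 : QSep r g P2 Q2) (e2 : e ∈ P2)
    (hgQ : g ∈ Q1) (hfQ : f ∈ Q2) (hb : b ∈ Y) (hbP : b ∈ P1) (hbQ : b ∈ Q2) :
    (X ∩ Q1 ∩ (X ∩ Q2)).ncard = 1 ∧ (X ∩ Q1 ∩ (X ∩ P2)).ncard = 1 ∧
      (X ∩ P1 ∩ (X ∩ Q2)).ncard = 1 := by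
  obtain ⟨c, x, y, t⟩ := hr.c1 h hY hf s1 e1
  obtain ⟨c', x', y', t'⟩ := hr.c1 h hY hg s2 e2
  have he := h.eY
  have mY : ∀ z, z ∈ Y ↔ z = f ∨ z = c ∨ z = x ∨ z = y := by intro z; rw [t.hY]; simp
  have mY' : ∀ z, z ∈ Y ↔ z = g ∨ z = c' ∨ z = x' ∨ z = y' := by intro z; rw [t'.hY]; simp
  obtain ⟨q1, q2, q3, q4, q5, q6, -, q7, q8, q9, v1, v2, bb, w1, w2⟩ := t
  obtain ⟨q1', q2', q3', q4', q5', q6', -, q7', q8', q9', v1', v2', bb', w1', w2'⟩ := t'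
  have hgf : g ≠ f := by have := s1.eY; grind
  have hbf : b ≠ f := by have := s1.eX; grind
  have hbg : b ≠ g := by have := s2.eY; grind
  have dx := s1.dis x
  have dy := s1.dis y
  have db := s1.dis b
  have dg := s1.dis g
  have dc := s2.dis c'
  have hbc : b = c := by have := mY b; grind
  subst hbc
  have hc : (g = x ∧ c' = y) ∨ (g = y ∧ c' = x) := by have := mY g; have := mY c'; grind
  have hxy : (x' = f ∧ y' = b) ∨ (x' = b ∧ y' = f) := by
      have := mY x'; have := mY y'; grind
  refine hr.in_ h hY (a := f) (b := b) (c := g) (d := c')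
      ⟨?_, ?_, ?_, ?_, ?_, ?_, ?_, ?_, ?_, ?_, ?_⟩ bb bb' w1 w2 w1' w2'
      ?_ v2 ?_ v2'
  · ext z; rw [mY]; grind
  any_goals grind
  · rcases hc with ⟨rfl, rfl⟩ | ⟨rfl, rfl⟩
    · exact v1
    · exact v1.symm
  · rcases hxy with ⟨rfl, rfl⟩ | ⟨rfl, rfl⟩
    · exact v1'
    · exact v1'.symm

end QMat
end

section
attribute [-grind] Set.subset_insert
set_option linter.unusedSectionVars false
variable {β : Type u} {r : Set β → ℕ}

theorem addc {A B C : Set β} {p q : ℕ} (hA : A.ncard = p + 1) (hB : B.ncard = q + 1)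
    (hC : ∀ z, z ∈ C ↔ z ∈ A ∨ z ∈ B) (hd : ∀ z, z ∈ A → z ∉ B) : C.ncard = p + q + 2 := by
  have e1 : C = A ∪ B := by ext z; rw [hC]; rfl
  have := Set.ncard_union_eq (s := A) (t := B) (Set.disjoint_left.2 (fun {z} => hd z)) (fin_of_pos (by omega)) (fin_of_pos (by omega))
  rw [e1]; omega

theorem addS {v : β} {A P Q B C : Set β} {p q : ℕ} (s : QSep r v P Q) (hv : v ∉ A)
    (hB : B.ncard = p + 1) (hC : C.ncard = q + 1) (h1 : ∀ z, z ∈ B ↔ z ∈ A ∧ z ∈ P)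
    (h2 : ∀ z, z ∈ C ↔ z ∈ A ∧ z ∈ Q) : A.ncard = p + q + 2 := by
  refine addc hB hC ?_ ?_
  · intro z; rw [h1, h2]; have := s.cov z; grind
  · intro z; rw [h1, h2]; have := s.dis z; grind

namespace QMat
variable (hr : QMat r)
include hr
variable {e f g a b c d i j k l m : β} {X Y P Q A A' B B' P1 Q1 P2 Q2 S1 S1' S2 S2' q : Set β}

theorem G2 (h : QSep r e X Y) (hY : Y.ncard = 4) (hf : f ∈ Y) (hg : g ∈ Y)
    (s1 : QSep r f P1 Q1) (e1 : e ∈ P1) (s2 : QSep r g P2 Q2) (e2 : e ∈ P2)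
    (hgP : g ∈ P1) (hfQ : f ∈ Q2) : X.ncard = 4 := by
  obtain ⟨k1, k2, k3⟩ := hr.lemG h hY hf hg s1 e1 s2 e2 hgP hfQ
  obtain ⟨c, x, y, t⟩ := hr.c1 h hY hf s1 e1
  have he := h.eY
  have mY : ∀ z, z ∈ Y ↔ z = f ∨ z = c ∨ z = x ∨ z = y := by intro z; rw [t.hY]; simp
  have tx := t.aQ
  have ty := t.bQ
  have dx := s1.dis x
  have dy := s1.dis y
  have f1 := s1.eX
  have g1 := s2.eX
  have g2 := s2.eY
  have fX := h.dis f
  have gX := h.dis g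
  have eX := h.eX
  have hgc : g = c := by have := mY g; grind
  have n1 : (X ∩ P1).ncard = 2 := by
    refine addc k2 k3 ?_ ?_
    · intro z; have := s2.cov z; grind
    · intro z; have := s2.dis z; grind
  have n2 : ({e, g} : Set β).ncard = 2 := Set.ncard_pair (by grind)
  have n3 : P1.ncard = 4 := by
    refine addc n1 n2 ?_ ?_
    · intro z; have := h.cov z; have := mY z; grind
    · intro z; grind
  obtain ⟨k4, -, -⟩ := hr.lemG s1.symm n3 e1 hgP h.symm hf s2.symm hfQ hg e2
  have n4 : (X ∩ Q1).ncard = 2 := by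
    refine addc k1 k4 ?_ ?_
    · intro z; have := s2.cov z; have := s1.dis z; grind
    · intro z; have := s2.dis z; grind
  refine addc n1 n4 ?_ ?_
  · intro z; have := s1.cov z; grind
  · intro z; have := s1.dis z; grind

theorem exists44 : ∃ e X Y, QSep r e X Y ∧ X.ncard = 4 ∧ Y.ncard = 4 := by
  by_contra hG
  have NG : ∀ {e f g : β} {X Y P1 Q1 P2 Q2 : Set β}, QSep r e X Y → Y.ncard = 4 → f ∈ Y → g ∈ Y →
      QSep r f P1 Q1 → e ∈ P1 → QSep r g P2 Q2 → e ∈ P2 → g ∈ P1 → f ∈ Q2 → False :=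
    fun h hY hf hg s1 e1 s2 e2 hgP hfQ => hG ⟨_, _, _, h, hr.G2 h hY hf hg s1 e1 s2 e2 hgP hfQ, hY⟩
  obtain ⟨e, X, Y, h, hY⟩ := hr.exists4
  apply hG
  refine ⟨e, X, Y, h, ?_, hY⟩
  clear hG
  obtain ⟨v1, hv1⟩ := hr.nonemp h
  have he := h.eY
  have heX := h.eX
  have hd := h.dis
  have ne : ∀ {v}, v ∈ Y → e ≠ v := by intro v hv; grind
  obtain ⟨P1, Q1, s1, e1⟩ := hr.sep2 _ _ (ne hv1)
  obtain ⟨v2, v3, v4, t⟩ := hr.c1 h hY hv1 s1 e1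
  have mY : ∀ z, z ∈ Y ↔ z = v1 ∨ z = v2 ∨ z = v3 ∨ z = v4 := by intro z; rw [t.hY]; simp
  have hv2 := (mY v2).2 (by simp)
  have hv3 := (mY v3).2 (by simp)
  have hv4 := (mY v4).2 (by simp)
  obtain ⟨q1, q2, q3, q4, q5, q6, -, q7, q8, q9, -, -, -, -, -⟩ := t
  obtain ⟨P2, Q2, s2, e2⟩ := hr.sep2 _ _ (ne hv2)
  obtain ⟨P3, Q3, s3, e3⟩ := hr.sep2 _ _ (ne hv3)
  obtain ⟨P4, Q4, s4, e4⟩ := hr.sep2 _ _ (ne hv4)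
  have h12 : v1 ∈ P2 := by
    have := NG h hY hv1 hv2 s1 e1 s2 e2 q7
    have := s2.cov v1
    grind
  have h32 : v3 ∈ Q2 ∧ v4 ∈ Q2 := by
    obtain ⟨c, x, y, t⟩ := hr.c1 h hY hv2 s2 e2
    have mY2 : ∀ z, z ∈ Y ↔ z = v2 ∨ z = c ∨ z = x ∨ z = y := by intro z; rw [t.hY]; simp
    have := t.aQ
    have := t.bQ
    have := s2.dis v1
    have m1 := (mY2 v1).1 hv1
    have m3 := (mY2 v3).1 hv3
    have m4 := (mY2 v4).1 hv4
    clear mY mY2 NG t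
    grind
  have hA : ∀ {v w P Q}, v ∈ Y → w ∈ Y → v ∈ Q1 → v ∈ Q2 → v ≠ w → w ≠ v1 → w ≠ v2 → QSep r v P Q → e ∈ P →
      v1 ∈ Q ∧ v2 ∈ Q ∧ w ∈ P := by
    intro v w P Q hv hw hvQ1 hvQ2 hvw hw1 hw2 s es
    have a1 : v1 ∈ Q := by
      by_contra hc
      have := s.cov v1
      have := s1.eY
      exact NG h hY hv hv1 s es s1 e1 (by grind) hvQ1
    have a2 : v2 ∈ Q := by
      by_contra hc
      have := s.cov v2
      have := s2.eY
      exact NG h hY hv hv2 s es s2 e2 (by grind) hvQ2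
    refine ⟨a1, a2, ?_⟩
    obtain ⟨c, x, y, t⟩ := hr.c1 h hY hv s es
    have mY2 : ∀ z, z ∈ Y ↔ z = v ∨ z = c ∨ z = x ∨ z = y := by intro z; rw [t.hY]; simp
    have b1 := (mY2 v1).1 hv1
    have b2 := (mY2 v2).1 hv2
    have b3 := (mY2 w).1 hw
    have := t.cP
    have := s.dis c
    have := s1.eY
    have := s2.eY
    clear mY mY2 NG t
    grind
  obtain ⟨a13, a23, a43⟩ := hA hv3 hv4 q8 h32.1 q6 q3.symm q5.symm s3 e3
  obtain ⟨a14, a24, a34⟩ := hA hv4 hv3 q9 h32.2 q6.symm q2.symm q4.symm s4 e4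
  clear hA
  obtain ⟨k1, k2, k3⟩ := hr.lemI h hY hv1 hv3 s1 e1 s3 e3 q8 a13 hv2 q7 a23
  have v3X := fun hx => hd v3 hx hv3
  have n1 : (X ∩ Q1).ncard = 2 := by
    exact addS s3.symm (fun hx => v3X hx.1) k1 k2 (by intro z; simp; tauto) (by intro z; simp; tauto)
  have n2 : ({v3, v4} : Set β).ncard = 2 := Set.ncard_pair q6
  have n3 : Q1.ncard = 4 := by
    refine addc n1 n2 ?_ ?_
    · intro z
      have c1 := h.cov z; have c2 := mY z; have c3 := s1.dis z; have c4 := s1.eY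
      clear mY NG hd k1 k2 k3 n1 n2 s1 s2 s3 s4 h hr ne
      grind
    · intro z
      have c1 := hd z
      clear mY NG hd k1 k2 k3 n1 n2 s1 s2 s3 s4 h hr ne
      grind
  obtain ⟨s, hs⟩ := Set.nonempty_of_ncard_ne_zero (s := X ∩ Q1 ∩ (X ∩ Q3)) (by omega)
  have hsX : s ∈ X := hs.1.1
  have hsY := hd s hsX
  have hsQ1 : s ∈ Q1 := hs.1.2
  have hsQ3 : s ∈ Q3 := hs.2.2
  have hsP4 : s ∈ P4 := by
    by_contra hc
    have hsQ4 : s ∈ Q4 := by have := s4.cov s; grind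
    obtain ⟨Ps, Qs, ss, es⟩ := hr.sep2 s v1 (by grind)
    have b3 : v3 ∈ Ps := by
      have := NG s1 n3 q8 hsQ1 s3.symm a13 ss es hsQ3
      have := ss.cov v3
      grind
    have b4 : v4 ∈ Ps := by
      have := NG s1 n3 q9 hsQ1 s4.symm a14 ss es hsQ4
      have := ss.cov v4
      grind
    obtain ⟨c, x, y, t⟩ := hr.c1 s1 n3 hsQ1 ss es
    have mY2 : ∀ z, z ∈ Q1 ↔ z = s ∨ z = c ∨ z = x ∨ z = y := by intro z; rw [t.hY]; simp
    have m3 := (mY2 v3).1 q8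
    have m4 := (mY2 v4).1 q9
    have := t.aQ
    have := t.bQ
    have := ss.dis v3
    have := ss.dis v4
    have := ss.eX
    clear mY mY2 NG t
    grind
  obtain ⟨j1, j2, -⟩ := hr.lemI s1 n3 q8 q9 s3.symm a13 s4.symm a14 a43 a34 hsQ1 hsQ3 hsP4
  have n4 : (P1 ∩ P3).ncard = 2 := by
    exact addS s4 (fun hx => s1.dis v4 hx.1 q9) j1 j2 (by intro z; simp; tauto) (by intro z; simp; tauto)
  have n5 : (X ∩ P1 ∩ (X ∩ P3)).ncard = 1 := by
    have e5 : X ∩ P1 ∩ (X ∩ P3) = (P1 ∩ P3) \ {e} := by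
      ext z
      have c1 := h.cov z; have c2 := mY z; have c3 := s1.dis z; have c4 := s1.eX; have c5 := s3.dis z
      clear mY NG hd k1 k2 k3 n1 n2 n3 n4 j1 j2 s1 s2 s3 s4 h hr ne
      grind
    rw [e5, Set.ncard_sdiff_singleton_of_mem (show e ∈ P1 ∩ P3 from ⟨e1, e3⟩), n4]
  have n6 : (X ∩ P1).ncard = 2 := by
    exact addS s3.symm (fun hx => v3X hx.1) k3 n5 (by intro z; simp; tauto) (by intro z; simp; tauto)
  exact addS s1.symm (fun hx => hd v1 hx hv1) n1 n6 (fun z => Iff.rfl) (fun z => Iff.rfl)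

end QMat
end

section

def n9le2 (x : ℕ) : Bool :=
  Nat.beq (Nat.land (Nat.land x (Nat.pred x)) (Nat.pred (Nat.land x (Nat.pred x)))) 0

def n9comp (f b : ℕ) : ℕ := Nat.xor (Nat.xor 511 b) (Nat.shiftLeft 1 f)

def n9ok (f b g c : ℕ) : Bool :=
  n9le2 (Nat.land b c) && n9le2 (Nat.land b (n9comp g c)) &&
    n9le2 (Nat.land (n9comp f b) c) && n9le2 (Nat.land (n9comp f b) (n9comp g c))

def n9bit (x i : ℕ) : Bool := Nat.beq (Nat.land (Nat.shiftRight x i) 1) 1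

theorem n9bit_eq (x i : ℕ) : n9bit x i = x.testBit i := by
  have h : Nat.land (Nat.shiftRight x i) 1 = (x >>> i) % 2 := Nat.and_one_is_mod _
  unfold n9bit
  rw [h, Nat.testBit_eq_decide_div_mod_eq, Nat.shiftRight_eq_div_pow]
  rw [Bool.eq_iff_iff]
  simp

def n9bN (x i : ℕ) : ℕ := Nat.land (Nat.shiftRight x i) 1

def n9pop (x : ℕ) : ℕ :=
  Nat.add (Nat.add (Nat.add (Nat.add (Nat.add (Nat.add (Nat.add (Nat.add (n9bN x 0) (n9bN x 1))
    (n9bN x 2)) (n9bN x 3)) (n9bN x 4)) (n9bN x 5)) (n9bN x 6)) (n9bN x 7)) (n9bN x 8)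

def n9list : List ℕ := [135, 75, 275, 45, 325, 153, 113, 417, 30, 102, 298, 178, 450, 396, 308, 212, 344, 232]

def n9perms : List (List ℕ) := [[0, 1, 5, 3, 8, 6, 4, 2, 7], [0, 1, 5, 3, 8, 6, 4, 7, 2], [0, 1, 5, 3, 8, 4, 6, 2, 7], [0, 1, 5, 3, 8, 4, 6, 7, 2]]

def n9cands : List (ℕ × List ℕ) := [(2, [99, 105, 113, 163, 169, 177, 195, 201, 209, 291, 297, 305, 323, 329, 337, 387, 393, 401]),
  (3, [99, 101, 113, 163, 165, 177, 195, 197, 209, 291, 293, 305, 323, 325, 337, 387, 389, 401]),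
  (4, [99, 101, 105, 163, 165, 169, 195, 197, 201, 291, 293, 297, 323, 325, 329, 387, 389, 393]),
  (5, [71, 75, 77, 83, 85, 89, 135, 139, 141, 147, 149, 153, 263, 267, 269, 275, 277, 281]),
  (6, [39, 43, 45, 51, 53, 57, 135, 139, 141, 147, 149, 153, 263, 267, 269, 275, 277, 281]),
  (7, [39, 43, 45, 51, 53, 57, 71, 75, 77, 83, 85, 89, 263, 267, 269, 275, 277, 281]),
  (8, [39, 43, 45, 51, 53, 57, 71, 75, 77, 83, 85, 89, 135, 139, 141, 147, 149, 153])]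

def n9all : List ℕ := [0, 1, 2, 3, 4, 5, 6, 7, 8]

def n9leaf (ch : List (ℕ × ℕ)) : Bool :=
  n9perms.any fun p => n9list.all fun m => ch.any fun fb =>
    (n9all.all fun i => n9bit m (p.getD i 0) == n9bit fb.2 i) ||
    (n9all.all fun i => n9bit m (p.getD i 0) == n9bit (n9comp fb.1 fb.2) i)

def n9search : List (ℕ × List ℕ) → List (ℕ × ℕ) → Bool
  | [], ch => n9leaf ch
  | (f, L) :: rest, ch =>
    L.all fun b => !(ch.all fun gc => n9ok gc.1 gc.2 f b) || n9search rest ((f, b) :: ch)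

theorem n9sound (B : ℕ → ℕ) (hok : ∀ f g, f < 9 → g < 9 → f ≠ g → n9ok f (B f) g (B g) = true) :
    ∀ (rest : List (ℕ × List ℕ)) (ch : List (ℕ × ℕ)), n9search rest ch = true →
      (∀ p ∈ ch, p.1 < 9 ∧ B p.1 = p.2) → (∀ p ∈ rest, p.1 < 9 ∧ B p.1 ∈ p.2) →
      (∀ p ∈ ch, ∀ q ∈ rest, p.1 ≠ q.1) → rest.Pairwise (fun p q => p.1 ≠ q.1) →
      ∃ ch', n9leaf ch' = true ∧ ∀ p ∈ ch', p.1 < 9 ∧ B p.1 = p.2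
  | [], ch, h, h1, _, _, _ => ⟨ch, h, h1⟩
  | (f, L) :: rest, ch, h, h1, h2, h3, h4 => by
    have hf := h2 (f, L) (by simp)
    have h4' := List.pairwise_cons.1 h4
    have h5 : n9search ((f, L) :: rest) ch = (L.all fun b =>
      !(ch.all fun gc => n9ok gc.1 gc.2 f b) || n9search rest ((f, b) :: ch)) := rfl
    rw [h5, List.all_eq_true] at h
    have h6 := h (B f) hf.2
    have h7 : (ch.all fun gc => n9ok gc.1 gc.2 f (B f)) = true := by
      rw [List.all_eq_true]
      intro p hp
      have := h1 p hp
      have h8 := hok p.1 f this.1 hf.1 (h3 p hp (f, L) (by simp))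
      rw [this.2] at h8
      exact h8
    rw [h7] at h6
    simp only [Bool.not_true, Bool.false_or] at h6
    refine n9sound B hok rest ((f, B f) :: ch) h6 ?_ ?_ ?_ h4'.2
    · intro p hp
      rcases List.mem_cons.1 hp with rfl | hp
      · exact ⟨hf.1, rfl⟩
      · exact h1 p hp
    · intro p hp
      exact h2 p (List.mem_cons_of_mem _ hp)
    · intro p hp q hq
      rcases List.mem_cons.1 hp with rfl | hp
      · exact h4'.1 q hq
      · exact h3 p hp q (List.mem_cons_of_mem _ hq)

theorem n9search_true : n9search n9cands [(1, 101), (0, 480)] = true := by decide +kernel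

def n9cchk (b : ℕ) : Bool :=
  n9cands.all fun p => !(n9bit b 0 && !n9bit b p.1 && Nat.beq (n9pop b) 4 && n9ok 0 480 p.1 b) ||
    p.2.any (Nat.beq b)

theorem n9cchk_true : ∀ b < 512, n9cchk b = true := by decide +kernel

theorem n9cands_mem (b : ℕ) (hb : b < 512) (p : ℕ × List ℕ) (hp : p ∈ n9cands)
    (h1 : b.testBit 0 = true) (h2 : b.testBit p.1 = false)
    (h3 : n9pop b = 4) (h4 : n9ok 0 480 p.1 b = true) : b ∈ p.2 := by
  have h := n9cchk_true b hb
  unfold n9cchk at h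
  rw [List.all_eq_true] at h
  have h5 := h p hp
  rw [n9bit_eq, n9bit_eq, h1, h2, h3, h4] at h5
  simpa using h5

theorem n9le2_pop : ∀ x < 512, n9pop x ≤ 2 → n9le2 x = true := by decide +kernel

def n9tchk (x : ℕ) : Bool :=
  !(Nat.beq (n9pop x) 4) || n9list.any (Nat.beq x) || n9list.any fun m =>
    Nat.beq (n9pop (Nat.land x m)) 3

theorem n9tchk_true : ∀ x < 512, n9tchk x = true := by decide +kernel

theorem n9three (x : ℕ) (hx : x < 512) (h4 : n9pop x = 4) :
    x ∈ n9list ∨ ∃ m ∈ n9list, n9pop (Nat.land x m) = 3 := by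
  have h := n9tchk_true x hx
  unfold n9tchk at h
  rw [h4] at h
  simpa using h

theorem n9list_pop : ∀ m ∈ n9list, n9pop m = 4 ∧ m < 512 := by decide +kernel

theorem n9perms_inj : ∀ p ∈ n9perms, p.length = 9 ∧ p.Nodup ∧ ∀ k ∈ p, k < 9 := by decide

theorem n9search_spec (B : ℕ → ℕ) (hlt : ∀ f, B f < 512)
    (hok : ∀ f g, f < 9 → g < 9 → f ≠ g → n9ok f (B f) g (B g) = true) (h0 : B 0 = 480)
    (h1 : B 1 = 101) (hz : ∀ f, 2 ≤ f → f < 9 → (B f).testBit 0 = true ∧ (B f).testBit f = false ∧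
      n9pop (B f) = 4) : ∃ p : Fin 9 → Fin 9, (∀ i j, p i = p j → i = j) ∧ ∀ m ∈ n9list, ∃ f < 9,
      (∀ i : Fin 9, m.testBit (p i).1 = (B f).testBit i.1) ∨
      (∀ i : Fin 9, m.testBit (p i).1 = (n9comp f (B f)).testBit i.1) := by
  have hc : ∀ p ∈ n9cands, 2 ≤ p.1 ∧ p.1 < 9 := by decide
  obtain ⟨ch, hl, hch⟩ := n9sound B hok n9cands [(1, 101), (0, 480)] n9search_true (by simp [h0, h1])
    (by
      intro p hp
      have h2 := hc p hp
      have h3 := hz p.1 h2.1 h2.2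
      refine ⟨h2.2, n9cands_mem _ (hlt _) p hp h3.1 h3.2.1 h3.2.2 ?_⟩
      have := hok 0 p.1 (by omega) h2.2 (by omega)
      rwa [h0] at this) (by decide) (by decide)
  unfold n9leaf at hl
  rw [List.any_eq_true] at hl
  obtain ⟨p, hp, hl⟩ := hl
  obtain ⟨p1, p2, p3⟩ := n9perms_inj p hp
  have hg : ∀ i : Fin 9, p.getD i.1 0 = p[i.1]'(by omega) := by
    intro i; rw [List.getD_eq_getElem]
  refine ⟨fun i => ⟨p[i.1]'(by omega), p3 _ (List.getElem_mem _)⟩, ?_, ?_⟩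
  · intro i j hij
    have h2 := Fin.mk.inj hij
    exact Fin.ext ((List.Nodup.getElem_inj_iff p2).1 h2)
  rw [List.all_eq_true] at hl
  intro m hm
  have h2 := hl m hm
  rw [List.any_eq_true] at h2
  obtain ⟨fb, hfb, h3⟩ := h2
  obtain ⟨h4, h5⟩ := hch fb hfb
  have hall : ∀ i : Fin 9, i.1 ∈ n9all := by decide
  refine ⟨fb.1, h4, ?_⟩
  rw [h5]
  rw [Bool.or_eq_true, List.all_eq_true, List.all_eq_true] at h3
  rcases h3 with h3 | h3
  · left; intro i
    have h6 := eq_of_beq (h3 i (hall i))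
    rw [n9bit_eq, n9bit_eq, hg] at h6
    exact h6
  · right; intro i
    have h6 := eq_of_beq (h3 i (hall i))
    rw [n9bit_eq, n9bit_eq, hg] at h6
    exact h6

end

section
attribute [-grind] Set.subset_insert
set_option linter.unusedSectionVars false
variable {β : Type u} {r : Set β → ℕ}

open Classical in
noncomputable def n9mk (τ : Fin 9 ≃ β) (S : Set β) : ℕ :=
  Nat.ofBits (n := 9) (fun i => decide (τ i ∈ S))

theorem n9mk_lt (τ : Fin 9 ≃ β) (S : Set β) : n9mk τ S < 512 := by
  unfold n9mk
  exact Nat.ofBits_lt_two_pow _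

theorem n9mk_bit (τ : Fin 9 ≃ β) (S : Set β) (i : Fin 9) :
    (n9mk τ S).testBit i.1 = true ↔ τ i ∈ S := by
  unfold n9mk
  rw [Nat.testBit_ofBits_lt _ _ i.2]
  simp

theorem n9mk_bit_ge (τ : Fin 9 ≃ β) (S : Set β) (i : ℕ) (hi : 9 ≤ i) :
    (n9mk τ S).testBit i = false := by
  unfold n9mk
  exact Nat.testBit_ofBits_ge _ _ hi

theorem n9mk_ext (τ : Fin 9 ≃ β) (S : Set β) (x : ℕ) (hx : x < 512)
    (h : ∀ i : Fin 9, x.testBit i.1 = true ↔ τ i ∈ S) : n9mk τ S = x := by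
  apply Nat.eq_of_testBit_eq
  intro i
  by_cases hi : i < 9
  · have h1 := h ⟨i, hi⟩
    have h2 := n9mk_bit τ S ⟨i, hi⟩
    rw [Bool.eq_iff_iff]
    exact h2.trans h1.symm
  · rw [n9mk_bit_ge τ S i (by omega)]
    symm
    apply Nat.testBit_lt_two_pow
    calc x < 2 ^ 9 := hx
      _ ≤ 2 ^ i := Nat.pow_le_pow_right (by omega) (by omega)

theorem n9mk_inter (τ : Fin 9 ≃ β) (S T : Set β) :
    Nat.land (n9mk τ S) (n9mk τ T) = n9mk τ (S ∩ T) := by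
  symm
  apply n9mk_ext
  · exact lt_of_le_of_lt Nat.and_le_left (n9mk_lt τ S)
  · intro i
    have : (Nat.land (n9mk τ S) (n9mk τ T)).testBit i.1 =
      ((n9mk τ S).testBit i.1 && (n9mk τ T).testBit i.1) := Nat.testBit_and ..
    rw [this, Bool.and_eq_true, n9mk_bit, n9mk_bit]
    rfl

theorem n9mk_comp (τ : Fin 9 ≃ β) {P Q : Set β} {f : Fin 9} (h : QSep r (τ f) P Q) :
    n9comp f.1 (n9mk τ P) = n9mk τ Q := by
  symm
  have hb : ∀ i, (n9comp f.1 (n9mk τ P)).testBit i =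
      ((decide (i < 9) ^^ (n9mk τ P).testBit i) ^^ decide (f.1 = i)) := by
    intro i
    have e1 : n9comp f.1 (n9mk τ P) = ((2 ^ 9 - 1) ^^^ n9mk τ P) ^^^ (1 <<< f.1) := rfl
    rw [e1, Nat.testBit_xor, Nat.testBit_xor, Nat.testBit_two_pow_sub_one, Nat.one_shiftLeft,
      Nat.testBit_two_pow]
  apply n9mk_ext
  · have h1 : (2 ^ 9 - 1) ^^^ n9mk τ P < 2 ^ 9 := Nat.xor_lt_two_pow (by norm_num) (n9mk_lt τ P)
    have h2 : 1 <<< f.1 < 2 ^ 9 := by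
      rw [Nat.one_shiftLeft]; exact Nat.pow_lt_pow_right (by omega) f.2
    exact Nat.xor_lt_two_pow h1 h2
  · intro i
    rw [hb]
    have h1 := n9mk_bit τ P i
    have c1 := h.cov (τ i)
    have c2 := h.dis (τ i)
    have c3 := h.eX
    have c4 := h.eY
    by_cases hfi : f = i
    · subst hfi
      have : (n9mk τ P).testBit f.1 = false := by
        rw [← Bool.not_eq_true, h1]; exact c3
      simp [this, c4]
    · have hfi' : f.1 ≠ i.1 := fun hc => hfi (Fin.ext hc)
      have hfi2 : τ i ≠ τ f := fun hc => hfi (τ.injective hc).symm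
      by_cases hP : τ i ∈ P
      · simp [h1.2 hP, hfi', c2 hP]
      · have : (n9mk τ P).testBit i.1 = false := by
          rw [← Bool.not_eq_true, h1]; exact hP
        have : τ i ∈ Q := by tauto
        simp [*]

theorem n9bN_eq (x i : ℕ) : n9bN x i = (x.testBit i).toNat := by
  have h : n9bN x i = (x >>> i) % 2 := Nat.and_one_is_mod _
  rw [h, Nat.testBit_eq_decide_div_mod_eq, Nat.shiftRight_eq_div_pow]
  rcases Nat.mod_two_eq_zero_or_one (x / 2 ^ i) with h | h <;> simp [h]

theorem n9mk_pop (τ : Fin 9 ≃ β) (S : Set β) : n9pop (n9mk τ S) = S.ncard := by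
  classical
  have e1 : S = τ '' (τ ⁻¹' S) := by rw [Set.image_preimage_eq _ τ.surjective]
  have e2 : S.ncard = (τ ⁻¹' S).ncard := by
    conv_lhs => rw [e1]
    exact Set.ncard_image_of_injective _ τ.injective
  have e3 : (τ ⁻¹' S).ncard = (Finset.univ.filter fun i : Fin 9 => τ i ∈ S).card := by
    rw [← Set.ncard_coe_finset]; congr 1; ext i; simp
  rw [e2, e3, Finset.card_filter]
  have e4 : ∀ i : Fin 9, (if τ i ∈ S then 1 else 0) = n9bN (n9mk τ S) i.1 := by
    intro i
    rw [n9bN_eq]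
    have := n9mk_bit τ S i
    by_cases h : τ i ∈ S
    · simp [h, this.2 h]
    · have : (n9mk τ S).testBit i.1 = false := by
          rw [← Bool.not_eq_true, this]; exact h
      simp [h, this]
  rw [Finset.sum_congr rfl (fun i _ => e4 i)]
  rw [Fin.sum_univ_castSucc, Fin.sum_univ_eight]
  rfl

end

section
attribute [-grind] Set.subset_insert
set_option linter.unusedSectionVars false
variable {β : Type u} {r : Set β → ℕ}

theorem c9 {e : β} {X Y : Set β} (h : QSep r e X Y) (hX : X.Finite) (hY : Y.Finite) :
    (univ : Set β).ncard = X.ncard + Y.ncard + 1 := by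
  have e1 : (univ : Set β) = insert e (X ∪ Y) := by
    ext z; have := h.cov z; simp; tauto
  rw [e1, Set.ncard_insert_of_notMem (by have := h.eX; have := h.eY; grind) (hX.union hY),
    Set.ncard_union_eq (Set.disjoint_left.2 (fun {z} => h.dis z)) hX hY]

namespace QMat
variable (hr : QMat r)
include hr
variable {e f g : β} {X Y P Q R S A T : Set β}

theorem all4 (h9 : (univ : Set β).ncard = 9) (h : QSep r e X Y) : X.ncard = 4 ∧ Y.ncard = 4 := by
  have hu : (univ : Set β).Finite := fin_of_pos (by omega)
  have hX := hu.subset (subset_univ X)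
  have hY := hu.subset (subset_univ Y)
  have := c9 h hX hY
  have := hr.k4 h hY
  have := hr.k4 h.symm hX
  omega

theorem exists9 : (univ : Set β).ncard = 9 ∧ r univ = 4 := by
  obtain ⟨e, X, Y, h, hX, hY⟩ := hr.exists44
  have h1 := c9 h (fin_of_pos (by omega)) (fin_of_pos (by omega))
  have := hr.c4r h hY
  have := hr.c4r h.symm hX
  have := h.sum
  omega

theorem big (h9 : (univ : Set β).ncard = 9) (hA : r A < r univ) : A.ncard ≤ 4 := by
  have hu : (univ : Set β).Finite := fin_of_pos (by omega)
  have h1 := hr.coc5 Aᶜ (hu.subset (subset_univ _)) (by rwa [compl_compl])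
  have h2 := Set.ncard_union_eq (s := A) (t := Aᶜ) disjoint_compl_right
    (hu.subset (subset_univ _)) (hu.subset (subset_univ _))
  rw [union_compl_self] at h2
  omega

theorem meet3 (h9 : (univ : Set β).ncard = 9) (h4 : r univ = 4) (h : QSep r e X Y)
    (hA : r A ≤ 3) (hm : 3 ≤ (A ∩ X).ncard) : (A ∪ X).ncard ≤ 4 := by
  have hu : (univ : Set β).Finite := fin_of_pos (by omega)
  obtain ⟨hX, hY⟩ := hr.all4 h9 h
  obtain ⟨T, hT, hT3⟩ := Set.exists_subset_card_eq hm
  have h1 := hr.c4tri h.symm hX (T := T) ((hT.trans inter_subset_right).trans (subset_insert _ _)) hT3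
  have h2 := hr.c4r h.symm hX
  have h3 := hr.sub (A := A) (B := X) (I := T) (U := A ∪ X) hT subset_rfl
  exact hr.big h9 (by omega)

theorem meet4 (h9 : (univ : Set β).ncard = 9) (h4 : r univ = 4) (h : QSep r e X Y)
    (hA4 : A.ncard = 4) (hm : (A ∩ X).ncard = 3) : r A = 4 := by
  have hu : (univ : Set β).Finite := fin_of_pos (by omega)
  obtain ⟨hX, hY⟩ := hr.all4 h9 h
  by_contra hc
  have := hr.mono (subset_univ A)
  have h1 := hr.meet3 h9 h4 h (A := A) (by omega) (by omega)
  have := Set.ncard_union_add_ncard_inter A X (hu.subset (subset_univ _)) (hu.subset (subset_univ _))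
  omega

theorem meet2 (h9 : (univ : Set β).ncard = 9) (h4 : r univ = 4) (h : QSep r e X Y)
    (g : QSep r f P Q) (hef : e ≠ f) : (P ∩ X).ncard ≤ 2 := by
  have hu : (univ : Set β).Finite := fin_of_pos (by omega)
  have hf : ∀ S : Set β, S.Finite := fun S => hu.subset (subset_univ S)
  obtain ⟨hX, hY⟩ := hr.all4 h9 h
  obtain ⟨hP, hQ⟩ := hr.all4 h9 g
  by_contra hc
  have h1 := hr.meet3 h9 h4 h (A := P) (by have := hr.c4r g.symm hP; omega) (by omega)
  have e1 : P = P ∪ X := Set.eq_of_subset_of_ncard_le subset_union_left (by omega) (hf _)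
  have e2 : X = P ∪ X := Set.eq_of_subset_of_ncard_le subset_union_right (by omega) (hf _)
  have e3 : P = X := e1.trans e2.symm
  subst e3
  have e4 : Q ∩ Y = Y \ {f} := by
    ext z; have := h.dis z; have := g.dis z; have := g.cov z; have := g.eY; grind
  have hfY : f ∈ Y := by have := h.cov f; have := g.eX; grind
  have h5 := Set.ncard_sdiff_singleton_of_mem hfY
  have h6 := hr.meet3 h9 h4 h.symm (A := Q) (by have := hr.c4r g hQ; omega) (by rw [e4]; omega)
  have h7 := Set.ncard_union_add_ncard_inter Q Y (hf _) (hf _)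
  have h8 : (Q ∪ Y) = insert f Q := by
    ext z; have := h.dis z; have := g.dis z; have := g.cov z; have := h.cov z; have := g.eY; grind
  rw [h8, Set.ncard_insert_of_notMem g.eY (hf _)] at h6
  omega

theorem notri (h9 : (univ : Set β).ncard = 9) (hT : T.ncard = 3) : r T = 3 := by
  have hu : (univ : Set β).Finite := fin_of_pos (by omega)
  have hf : ∀ S : Set β, S.Finite := fun S => hu.subset (subset_univ S)
  have hle := hr.le_ncard (hf T)
  obtain ⟨f, -, hfT⟩ := Set.exists_mem_notMem_of_ncard_lt_ncard (s := T) (t := univ) (by omega) (hf T)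
  obtain ⟨P, Q, h⟩ := hr.sep f
  have key : ∀ P Q : Set β, QSep r f P Q → 2 ≤ (T ∩ P).ncard → 3 ≤ r T := by
    intro P Q h h2
    obtain ⟨hP, hQ⟩ := hr.all4 h9 h
    by_cases hTP : T ⊆ P
    · exact hr.c4tri h.symm hP (hTP.trans (subset_insert _ _)) hT
    · obtain ⟨t, ht, htP⟩ := Set.not_subset.1 hTP
      have h3 := hr.c4cl h hQ (i := t) (S := T ∩ P) (by have := h.cov t; grind) inter_subset_right
      have h4 := hr.two_le' h2
      have h5 := hr.mono (A := insert t (T ∩ P)) (B := T) (by intro z; grind)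
      omega
  have e1 : (T ∩ P).ncard + (T ∩ Q).ncard = 3 := by
    rw [← hT, ← Set.ncard_union_eq (Set.disjoint_left.2 (fun {z} h1 h2 => h.dis z h1.2 h2.2)) (hf _) (hf _)]
    congr 1
    ext z; have := h.cov z; grind
  have : 3 ≤ r T := by
    by_cases h2 : 2 ≤ (T ∩ P).ncard
    · exact key P Q h h2
    · exact key Q P h.symm (by omega)
  omega

end QMat
end

section
attribute [-grind] Set.subset_insert
set_option linter.unusedSectionVars false
variable {β : Type u} {r : Set β → ℕ}

namespace QMat
variable (hr : QMat r)
include hr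
variable {e f g : β} {X Y P Q R S A T : Set β}

theorem label (h9 : (univ : Set β).ncard = 9) : ∃ (σ : Fin 9 ≃ β) (X Y P Q : Set β),
    QSep r (σ 0) X Y ∧ QSep r (σ 1) P Q ∧ σ 0 ∈ P ∧ n9mk σ X = 480 ∧ n9mk σ P = 101 := by
  have hu : (univ : Set β).Finite := fin_of_pos (by omega)
  have hfin : ∀ S : Set β, S.Finite := fun S => hu.subset (subset_univ S)
  obtain ⟨e, X, Y, h, hX, hY⟩ := hr.exists44
  obtain ⟨v1, hv1⟩ := hr.nonemp h
  have he := h.eY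
  have heX := h.eX
  obtain ⟨P, Q, s1, e1⟩ := hr.sep2 v1 e (by grind)
  obtain ⟨v2, v3, v4, t⟩ := hr.c1 h hY hv1 s1 e1
  have hYe := t.hY
  obtain ⟨q1, q2, q3, q4, q5, q6, -, q7, q8, q9, -, -, -, -, -⟩ := t
  have mY : ∀ z, z ∈ Y ↔ z = v1 ∨ z = v2 ∨ z = v3 ∨ z = v4 := by intro z; rw [hYe]; simp
  obtain ⟨hP, hQ⟩ := hr.all4 h9 s1
  have v1P := s1.eX
  have v1Q := s1.eY
  have v3P := fun h => s1.dis v3 h q8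
  have v4P := fun h => s1.dis v4 h q9
  have v1X := fun hx => h.dis v1 hx hv1
  have v2X := fun hx => h.dis v2 hx ((mY v2).2 (by simp))
  have v3X := fun hx => h.dis v3 hx ((mY v3).2 (by simp))
  have v4X := fun hx => h.dis v4 hx ((mY v4).2 (by simp))
  have nP : (X ∩ P).ncard = 2 := by
    have e2 : P = (X ∩ P) ∪ {e, v2} := by
      ext z; have c1 := h.cov z; have c2 := mY z
      clear mY hYe hfin hu h9 hP hQ
      grind
    have e3 := Set.ncard_union_eq (s := X ∩ P) (t := {e, v2})
      (Set.disjoint_left.2 (by intro z; grind)) (hfin _) (hfin _)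
    rw [← e2, Set.ncard_pair (by grind)] at e3
    omega
  have nQ : (X ∩ Q).ncard = 2 := by
    have e2 : X = (X ∩ P) ∪ (X ∩ Q) := by
      ext z; have c1 := s1.cov z
      clear mY hYe hfin hu h9 hP hQ
      grind
    have e3 := Set.ncard_union_eq (s := X ∩ P) (t := X ∩ Q)
      (Set.disjoint_left.2 (by intro z h1 h2; exact s1.dis z h1.2 h2.2)) (hfin _) (hfin _)
    rw [← e2] at e3
    omega
  obtain ⟨x5, x6, -, h56⟩ := Set.ncard_eq_two.1 nP
  obtain ⟨x7, x8, -, h78⟩ := Set.ncard_eq_two.1 nQ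
  have m56 : ∀ z, z ∈ X ∧ z ∈ P ↔ z = x5 ∨ z = x6 := by
    intro z; have : z ∈ X ∩ P ↔ z ∈ ({x5, x6} : Set β) := by rw [h56]
    simpa using this
  have m78 : ∀ z, z ∈ X ∧ z ∈ Q ↔ z = x7 ∨ z = x8 := by
    intro z; have : z ∈ X ∩ Q ↔ z ∈ ({x7, x8} : Set β) := by rw [h78]
    simpa using this
  obtain ⟨a5, b5⟩ := (m56 x5).2 (by simp)
  obtain ⟨a6, b6⟩ := (m56 x6).2 (by simp)
  obtain ⟨a7, b7⟩ := (m78 x7).2 (by simp)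
  obtain ⟨a8, b8⟩ := (m78 x8).2 (by simp)
  have c7 := fun h => s1.dis x7 h b7
  have c8 := fun h => s1.dis x8 h b8
  have hsurj : Function.Surjective ![e, v1, v2, v3, v4, x5, x6, x7, x8] := by
    intro z
    have c1 := h.cov z
    rw [mY] at c1
    rcases c1 with rfl | hz | rfl | rfl | rfl | rfl
    · exact ⟨0, rfl⟩
    · rcases s1.cov z with rfl | hz2 | hz2
      · exact ⟨1, rfl⟩
      · rcases (m56 z).1 ⟨hz, hz2⟩ with rfl | rfl
        · exact ⟨5, rfl⟩
        · exact ⟨6, rfl⟩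
      · rcases (m78 z).1 ⟨hz, hz2⟩ with rfl | rfl
        · exact ⟨7, rfl⟩
        · exact ⟨8, rfl⟩
    · exact ⟨1, rfl⟩
    · exact ⟨2, rfl⟩
    · exact ⟨3, rfl⟩
    · exact ⟨4, rfl⟩
  have hbij : Function.Bijective ![e, v1, v2, v3, v4, x5, x6, x7, x8] := by
    apply hsurj.bijective_of_nat_card_le
    rw [← Set.ncard_univ, ← Set.ncard_univ β, h9]
    simp [Set.ncard_univ]
  refine ⟨Equiv.ofBijective _ hbij, X, Y, P, Q, h, s1, e1, ?_, ?_⟩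
  · refine n9mk_ext _ _ _ (by norm_num) ?_
    intro i
    fin_cases i
    · exact iff_of_false (by decide) heX
    · exact iff_of_false (by decide) v1X
    · exact iff_of_false (by decide) v2X
    · exact iff_of_false (by decide) v3X
    · exact iff_of_false (by decide) v4X
    · exact iff_of_true (by decide) a5
    · exact iff_of_true (by decide) a6
    · exact iff_of_true (by decide) a7
    · exact iff_of_true (by decide) a8
  · refine n9mk_ext _ _ _ (by norm_num) ?_
    intro i
    fin_cases i
    · exact iff_of_true (by decide) e1
    · exact iff_of_false (by decide) v1P
    · exact iff_of_true (by decide) q7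
    · exact iff_of_false (by decide) v3P
    · exact iff_of_false (by decide) v4P
    · exact iff_of_true (by decide) b5
    · exact iff_of_true (by decide) b6
    · exact iff_of_false (by decide) c7
    · exact iff_of_false (by decide) c8

theorem label2 (h9 : (univ : Set β).ncard = 9) (h4 : r univ = 4) : ∃ (τ : Fin 9 ≃ β),
    ∀ m ∈ n9list, ∃ f P Q, QSep r f P Q ∧ n9mk τ P = m := by
  obtain ⟨σ, X, Y, P, Q, h, s1, h0P, hm0, hm1⟩ := hr.label h9
  have hex : ∀ f : Fin 9, ∃ P' Q', QSep r (σ f) P' Q' ∧ (f = 0 → P' = X) ∧ (f = 1 → P' = P) ∧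
      (f ≠ 0 → σ 0 ∈ P') := by
    intro f
    by_cases hf0 : f = 0
    · subst hf0
      exact ⟨X, Y, h, fun _ => rfl, fun hc => by simp at hc, fun hc => absurd rfl hc⟩
    · by_cases hf1 : f = 1
      · subst hf1
        exact ⟨P, Q, s1, fun hc => by simp at hc, fun _ => rfl, fun _ => h0P⟩
      · obtain ⟨P', Q', s, hs⟩ := hr.sep2 (σ f) (σ 0) (fun hc => hf0 (σ.injective hc).symm)
        exact ⟨P', Q', s, fun hc => absurd hc hf0, fun hc => absurd hc hf1, fun _ => hs⟩
  choose Pf Qf hs hX hP1 hP0 using hex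
  obtain ⟨p, hp, hpm⟩ := n9search_spec (fun n => if hn : n < 9 then n9mk σ (Pf ⟨n, hn⟩) else 0)
    (by
      intro f
      by_cases hf : f < 9
      · simp only [hf, dif_pos]; exact n9mk_lt _ _
      · simp only [hf, dif_neg, not_false_eq_true]; norm_num)
    (by
      intro f g hf hg hfg
      simp only [hf, hg, dif_pos]
      have hne : σ ⟨g, hg⟩ ≠ σ ⟨f, hf⟩ := fun hc => hfg (Fin.mk.inj (σ.injective hc)).symm
      have c1 := n9mk_comp σ (hs ⟨f, hf⟩)
      have c2 := n9mk_comp σ (hs ⟨g, hg⟩)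
      unfold n9ok
      simp only at c1 c2
      rw [c1, c2]
      simp only [n9mk_inter, Bool.and_eq_true]
      refine ⟨⟨⟨?_, ?_⟩, ?_⟩, ?_⟩ <;> refine n9le2_pop _ (n9mk_lt _ _) ?_ <;> rw [n9mk_pop]
      · exact hr.meet2 h9 h4 (hs _) (hs _) hne
      · exact hr.meet2 h9 h4 (hs _).symm (hs _) hne
      · exact hr.meet2 h9 h4 (hs _) (hs _).symm hne
      · exact hr.meet2 h9 h4 (hs _).symm (hs _).symm hne)
    (by
      have : Pf ⟨0, by omega⟩ = X := hX _ rfl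
      simp only [Nat.ofNat_pos, dif_pos, this]; exact hm0)
    (by
      have : Pf ⟨1, by omega⟩ = P := hP1 _ rfl
      simp only [Nat.one_lt_ofNat, dif_pos, this]; exact hm1)
    (by
      intro f hf2 hf
      simp only [hf, dif_pos]
      refine ⟨?_, ?_, ?_⟩
      · refine (n9mk_bit σ (Pf ⟨f, hf⟩) 0).2 (hP0 _ ?_)
        intro hc
        have := congrArg Fin.val hc
        simp only [Fin.val_zero] at this
        omega
      · rw [← Bool.not_eq_true]
        intro hc
        exact (hs ⟨f, hf⟩).eX ((n9mk_bit σ _ ⟨f, hf⟩).1 hc)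
      · rw [n9mk_pop]
        exact (hr.all4 h9 (hs _)).1)
  have hpb : Function.Bijective p := Finite.injective_iff_bijective.1 (fun i j => hp i j)
  refine ⟨(Equiv.ofBijective p hpb).symm.trans σ, ?_⟩
  intro m hm
  have hmlt := (n9list_pop m hm).2
  have hk : ∀ (S : Set β), (∀ i : Fin 9, m.testBit (p i).1 = (n9mk σ S).testBit i.1) →
      n9mk ((Equiv.ofBijective p hpb).symm.trans σ) S = m := by
    intro S hS
    refine n9mk_ext _ _ _ hmlt ?_
    intro k
    obtain ⟨i, rfl⟩ := hpb.2 k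
    rw [hS i, n9mk_bit]
    have : (Equiv.ofBijective p hpb).symm (p i) = i := by
      rw [Equiv.symm_apply_eq]; rfl
    rw [Equiv.trans_apply, this]
  obtain ⟨f, hf, hfm⟩ := hpm m hm
  simp only [hf, dif_pos] at hfm
  rcases hfm with h1 | h1
  · exact ⟨_, _, _, hs ⟨f, hf⟩, hk _ h1⟩
  · have c1 := n9mk_comp σ (hs ⟨f, hf⟩)
    simp only at c1
    rw [c1] at h1
    exact ⟨_, _, _, (hs ⟨f, hf⟩).symm, hk _ h1⟩

theorem n9main : ∃ (τ : Fin 9 ≃ β), ∀ S : Set β, r S = S.ncard ↔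
    S.ncard ≤ 4 ∧ ∀ m ∈ n9list, ¬ ∀ i : Fin 9, m.testBit i.1 = true → τ i ∈ S := by
  obtain ⟨h9, h4⟩ := hr.exists9
  have hu : (univ : Set β).Finite := fin_of_pos (by omega)
  have hfin : ∀ S : Set β, S.Finite := fun S => hu.subset (subset_univ S)
  obtain ⟨τ, hτ⟩ := hr.label2 h9 h4
  refine ⟨τ, fun S => ⟨fun hS => ⟨?_, ?_⟩, fun ⟨hS4, hS⟩ => ?_⟩⟩
  · have := hr.mono (subset_univ S); omega
  · intro m hm hc
    obtain ⟨f, P, Q, h, hP⟩ := hτ m hm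
    have hPS : P ⊆ S := by
      intro z hz
      obtain ⟨i, rfl⟩ := τ.surjective z
      exact hc i (by rw [← hP, n9mk_bit]; exact hz)
    obtain ⟨hP4, hQ4⟩ := hr.all4 h9 h
    have h1 := hr.c4r h.symm hP4
    have h2 := hr.sub (A := P) (B := S \ P) (I := ∅) (U := S) (empty_subset _) (by intro z; grind)
    have h3 := hr.le_ncard (hfin (S \ P))
    have h5 := Set.ncard_sdiff_add_ncard_of_subset hPS (hfin S)
    omega
  · have hle := hr.le_ncard (hfin S)
    have hcase : S.ncard = 0 ∨ S.ncard = 1 ∨ S.ncard = 2 ∨ S.ncard = 3 ∨ S.ncard = 4 := by omega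
    rcases hcase with h | h | h | h | h
    · omega
    · obtain ⟨x, rfl⟩ := Set.ncard_eq_one.1 h
      rw [h, hr.one]
    · have := hr.two_le' (S := S) (by omega)
      omega
    · rw [hr.notri h9 h, h]
    · rcases n9three (n9mk τ S) (n9mk_lt _ _) (by rw [n9mk_pop, h]) with h5 | ⟨m, hm, h5⟩
      · exact (hS _ h5 (fun i hi => (n9mk_bit τ S i).1 hi)).elim
      · obtain ⟨f, P, Q, s, hP⟩ := hτ m hm
        rw [← hP, n9mk_inter, n9mk_pop] at h5
        rw [h, hr.meet4 h9 h4 s h h5]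

end QMat
end

section

def n9cw (a b c d e : ZMod 3) : Fin 9 → ZMod 3 :=
  ![-(b + c - d + e), -(a + c + d - e), -(a + b + d + e), -(-a + b + c - e), a, b, c, d, e]

theorem n9cwA : ∀ a b c d e : ZMod 3, (∀ i, n9cw a b c d e i = 0) ∨
    (∃ m ∈ n9list, ∀ i : Fin 9, m.testBit i.1 = true → n9cw a b c d e i ≠ 0) ∨
    5 ≤ (Finset.univ.filter fun i => n9cw a b c d e i ≠ 0).card := by decide +kernel

theorem n9cwB : ∀ m ∈ n9list, ∃ a b c d e : ZMod 3, (∃ i, n9cw a b c d e i ≠ 0) ∧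
    ∀ i : Fin 9, n9cw a b c d e i ≠ 0 → m.testBit i.1 = true := by decide +kernel

theorem n9cwC (a b c d e : ZMod 3) : ∑ i, n9cw a b c d e i • N9Cols i = 0 := by
  funext k
  simp only [Finset.sum_apply, Fin.sum_univ_succ, n9cw, N9Cols]
  fin_cases k <;> simp <;> ring

theorem n9cwD (g : Fin 9 → ZMod 3) (h : ∑ i, g i • N9Cols i = 0) :
    g = n9cw (g 4) (g 5) (g 6) (g 7) (g 8) := by
  have h0 := congrFun h 0
  have h1 := congrFun h 1
  have h2 := congrFun h 2
  have h3 := congrFun h 3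
  simp [Finset.sum_apply, Fin.sum_univ_succ, N9Cols] at h0 h1 h2 h3
  funext i
  fin_cases i <;> simp [n9cw]
  · linear_combination h0
  · linear_combination h1
  · linear_combination h2
  · linear_combination h3

open Classical in
theorem n9LI (J : Set (Fin 9)) : LinearIndepOn (ZMod 3) N9Cols J ↔
    J.ncard ≤ 4 ∧ ∀ m ∈ n9list, ¬ ∀ i : Fin 9, m.testBit i.1 = true → i ∈ J := by
  constructor
  · intro h
    refine ⟨?_, ?_⟩
    · have h1 := LinearIndependent.fintype_card_le_finrank h
      simp only [Module.finrank_fintype_fun_eq_card, Fintype.card_fin] at h1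
      rw [← Nat.card_coe_set_eq, Nat.card_eq_fintype_card]
      exact h1
    · intro m hm hJ
      obtain ⟨a, b, c, d, e, ⟨i, hi⟩, hs⟩ := n9cwB m hm
      rw [linearIndepOn_iff''] at h
      have hz : ∀ j, j ∉ (Finset.univ.filter fun i => i ∈ J) → n9cw a b c d e j = 0 := by
        intro j hj
        by_contra hc
        exact hj (by simpa using hJ j (hs j hc))
      refine hi (h (Finset.univ.filter fun i => i ∈ J) (n9cw a b c d e) (by intro x; simp) hz ?_ i ?_)
      · rw [← n9cwC a b c d e]
        apply Finset.sum_subset (Finset.subset_univ _)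
        intro x _ hx
        rw [hz x hx, zero_smul]
      · by_contra hc
        exact hi (hz i hc)
  · rintro ⟨h4, hm⟩
    rw [linearIndepOn_iff'']
    intro t g ht hg hs i hi
    have hs2 : ∑ i, g i • N9Cols i = 0 := by
      rw [← hs]
      symm
      apply Finset.sum_subset (Finset.subset_univ _)
      intro x _ hx
      rw [hg x hx, zero_smul]
    have hw := n9cwD g hs2
    have hJ : ∀ j, g j ≠ 0 → j ∈ J := by
      intro j hj
      by_contra hc
      exact hj (hg j (fun h => hc (ht h)))
    rcases n9cwA (g 4) (g 5) (g 6) (g 7) (g 8) with h | ⟨m, hml, h⟩ | h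
    · rw [hw]; exact h i
    · rw [← hw] at h
      exact (hm m hml fun i hi => hJ i (h i hi)).elim
    · rw [← hw] at h
      have : (Finset.univ.filter fun i => g i ≠ 0).card ≤ J.ncard := by
        rw [← Set.ncard_coe_finset]
        apply Set.ncard_le_ncard
        · intro x hx
          exact hJ x (by simpa using hx)
        · exact Set.toFinite _
      omega
end

section
attribute [-grind] Set.subset_insert

structure PMat {β : Type u} (r : Set β → ℕ) : Prop where
  mono : ∀ {A B : Set β}, A ⊆ B → r A ≤ r B
  submod : ∀ A B : Set β, r (A ∪ B) + r (A ∩ B) ≤ r A + r B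
  ins : ∀ (x : β) (A : Set β), r (insert x A) ≤ r A + 1
  emp : r ∅ = 0
  v4 : ∀ A : Set β, r A < r univ → r Aᶜ < r univ → r univ + 3 ≤ r A + r Aᶜ
  sep : ∀ e : β, ∃ X Y : Set β, X ∪ Y = {e}ᶜ ∧ Disjoint X Y ∧ r X < r {e}ᶜ ∧ r Y < r {e}ᶜ ∧
    r X + r Y ≤ r {e}ᶜ + 2

structure PSep {β : Type u} (r : Set β → ℕ) (e : β) (X Y : Set β) : Prop where
  cov : ∀ z, z = e ∨ z ∈ X ∨ z ∈ Y
  dis : ∀ z, z ∈ X → z ∉ Y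
  eX : e ∉ X
  eY : e ∉ Y
  cX : r (insert e X) = r X + 1
  cY : r (insert e Y) = r Y + 1
  sum : r X + r Y ≤ r univ + 2
  sum2 : r univ + 2 ≤ r X + r Y ∨ 2 * r univ ≤ r X + r Y + 2
  lX : r X < r univ
  lY : r Y < r univ

variable {β : Type u} {r : Set β → ℕ}

theorem PSep.symm {e : β} {X Y : Set β} (h : PSep r e X Y) : PSep r e Y X where
  cov := fun z => by rcases h.cov z with h | h | h <;> simp [h]
  dis := fun z h1 h2 => h.dis z h2 h1
  eX := h.eY
  eY := h.eX
  cX := h.cY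
  cY := h.cX
  sum := by have := h.sum; omega
  sum2 := by have := h.sum2; omega
  lX := h.lY
  lY := h.lX

namespace PMat
variable (hr : PMat r)
include hr

theorem sub {A B I U : Set β} (hI : I ⊆ A ∩ B) (hU : U ⊆ A ∪ B) : r U + r I ≤ r A + r B := by
  have := hr.submod A B
  have := hr.mono hI
  have := hr.mono hU
  omega

theorem le_ncard {A : Set β} (hA : A.Finite) : r A ≤ A.ncard := by
  induction A, hA using Set.Finite.induction_on with
  | empty => simp [hr.emp]
  | @insert a s ha hs ih =>
    rw [Set.ncard_insert_of_notMem ha hs]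
    have := hr.ins a s
    omega

theorem psep (e : β) : ∃ X Y, PSep r e X Y := by
  obtain ⟨X, Y, hu, hd, h1, h2, h3⟩ := hr.sep e
  have hn : r {e}ᶜ = r univ := by
    by_contra hne
    have h4 := hr.mono (subset_univ ({e}ᶜ : Set β))
    have h5 := hr.ins e ∅
    rw [hr.emp] at h5
    simp only [insert_empty_eq] at h5
    have h6 := hr.v4 {e}
    omega
  rw [hn] at h1 h2 h3
  have hd' : ∀ z, z ∈ X → z ∉ Y := fun z hz hz' => Set.disjoint_left.1 hd hz hz'
  have hz : ∀ z, (z ∈ X ∨ z ∈ Y) ↔ z ≠ e := by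
    intro z
    have := Set.ext_iff.1 hu z
    simpa using this
  have heX : e ∉ X := fun h => (hz e).1 (Or.inl h) rfl
  have heY : e ∉ Y := fun h => (hz e).1 (Or.inr h) rfl
  have c1 : (insert e X)ᶜ = Y := by
    ext z
    have := hz z
    have := hd' z
    by_cases z = e <;> grind
  have c2 : (insert e Y)ᶜ = X := by
    ext z
    have := hz z
    have := hd' z
    by_cases z = e <;> grind
  have v1 := hr.v4 (insert e X)
  have v2 := hr.v4 (insert e Y)
  rw [c1] at v1
  rw [c2] at v2
  have i1 := hr.ins e X
  have i2 := hr.ins e Y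
  have m1 := hr.mono (Set.subset_insert e X)
  have m2 := hr.mono (Set.subset_insert e Y)
  refine ⟨X, Y, ⟨?_, hd', heX, heY, ?_, ?_, h3, ?_, h1, h2⟩⟩
  · intro z
    have := hz z
    tauto
  · omega
  · omega
  · omega

theorem one (e : β) : r {e} = 1 := by
  obtain ⟨X, Y, h⟩ := hr.psep e
  have h5 := hr.ins e ∅
  rw [hr.emp] at h5
  simp only [insert_empty_eq] at h5
  have := hr.sub (A := {e}) (B := X) (I := ∅) (U := insert e X) (empty_subset _)
    (by intro z; simp)
  have := h.cX
  omega

theorem pair (x y : β) (hxy : x ≠ y) : r {x, y} = 2 := by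
  have h1 := hr.ins x {y}
  have hx := hr.one x
  have hy := hr.one y
  obtain ⟨X, Y, h⟩ := hr.psep x
  have key : ∀ X Y, PSep r x X Y → y ∈ X → r {x, y} = 2 := by
    intro X Y h hyX
    have := hr.sub (A := {x, y}) (B := X) (I := {y}) (U := insert x X)
      (by intro z; grind) (by intro z; grind)
    have := h.cX
    omega
  rcases h.cov y with h' | h' | h'
  · exact absurd h'.symm hxy
  · exact key X Y h h'
  · exact key Y X h.symm h'

theorem line {L : Set β} {e x y z : β} (he : e ∈ L) (hx : x ∈ L) (hy : y ∈ L) (hz : z ∈ L)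
    (hex : e ≠ x) (hey : e ≠ y) (hez : e ≠ z) (hxy : x ≠ y) (hxz : x ≠ z) (hyz : y ≠ z) :
    3 ≤ r L := by
  obtain ⟨X, Y, h⟩ := hr.psep e
  have key : ∀ X Y, PSep r e X Y → ∀ x y, x ∈ L → y ∈ L → x ≠ y → x ∈ X → y ∈ X → 3 ≤ r L := by
    intro X Y h x y hx hy hxy hxX hyX
    have := hr.sub (A := L) (B := X) (I := {x, y}) (U := insert e X)
      (by intro z; grind) (by intro z; grind)
    have := h.cX
    have := hr.pair x y hxy
    omega
  have k1 := key X Y h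
  have k2 := key Y X h.symm
  rcases h.cov x with h' | h1 | h1
  · exact absurd h'.symm hex
  · rcases h.cov y with h' | h2 | h2
    · exact absurd h'.symm hey
    · exact k1 x y hx hy hxy h1 h2
    · rcases h.cov z with h' | h3 | h3
      · exact absurd h'.symm hez
      · exact k1 x z hx hz hxz h1 h3
      · exact k2 y z hy hz hyz h2 h3
  · rcases h.cov y with h' | h2 | h2
    · exact absurd h'.symm hey
    · rcases h.cov z with h' | h3 | h3
      · exact absurd h'.symm hez
      · exact k1 y z hy hz hyz h2 h3
      · exact k2 x z hx hz hxz h1 h3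
    · exact k2 x y hx hy hxy h1 h2

theorem line4 {L : Set β} (h : (4 : ℕ∞) ≤ L.encard) : 3 ≤ r L := by
  obtain ⟨S, hS, hc⟩ := Set.exists_subset_encard_eq h
  obtain ⟨a, b, c, d, hab, hac, had, hbc, hbd, hcd, rfl⟩ := Set.encard_eq_four.1 hc
  exact hr.line (hS (by simp)) (hS (by simp)) (hS (by simp)) (hS (by simp : d ∈ _)) hab hac had hbc hbd hcd

theorem card3 {L : Set β} (h : r L ≤ 2) : L.Finite ∧ L.ncard ≤ 3 := by
  have h1 : L.encard < 4 := by
    by_contra hc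
    have := hr.line4 (not_lt.1 hc)
    omega
  have hf : L.Finite := Set.encard_ne_top_iff.1 (ne_top_of_lt h1)
  refine ⟨hf, ?_⟩
  rw [← hf.cast_ncard_eq] at h1
  have : L.ncard < 4 := by exact_mod_cast h1
  omega

theorem three_le (h6 : (6 : ℕ∞) ≤ (univ : Set β).encard) : 3 ≤ r univ :=
  hr.line4 (le_trans (by norm_num) h6)

theorem rank3 (h6 : (6 : ℕ∞) ≤ (univ : Set β).encard) (h3 : r univ = 3) :
    ∃ K : Set β, K.ncard = 4 ∧ r Kᶜ < r univ ∧ ∀ K', K' ⊂ K → r univ ≤ r K'ᶜ := by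
  have hne : (univ : Set β).Nonempty := by
    rw [← Set.encard_pos]
    exact lt_of_lt_of_le (by norm_num) h6
  obtain ⟨e, -⟩ := hne
  obtain ⟨X, Y, h⟩ := hr.psep e
  have hXl := hr.card3 (L := X) (by have := h.lX; omega)
  have hYl := hr.card3 (L := Y) (by have := h.lY; omega)
  have hU : (univ : Set β) = insert e (X ∪ Y) := by
    ext z
    have := h.cov z
    simp only [mem_univ, true_iff, mem_insert_iff, mem_union]
    exact this
  have hfin : (univ : Set β).Finite := by
    rw [hU]; exact (hXl.1.union hYl.1).insert e
  have hcU : (univ : Set β).ncard = X.ncard + Y.ncard + 1 := by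
    rw [hU, Set.ncard_insert_of_notMem (by
      intro hc; rcases hc with hc | hc
      · exact h.eX hc
      · exact h.eY hc) (hXl.1.union hYl.1),
      Set.ncard_union_eq (Set.disjoint_left.2 h.dis) hXl.1 hYl.1]
  have h6' : 6 ≤ (univ : Set β).ncard := by
    rw [← hfin.cast_ncard_eq] at h6
    exact_mod_cast h6
  have hsf : ∀ S : Set β, S.Finite := fun S => hfin.subset (subset_univ S)
  have hcc : ∀ S : Set β, Sᶜ.ncard + S.ncard = (univ : Set β).ncard := by
    intro S
    have := Set.ncard_sdiff_add_ncard_of_subset (subset_univ S) hfin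
    rwa [← Set.compl_eq_univ_sdiff] at this
  rw [h3]
  by_cases h7 : (univ : Set β).ncard = 7
  · have := hcc X
    refine ⟨Xᶜ, by omega, by rw [compl_compl]; have := h.lX; omega, ?_⟩
    intro K' hK'
    have h8 := Set.ncard_lt_ncard hK' (hsf _)
    have h9 := hcc K'
    by_contra hlt
    have := hr.card3 (L := K'ᶜ) (by omega)
    omega
  · have key : ∀ X Y, PSep r e X Y → X.ncard = 3 → Y.ncard = 2 → (univ : Set β).ncard = 6 →
        ∃ K : Set β, K.ncard = 4 ∧ r Kᶜ < 3 ∧ ∀ K', K' ⊂ K → 3 ≤ r K'ᶜ := by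
      intro X Y h hX hY hc6
      by_contra hno
      have hz : ∀ x ∈ X, ∃ z ∈ Y, r {e, x, z} ≤ 2 := by
        intro x hx
        by_contra hzz
        push Not at hzz
        have hex : e ≠ x := fun he => h.eX (he ▸ hx)
        have h2 : ({e, x} : Set β).ncard = 2 := Set.ncard_pair hex
        have h4 := hcc {e, x}
        refine hno ⟨{e, x}ᶜ, by omega, by rw [compl_compl, hr.pair e x hex]; omega, ?_⟩
        intro K' hK'
        obtain ⟨z, hz1, hz2⟩ := Set.exists_of_ssubset hK'
        have hsub : ({e, x, z} : Set β) ⊆ K'ᶜ := by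
          intro w hw
          rcases hw with rfl | rfl | rfl
          · exact fun hc => (hK'.1 hc) (by simp)
          · exact fun hc => (hK'.1 hc) (by simp)
          · exact hz2
        have hm := hr.mono hsub
        rcases h.cov z with rfl | hzX | hzY
        · simp at hz1
        · have hxz : x ≠ z := by rintro rfl; simp at hz1
          have := hr.sub (A := {e, x, z}) (B := X) (I := {x, z}) (U := insert e X)
            (by intro z; grind) (by intro z; grind)
          have := h.cX
          have := hr.pair x z hxz
          omega
        · have := hzz z hzY
          omega
      obtain ⟨x1, x2, x3, h12, h13, h23, rfl⟩ := Set.ncard_eq_three.1 hX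
      obtain ⟨y1, y2, hy, rfl⟩ := Set.ncard_eq_two.1 hY
      have kk : ∀ x x' z, x ∈ ({x1, x2, x3} : Set β) → x' ∈ ({x1, x2, x3} : Set β) →
          z ∈ ({y1, y2} : Set β) → x ≠ x' →
          r {e, x, z} ≤ 2 → r {e, x', z} ≤ 2 → False := by
        intro x x' z hx hx' hz hxx a1 a2
        have hez : e ≠ z := fun he => h.eY (he ▸ hz)
        have hex : e ≠ x := fun he => h.eX (he ▸ hx)
        have hex' : e ≠ x' := fun he => h.eX (he ▸ hx')
        have hxz : x ≠ z := fun he => h.dis x hx (he ▸ hz)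
        have hxz' : x' ≠ z := fun he => h.dis x' hx' (he ▸ hz)
        have b1 := hr.sub (A := {e, x, z}) (B := {e, x', z}) (I := {e, z}) (U := {e, x, x', z})
          (by intro z; simp; tauto) (by intro z; simp; tauto)
        have b2 := hr.pair e z hez
        have b3 := hr.line (L := {e, x, x', z}) (e := e) (x := x) (y := x') (z := z)
          (by simp) (by simp) (by simp) (by simp) hex hex' hez hxx hxz hxz'
        omega
      obtain ⟨z1, m1, a1⟩ := hz x1 (by simp)
      obtain ⟨z2, m2, a2⟩ := hz x2 (by simp)
      obtain ⟨z3, m3, a3⟩ := hz x3 (by simp)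
      have c12 : z1 ≠ z2 := fun hc => kk x1 x2 z1 (by simp) (by simp) m1 h12 a1 (hc ▸ a2)
      have c13 : z1 ≠ z3 := fun hc => kk x1 x3 z1 (by simp) (by simp) m1 h13 a1 (hc ▸ a3)
      have c23 : z2 ≠ z3 := fun hc => kk x2 x3 z2 (by simp) (by simp) m2 h23 a2 (hc ▸ a3)
      simp only [mem_insert_iff, mem_singleton_iff] at m1 m2 m3
      grind
    have : (X.ncard = 3 ∧ Y.ncard = 2) ∨ (X.ncard = 2 ∧ Y.ncard = 3) := by omega
    rcases this with ⟨a, b⟩ | ⟨a, b⟩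
    · exact key X Y h a b (by omega)
    · exact key Y X h.symm b a (by omega)

theorem toQ (h4 : 4 ≤ r univ)
    (hC4 : ∀ K : Set β, K.ncard = 4 → r Kᶜ < r univ → (∀ K', K' ⊂ K → r univ ≤ r K'ᶜ) → False)
    (hC5 : ∀ K T : Set β, K.ncard = 5 → r Kᶜ < r univ → (∀ K', K' ⊂ K → r univ ≤ r K'ᶜ) →
      T ⊆ K → T.ncard = 3 → r T ≤ 2 → False) : QMat r := by
  have hco : ∀ n, ∀ K : Set β, K.Finite → K.ncard = n → r Kᶜ < r univ → 5 ≤ K.ncard := by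
    intro n
    induction n using Nat.strong_induction_on with
    | _ n ih =>
      intro K hK hn hlt
      by_contra hc
      by_cases hmin : ∀ K', K' ⊂ K → r univ ≤ r K'ᶜ
      · by_cases h4 : K.ncard = 4
        · exact hC4 K h4 hlt hmin
        · have := hr.le_ncard hK
          have := hr.v4 K
          omega
      · push Not at hmin
        obtain ⟨K', hK', hl⟩ := hmin
        have := Set.ncard_lt_ncard hK' hK
        have := ih K'.ncard (by omega) K' (hK.subset hK'.1) rfl hl
        omega
  have hco' : ∀ K : Set β, K.Finite → r Kᶜ < r univ → 5 ≤ K.ncard := fun K hK => hco _ K hK rfl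
  refine ⟨hr.mono, hr.submod, hr.ins, hr.emp, hr.pair, h4, hr.v4, hco', ?_, ?_⟩
  · intro K T hK hlt hT hT3
    by_contra hc
    have hf : K.Finite := Set.finite_of_ncard_ne_zero (by omega)
    refine hC5 K T hK hlt ?_ hT hT3 (by omega)
    intro K' hK'
    by_contra hcc
    have := hco' K' (hf.subset hK'.1) (by omega)
    have := Set.ncard_lt_ncard hK' hf
    omega
  · intro e
    obtain ⟨X, Y, h⟩ := hr.psep e
    refine ⟨X, Y, h.cov, h.dis, h.eX, h.eY, h.cX, h.cY, ?_, h.lX, h.lY⟩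
    have := h.sum
    have := h.sum2
    have := h.lX
    have := h.lY
    omega

end PMat
end

section
variable {α : Type u}

theorem mrk_eq (M : Matroid α) (X : Set α) : mrk M X = M.eRk X := by
  apply le_antisymm
  · apply iSup₂_le
    rintro I ⟨hI, hX⟩
    exact hI.encard_le_eRk_of_subset hX
  · obtain ⟨I, hI⟩ := M.exists_isBasis' X
    rw [← hI.encard_eq_eRk]
    exact le_iSup₂_of_le (f := fun (I : Set α) (_ : I ∈ {I : Set α | M.Indep I ∧ I ⊆ X}) => I.encard)
      I ⟨hI.indep, hI.subset⟩ le_rfl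

theorem mrank_eq (M : Matroid α) : mrank M = M.eRank := by
  rw [mrank, mrk_eq, M.eRank_def]

theorem vc_finite (M : Matroid α) (h : VertConn M 4) : M.RankFinite := by
  rw [← Matroid.eRank_ne_top_iff]
  intro htop
  obtain ⟨B, hB⟩ := M.exists_isBase
  have hBt : B.encard = ⊤ := by rw [hB.encard_eq_eRank, htop]
  have h2 : (2 : ℕ∞) ≤ B.encard := by rw [hBt]; exact le_top
  obtain ⟨S, hS, hc⟩ := Set.exists_subset_encard_eq h2
  obtain ⟨a, b, hab, rfl⟩ := Set.encard_eq_two.1 hc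
  have haB : a ∈ B := hS (by simp)
  have hbB : b ∈ B := hS (by simp)
  have hB' := hB.subset_ground
  have i1 : ∀ x ∈ B, ∀ X : Set α, x ∈ X → (1 : ℕ∞) ≤ mrk M X := by
    intro x hx X hX
    rw [mrk_eq, ← Set.encard_singleton x]
    exact (hB.indep.subset (by simpa using hx)).encard_le_eRk_of_subset (by simpa using hX)
  refine h 1 {a} (M.E \ {a}) one_pos (by norm_num) ⟨?_, ?_, ?_, ?_, ?_⟩
  · exact Set.union_sdiff_cancel (by simpa using hB' haB)
  · exact Set.disjoint_sdiff_right
  · rw [lam, mrank_eq, htop]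
    simp
  · exact i1 a haB _ rfl
  · exact i1 b hbB _ ⟨hB' hbB, fun hc => hab hc.symm⟩

noncomputable def mr (M : Matroid α) (X : Set M.E) : ℕ := (M.eRk (Subtype.val '' X)).toNat

theorem mr_coe (M : Matroid α) [M.RankFinite] (X : Set M.E) :
    (mr M X : ℕ∞) = M.eRk (Subtype.val '' X) := by
  apply ENat.coe_toNat
  exact ne_top_of_le_ne_top ((Matroid.eRank_ne_top_iff M).2 inferInstance) (M.eRk_le_eRank _)

theorem mr_univ (M : Matroid α) [M.RankFinite] : (mr M univ : ℕ∞) = M.eRank := by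
  rw [mr_coe]; simp

theorem img_compl (M : Matroid α) (X : Set M.E) :
    (Subtype.val '' Xᶜ : Set α) = M.E \ Subtype.val '' X := by
  ext z
  constructor
  · rintro ⟨w, hw, rfl⟩
    refine ⟨w.2, ?_⟩
    rintro ⟨v, hv, hvw⟩
    exact hw (Subtype.ext hvw ▸ hv)
  · rintro ⟨h1, h2⟩
    exact ⟨⟨z, h1⟩, fun hc => h2 ⟨_, hc, rfl⟩, rfl⟩

theorem img_pre (M : Matroid α) (X : Set α) (hX : X ⊆ M.E) :
    (Subtype.val '' (Subtype.val ⁻¹' X : Set M.E) : Set α) = X := by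
  rw [Subtype.image_preimage_coe]
  exact Set.inter_eq_right.2 hX

theorem mr_pmat (M : Matroid α) [M.RankFinite] (hM : MinVertConn4 M) : PMat (mr M) where
  mono := by
    intro A B h
    have : (mr M A : ℕ∞) ≤ mr M B := by
      rw [mr_coe, mr_coe]; exact M.eRk_mono (Set.image_mono h)
    exact_mod_cast this
  submod := by
    intro A B
    have : (mr M (A ∪ B) : ℕ∞) + mr M (A ∩ B) ≤ mr M A + mr M B := by
      simp only [mr_coe]
      rw [Set.image_union, Set.image_inter Subtype.val_injective, add_comm]
      exact M.eRk_inter_add_eRk_union_le _ _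
    exact_mod_cast this
  ins := by
    intro x A
    have : (mr M (insert x A) : ℕ∞) ≤ mr M A + 1 := by
      simp only [mr_coe]
      rw [Set.image_insert_eq]
      exact M.eRk_insert_le_add_one _ _
    exact_mod_cast this
  emp := by simp [mr]
  v4 := by
    intro A h1 h2
    by_contra hlt
    have hsub : mr M univ ≤ mr M A + mr M Aᶜ := by
      have : (mr M univ : ℕ∞) ≤ mr M A + mr M Aᶜ := by
        simp only [mr_coe]
        have := M.eRk_union_le_eRk_add_eRk (Subtype.val '' A) (Subtype.val '' Aᶜ)
        rwa [← Set.image_union, Set.union_compl_self] at this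
      exact_mod_cast this
    refine hM.1 (mr M A + mr M Aᶜ - mr M univ + 1) (Subtype.val '' A) (Subtype.val '' Aᶜ)
      (by omega) (by omega) ⟨?_, ?_, ?_, ?_, ?_⟩
    · rw [← Set.image_union, Set.union_compl_self]; simp
    · rw [img_compl]; exact Set.disjoint_sdiff_right
    · rw [lam, mrk_eq, mrk_eq, mrank_eq, ← img_compl, ← mr_coe, ← mr_coe, ← mr_univ]
      norm_cast
      omega
    · rw [mrk_eq, ← mr_coe]
      norm_cast
      omega
    · rw [mrk_eq, ← mr_coe]
      norm_cast
      omega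
  sep := by
    intro e
    have h := hM.2 e.1 e.2
    unfold VertConn at h
    push Not at h
    obtain ⟨j, X, Y, hj0, hj4, hu, hd, hl, hX, hY⟩ := h
    have hE : (mdel M {e.1}).E = M.E \ {e.1} := rfl
    rw [hE] at hu
    have hXs : X ⊆ M.E \ {e.1} := hu ▸ Set.subset_union_left
    have hYs : Y ⊆ M.E \ {e.1} := hu ▸ Set.subset_union_right
    have hYX : (M.E \ {e.1}) \ X = Y := by
      rw [← hu, Set.union_sdiff_left]
      exact hd.sdiff_eq_right
    have hm : ∀ Z ⊆ M.E \ {e.1}, mrk (mdel M {e.1}) Z = mr M (Subtype.val ⁻¹' Z) := by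
      intro Z hZ
      rw [mrk_eq, mdel, M.restrict_eRk_eq hZ, mr_coe, img_pre M Z (hZ.trans Set.sdiff_subset)]
    have hec : (Subtype.val ⁻¹' (M.E \ {e.1}) : Set M.E) = {e}ᶜ := by
      ext z
      simp [Subtype.ext_iff]
    rw [lam, mrank, hE, hYX, hm X hXs, hm Y hYs, hm _ subset_rfl, hec] at hl
    rw [hm X hXs] at hX
    rw [hm Y hYs] at hY
    norm_cast at hl hX hY
    refine ⟨Subtype.val ⁻¹' X, Subtype.val ⁻¹' Y, ?_, ?_, ?_, ?_, ?_⟩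
    · rw [← Set.preimage_union, hu, hec]
    · exact hd.preimage _
    · omega
    · omega
    · omega

theorem mr_coindep (M : Matroid α) [M.RankFinite] (K : Set M.E) :
    M✶.Indep (Subtype.val '' K) ↔ mr M univ ≤ mr M Kᶜ := by
  rw [← Matroid.coindep_def, Matroid.coindep_iff_compl_spanning (by simp),
    Matroid.spanning_iff_eRk_le Set.sdiff_subset, ← mr_univ, ← img_compl, ← mr_coe]
  norm_cast

theorem mr_indep (M : Matroid α) [M.RankFinite] (S : Set M.E) (hS : S.Finite) :
    M.Indep (Subtype.val '' S) ↔ mr M S = S.ncard := by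
  rw [Matroid.indep_iff_eRk_eq_encard, ← mr_coe, Subtype.val_injective.encard_image,
    ← hS.cast_ncard_eq]
  norm_cast

theorem mr_cocircuit (M : Matroid α) [M.RankFinite] (K : Set M.E) (h1 : mr M Kᶜ < mr M univ)
    (h2 : ∀ K', K' ⊂ K → mr M univ ≤ mr M K'ᶜ) : MCocircuit M (Subtype.val '' K) := by
  refine ⟨⟨fun h => ?_, by simp⟩, ?_⟩
  · rw [mr_coindep] at h; omega
  · intro D hD
    have hDE : D ⊆ M.E := hD.1.trans (by simp)
    rw [← img_pre M D hDE, mr_coindep]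
    apply h2
    rw [← img_pre M D hDE] at hD
    exact (Subtype.val_injective.injOn.image_ssubset_image_iff (subset_univ _) (subset_univ _)).1 hD

theorem mr_triangle (M : Matroid α) [M.RankFinite] (hp : PMat (mr M)) (T : Set M.E)
    (h3 : T.ncard = 3) (h2 : mr M T ≤ 2) : IsTriangle M (Subtype.val '' T) := by
  have hf : T.Finite := Set.finite_of_ncard_ne_zero (by omega)
  refine ⟨⟨⟨fun h => ?_, by simp⟩, ?_⟩, ?_⟩
  · rw [mr_indep M T hf] at h; omega
  · intro D hD
    have hDE : D ⊆ M.E := hD.1.trans (by simp)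
    rw [← img_pre M D hDE] at hD ⊢
    have hD' := (Subtype.val_injective.injOn.image_ssubset_image_iff (subset_univ _) (subset_univ _)).1 hD
    generalize (Subtype.val ⁻¹' D : Set M.E) = S at hD'
    have hSf := hf.subset hD'.1
    rw [mr_indep M S hSf]
    have := Set.ncard_lt_ncard hD' hf
    have hcase : S.ncard = 0 ∨ S.ncard = 1 ∨ S.ncard = 2 := by omega
    rcases hcase with h | h | h
    · rw [(Set.ncard_eq_zero hSf).1 h, hp.emp]; simp
    · obtain ⟨x, rfl⟩ := Set.ncard_eq_one.1 h
      rw [h, hp.one]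
    · obtain ⟨x, y, hxy, rfl⟩ := Set.ncard_eq_two.1 h
      rw [h, hp.pair x y hxy]
  · rw [Subtype.val_injective.encard_image, ← hf.cast_ncard_eq, h3]
    rfl

theorem n9final (M : Matroid α) [M.RankFinite] (h : QMat (mr M)) : IsoN9 M := by
  obtain ⟨τ, hτ⟩ := h.n9main
  classical
  have hfin : ∀ S : Set M.E, S.Finite := by
    intro S
    have : Finite M.E := Finite.of_equiv _ τ
    exact Set.toFinite S
  refine ⟨fun a => if ha : a ∈ M.E then τ.symm ⟨a, ha⟩ else 0, ?_, ?_⟩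
  · refine ⟨fun _ _ => mem_univ _, ?_, ?_⟩
    · intro a ha b hb hab
      simp only [dif_pos ha, dif_pos hb] at hab
      exact congrArg Subtype.val (τ.symm.injective hab)
    · intro i _
      exact ⟨(τ i).1, (τ i).2, by simp⟩
  · intro I hI
    set φ : α → Fin 9 := fun a => if ha : a ∈ M.E then τ.symm ⟨a, ha⟩ else 0 with hφ
    have hinj : Set.InjOn φ I := by
      intro a ha b hb hab
      simp only [hφ, dif_pos (hI ha), dif_pos (hI hb)] at hab
      exact congrArg Subtype.val (τ.symm.injective hab)
    have hL : (LinearIndependent (ZMod 3) fun x : I => N9Cols (φ x.1)) ↔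
        LinearIndepOn (ZMod 3) N9Cols (φ '' I) := by
      exact linearIndependent_equiv' (hinj.bijOn_image.equiv φ) rfl
    rw [hL, n9LI, ← img_pre M I hI]
    generalize hS : (Subtype.val ⁻¹' I : Set M.E) = S
    have hmem : ∀ i, i ∈ φ '' (Subtype.val '' S) ↔ τ i ∈ S := by
      intro i
      constructor
      · rintro ⟨_, ⟨w, hw, rfl⟩, rfl⟩
        simp [hφ]
        exact hw
      · intro hi
        exact ⟨_, ⟨_, hi, rfl⟩, by simp [hφ]⟩
    have hn : (φ '' (Subtype.val '' S)).ncard = S.ncard := by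
      have : φ '' (Subtype.val '' S) = τ.symm '' S := by
        ext i
        rw [hmem]
        simp
      rw [this, Set.ncard_image_of_injective _ τ.symm.injective]
    rw [mr_indep M S (hfin S), hτ S, hn]
    simp only [hmem]

theorem n9mainM (M : Matroid α) (hM : MinVertConn4 M) (hcard : 6 ≤ M.E.encard)
    (hN9 : ¬ IsoN9 M) :
    (∃ C, MCocircuit M C ∧ C.encard = 4) ∨
    (∃ C, MCocircuit M C ∧ C.encard = 5 ∧ ∃ T ⊆ C, IsTriangle M T) := by
  have hfin : M.RankFinite := vc_finite M hM.1
  have hp := mr_pmat M hM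
  have h6 : (6 : ℕ∞) ≤ (univ : Set M.E).encard := by
    rw [← Subtype.val_injective.encard_image, Set.image_univ, Subtype.range_coe]
    exact hcard
  have hcd : ∀ (K : Set M.E) (n : ℕ), 0 < n → K.ncard = n →
      (Subtype.val '' K : Set α).encard = (n : ℕ∞) := by
    intro K n hn h
    have hf : K.Finite := Set.finite_of_ncard_ne_zero (by omega)
    rw [Subtype.val_injective.encard_image, ← hf.cast_ncard_eq, h]
  have h3 := hp.three_le h6
  by_cases h4 : mr M univ = 3
  · obtain ⟨K, hK4, hK, hmin⟩ := hp.rank3 h6 h4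
    exact Or.inl ⟨_, mr_cocircuit M K hK hmin, hcd K 4 (by norm_num) hK4⟩
  · by_contra hno
    push Not at hno
    refine hN9 (n9final M (hp.toQ (by omega) ?_ ?_))
    · intro K hK4 hK hmin
      exact hno.1 _ (mr_cocircuit M K hK hmin) (hcd K 4 (by norm_num) hK4)
    · intro K T hK5 hK hmin hT hT3 hT2
      exact hno.2 _ (mr_cocircuit M K hK hmin) (hcd K 5 (by norm_num) hK5) _
        (Set.image_mono hT) (mr_triangle M hp T hT3 hT2)
end

/-- Every minimally vertically 4-connected matroid with at least six elements that is not
isomorphic to `N₉` has a 4-element cocircuit, or a 5-element cocircuit containing a triangle. -/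
theorem statement_0 (M : Matroid α) (hM : MinVertConn4 M) (hcard : 6 ≤ M.E.encard)
    (hN9 : ¬ IsoN9 M) :
    (∃ C, MCocircuit M C ∧ C.encard = 4) ∨
    (∃ C, MCocircuit M C ∧ C.encard = 5 ∧ ∃ T ⊆ C, IsTriangle M T) := by
  exact n9mainM M hM hcard hN9
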